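/- arXiv:0706.1326 — 5 statements merged into one kernel-verified Lean document; each statement's English description precedes it below -/
import Mathlib

section
/- Every Urysohn sphere S is 1/3-indivisible. -/
open Metric

/-- A metric space is ultrahomogeneous if every isometry between two finite
subspaces extends to a surjective self-isometry of the whole space. -/
def IsUltrahomogeneous (X : Type*) [MetricSpace X] : Prop :=
  ∀ F : Set X, F.Finite → ∀ φ : F → X, Isometry φ →
    ∃ ψ : X ≃ᵢ X, ∀ x : F, ψ x = φ x

/-- A metric space `X` is `ε`-indivisible if for every finite coloring there
is a color `i` and a subset `Y ⊆ X` isometric to `X` with every point of `Y`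
within distance `ε` of the `i`-th color class. -/
def EpsIndivisible (X : Type*) [MetricSpace X] (ε : ℝ) : Prop :=
  ∀ k : ℕ, 0 < k → ∀ χ : X → Fin k, ∃ i : Fin k, ∃ e : X → X, Isometry e ∧
    ∀ z : X, ∃ x : X, χ x = i ∧ dist (e z) x ≤ ε

/-- Approximate indivisibility (oscillation stability): `ε`-indivisible for
every `ε > 0`. -/
def ApproxIndivisible (X : Type*) [MetricSpace X] : Prop :=
  ∀ ε : ℝ, 0 < ε → EpsIndivisible X ε

/-- Exact indivisibility: some color class contains an isometric copy of `X`. -/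
def Indivisible (X : Type*) [MetricSpace X] : Prop :=
  ∀ k : ℕ, 0 < k → ∀ χ : X → Fin k, ∃ i : Fin k, ∃ e : X → X, Isometry e ∧
    ∀ z : X, χ (e z) = i

/-- The Urysohn sphere: complete, separable, ultrahomogeneous, of diameter at
most `1`, and universal for separable metric spaces of diameter at most `1`. -/
def IsUrysohnSphere (S : Type) [MetricSpace S] : Prop :=
  CompleteSpace S ∧ TopologicalSpace.SeparableSpace S ∧ IsUltrahomogeneous S ∧
  (∀ x y : S, dist x y ≤ 1) ∧
  ∀ (Y : Type) [MetricSpace Y], TopologicalSpace.SeparableSpace Y →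
    (∀ a b : Y, dist a b ≤ 1) → ∃ f : Y → S, Isometry f

/-- The rational Urysohn sphere: countable, ultrahomogeneous, with distances in
`ℚ ∩ [0,1]`, universal for countable metric spaces with distances in `ℚ ∩ [0,1]`. -/
def IsRationalUrysohnSphere (S : Type) [MetricSpace S] : Prop :=
  Countable S ∧ IsUltrahomogeneous S ∧
  (∀ x y : S, ∃ q : ℚ, 0 ≤ q ∧ q ≤ 1 ∧ dist x y = q) ∧
  ∀ (Y : Type) [MetricSpace Y], Countable Y →
    (∀ a b : Y, ∃ q : ℚ, 0 ≤ q ∧ q ≤ 1 ∧ dist a b = q) →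
    ∃ f : Y → S, Isometry f

/-- `[0,1]_m = {k/m : 0 ≤ k ≤ m}`. -/
def distSetM (m : ℕ) : Set ℝ := {d | ∃ k : ℕ, k ≤ m ∧ d = (k : ℝ) / m}

/-- The space `S_m`: countable, ultrahomogeneous, with distances in `[0,1]_m`,
universal for countable metric spaces with distances in `[0,1]_m`. -/
def IsUrysohnSphereM (m : ℕ) (S : Type) [MetricSpace S] : Prop :=
  Countable S ∧ IsUltrahomogeneous S ∧
  (∀ x y : S, dist x y ∈ distSetM m) ∧
  ∀ (Y : Type) [MetricSpace Y], Countable Y →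
    (∀ a b : Y, dist a b ∈ distSetM m) → ∃ f : Y → S, Isometry f

/-- An integer-valued metric with values in `{0, …, 4}`. -/
structure GridMetric (V : Type*) where
  /-- the distance function -/
  d : V → V → ℕ
  self : ∀ x, d x x = 0
  eq_of : ∀ x y, d x y = 0 → x = y
  comm : ∀ x y, d x y = d y x
  tri : ∀ x y z, d x z ≤ d x y + d y z
  le_four : ∀ x y, d x y ≤ 4

/-- The minimum of `4` and the elements of `A`. -/
noncomputable def minFour (A : Set ℕ) : ℕ := sInf (insert 4 A)

lemma minFour_le_four (A : Set ℕ) : minFour A ≤ 4 := Nat.sInf_le (Set.mem_insert _ _)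

lemma minFour_le {A : Set ℕ} {a : ℕ} (h : a ∈ A) : minFour A ≤ a :=
  Nat.sInf_le (Set.mem_insert_of_mem _ h)

lemma minFour_eq_or_mem (A : Set ℕ) : minFour A = 4 ∨ minFour A ∈ A :=
  Nat.sInf_mem (Set.insert_nonempty 4 A)

namespace GridMetric

variable {V : Type*} (M : GridMetric V)

/-- On the finite set `F`, the function `f` is the list of distances to a possible new point. -/
def IsType (F : Finset V) (f : V → ℕ) : Prop :=
  (∀ x ∈ F, 1 ≤ f x ∧ f x ≤ 4) ∧
    ∀ x ∈ F, ∀ y ∈ F, f x ≤ f y + M.d x y ∧ M.d x y ≤ f x + f y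

/-- `C` realizes every type over each of its finite subsets. -/
def Rich (C : Set V) : Prop :=
  ∀ F : Finset V, ↑F ⊆ C → ∀ f, M.IsType F f → ∃ y ∈ C, ∀ x ∈ F, M.d y x = f x

variable {M}

lemma IsType.mono {F G : Finset V} {f : V → ℕ} (hf : M.IsType G f) (h : F ⊆ G) :
    M.IsType F f :=
  ⟨fun x hx => hf.1 x (h hx), fun x hx y hy => hf.2 x (h hx) y (h hy)⟩

lemma IsType.congr {F : Finset V} {f g : V → ℕ} (hf : M.IsType F f)
    (h : ∀ x ∈ F, g x = f x) : M.IsType F g := by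
  refine ⟨fun x hx => ?_, fun x hx y hy => ?_⟩
  · rw [h x hx]; exact hf.1 x hx
  · rw [h x hx, h y hy]; exact hf.2 x hx y hy

lemma isType_d {F : Finset V} {y : V} (hy : y ∉ F) : M.IsType F (M.d y) := by
  refine ⟨fun x hx => ⟨?_, M.le_four _ _⟩, fun x _ z _ => ?_⟩
  · by_contra h
    exact hy (M.eq_of y x (by omega) ▸ hx)
  · have h1 := M.tri y z x
    have h2 := M.tri x y z
    rw [M.comm z x] at h1
    rw [M.comm x y] at h2
    omega

/-- Types extend to larger finite sets. -/
lemma IsType.exists_extension {F : Finset V} {f : V → ℕ} (hf : M.IsType F f) (G : Finset V) :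
    ∃ g, M.IsType G g ∧ ∀ x ∈ F, g x = f x := by
  let A : V → Set ℕ := fun x => {n | ∃ q ∈ F, n = f q + M.d q x}
  refine ⟨fun x => minFour (A x), ⟨fun x _ => ⟨?_, minFour_le_four _⟩, fun x _ y _ => ⟨?_, ?_⟩⟩,
    fun x hx => ?_⟩ <;> beta_reduce
  · rcases minFour_eq_or_mem (A x) with h | ⟨q, hq, h⟩
    · omega
    · have := (hf.1 q hq).1
      omega
  · have h4 := minFour_le_four (A x)
    rcases minFour_eq_or_mem (A y) with h | ⟨q, hq, h⟩
    · omega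
    · have h1 := minFour_le (A := A x) ⟨q, hq, rfl⟩
      have h2 := M.tri q y x
      have h3 := M.comm x y
      omega
  · have h4 := M.le_four x y
    rcases minFour_eq_or_mem (A x) with h | ⟨q, hq, h⟩
    · omega
    rcases minFour_eq_or_mem (A y) with h' | ⟨q', hq', h'⟩
    · omega
    have h1 := (hf.2 q hq q' hq').2
    have h2 := M.tri x q y
    have h3 := M.tri q q' y
    have h5 := M.comm x q
    omega
  · have h1 := minFour_le (A := A x) ⟨x, hx, rfl⟩
    have h2 := M.self x
    have h3 := (hf.1 x hx).2
    rcases minFour_eq_or_mem (A x) with h | ⟨q, hq, h⟩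
    · omega
    · have h4 := (hf.2 x hx q hq).1
      have h5 := M.comm x q
      omega

lemma exists_finite_representatives (F : Finset V) :
    ∃ E : Finset (V → ℕ), ∀ f, M.IsType F f → ∃ g ∈ E, ∀ x ∈ F, g x = f x := by
  classical
  refine ⟨Finset.univ.image fun (g : F → Fin 5) v => if h : v ∈ F then (g ⟨v, h⟩ : ℕ) else 0,
    fun f hf => ⟨_, Finset.mem_image_of_mem _ (Finset.mem_univ
      fun v : F => ⟨f v, Nat.lt_succ_of_le (hf.1 v v.2).2⟩), fun x hx => ?_⟩⟩
  simp [hx]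

/-- If every type over the support of a state is realized in the support of a later state, then
some sequence of states has a rich union of supports. -/
lemma exists_rich_iUnion {σ : Type*} (supp : σ → Finset V)
    (step : ∀ s f, M.IsType (supp s) f →
      ∃ s', supp s ⊆ supp s' ∧ ∃ y ∈ supp s', ∀ x ∈ supp s, M.d y x = f x) (s₀ : σ) :
    ∃ s : ℕ → σ, s 0 = s₀ ∧ M.Rich (⋃ n, (supp (s n) : Set V)) := by
  classical
  have all : ∀ s, ∃ s', supp s ⊆ supp s' ∧ ∀ f, M.IsType (supp s) f →
      ∃ y ∈ supp s', ∀ x ∈ supp s, M.d y x = f x := by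
    intro s
    obtain ⟨E, hE⟩ := exists_finite_representatives (M := M) (supp s)
    have key : ∀ E : Finset (V → ℕ), ∃ s', supp s ⊆ supp s' ∧ ∀ f ∈ E, M.IsType (supp s) f →
        ∃ y ∈ supp s', ∀ x ∈ supp s, M.d y x = f x := by
      intro E
      induction E using Finset.induction_on with
      | empty => exact ⟨s, subset_rfl, by simp⟩
      | insert g E _ ih =>
        obtain ⟨s', hs, h⟩ := ih
        by_cases hg : M.IsType (supp s) g
        · obtain ⟨g', hg', hgg⟩ := hg.exists_extension (supp s')
          obtain ⟨s'', hs', y, hy, hyx⟩ := step s' g' hg'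
          refine ⟨s'', hs.trans hs', fun f hf hft => ?_⟩
          rcases Finset.mem_insert.1 hf with rfl | hf
          · exact ⟨y, hy, fun x hx => (hyx x (hs hx)).trans (hgg x hx)⟩
          · obtain ⟨z, hz, hzx⟩ := h f hf hft
            exact ⟨z, hs' hz, hzx⟩
        · refine ⟨s', hs, fun f hf hft => ?_⟩
          rcases Finset.mem_insert.1 hf with rfl | hf
          · exact absurd hft hg
          · exact h f hf hft
    obtain ⟨s', hs, h⟩ := key E
    refine ⟨s', hs, fun f hf => ?_⟩
    obtain ⟨g, hg, hgf⟩ := hE f hf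
    obtain ⟨y, hy, hyx⟩ := h g hg (hf.congr hgf)
    exact ⟨y, hy, fun x hx => (hyx x hx).trans (hgf x hx)⟩
  choose next hnext hreal using all
  let s : ℕ → σ := fun n => Nat.rec s₀ (fun _ => next) n
  have hmono : Monotone fun n => supp (s n) := monotone_nat_of_le_succ fun n => hnext (s n)
  refine ⟨s, rfl, fun F hF f hf => ?_⟩
  have hFn : ∃ n, F ⊆ supp (s n) := by
    clear hf
    induction F using Finset.induction_on with
    | empty => exact ⟨0, by simp⟩
    | insert a F _ ih =>
      rw [Finset.coe_insert, Set.insert_subset_iff] at hF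
      obtain ⟨n, hn⟩ := ih hF.2
      obtain ⟨k, hk⟩ := Set.mem_iUnion.1 hF.1
      exact ⟨max n k, Finset.insert_subset (hmono (le_max_right n k) hk)
        (hn.trans (hmono (le_max_left n k)))⟩
  obtain ⟨n, hn⟩ := hFn
  obtain ⟨g, hg, hgf⟩ := hf.exists_extension (supp (s n))
  obtain ⟨y, hy, hyx⟩ := hreal (s n) g hg
  exact ⟨y, Set.mem_iUnion.2 ⟨n + 1, hy⟩, fun x hx => (hyx x (hn hx)).trans (hgf x hx)⟩

/-- Glue a type over `F` and a type over `S`. -/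
lemma IsType.union [DecidableEq V] {S F : Finset V} {t f : V → ℕ} (ht : M.IsType S t)
    (hf : M.IsType F f)
    (h : ∀ s ∈ S, s ∉ F → ∀ x ∈ F,
      t s ≤ f x + M.d s x ∧ f x ≤ t s + M.d s x ∧ M.d s x ≤ t s + f x) :
    M.IsType (S ∪ F) fun v => if v ∈ F then f v else t v := by
  have key : ∀ x ∈ S ∪ F, x ∉ F → x ∈ S := fun x hx hxF =>
    (Finset.mem_union.1 hx).resolve_right hxF
  refine ⟨fun x hx => ?_, fun x hx y hy => ?_⟩
  · by_cases hxF : x ∈ F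
    · simpa [hxF] using hf.1 x hxF
    · simpa [hxF] using ht.1 x (key x hx hxF)
  · by_cases hxF : x ∈ F <;> by_cases hyF : y ∈ F <;> simp only [hxF, hyF, if_true, if_false]
    · exact hf.2 x hxF y hyF
    · have := h y (key y hy hyF) hyF x hxF
      have := M.comm x y
      omega
    · have := h x (key x hx hxF) hxF y hyF
      omega
    · exact ht.2 x (key x hx hxF) y (key y hy hyF)

variable (M) in
/-- The points of `C` realizing `f` over `F`. -/
def realizations (C : Set V) (F : Finset V) (f : V → ℕ) : Set V :=
  {y | y ∈ C ∧ ∀ x ∈ F, M.d y x = f x}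

lemma realizations_congr {C : Set V} {F : Finset V} {f g : V → ℕ} (h : ∀ x ∈ F, f x = g x) :
    M.realizations C F f = M.realizations C F g := by
  ext y
  exact and_congr_right fun _ => forall₂_congr fun x hx => by rw [h x hx]

lemma realizations_subset {C C' : Set V} {F G : Finset V} {f g : V → ℕ} (hC : C' ⊆ C)
    (hFG : F ⊆ G) (h : ∀ x ∈ F, g x = f x) :
    M.realizations C' G g ⊆ M.realizations C F f :=
  fun _ hy => ⟨hC hy.1, fun x hx => (hy.2 x (hFG hx)).trans (h x hx)⟩

/-- If the complement of `X` in `C` has no rich subset, then every type with values at least `2`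
extends to a type all of whose realizations lie in `X`. -/
lemma exists_extension_realizations_subset {C X : Set V}
    (hX : ∀ D ⊆ C \ X, ¬ M.Rich D) {F : Finset V} (hF : ↑F ⊆ C) {b : V → ℕ}
    (hb : M.IsType F b) (hb2 : ∀ x ∈ F, 2 ≤ b x) :
    ∃ G : Finset V, F ⊆ G ∧ ↑G ⊆ C ∧ ∃ g, M.IsType G g ∧ (∀ x ∈ F, g x = b x) ∧
      M.realizations C G g ⊆ X := by
  classical
  by_contra! hcon
  let σ := {S : Finset V // ∀ s ∈ S, s ∈ C \ X ∧ ∀ x ∈ F, M.d s x = b x}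
  obtain ⟨s, -, hs⟩ := exists_rich_iUnion (M := M) (σ := σ) Subtype.val (fun S t ht => by
    have hdisj : ∀ s ∈ S.1, s ∉ F := fun s hs hsF => by
      have := (S.2 s hs).2 s hsF
      have := hb2 s hsF
      have := M.self s
      omega
    have htype := ht.union hb fun s hs _ x hx => by
      have h1 := (S.2 s hs).2 x hx
      have h2 := ht.1 s hs
      have h3 := hb2 x hx
      omega
    have hSF : ↑(S.1 ∪ F) ⊆ C := by
      intro x hx
      rcases Finset.mem_union.1 (Finset.mem_coe.1 hx) with hx | hx
      · exact (S.2 x hx).1.1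
      · exact hF hx
    obtain ⟨y, hy, hyX⟩ := Set.not_subset.1 <|
      hcon (S.1 ∪ F) Finset.subset_union_right hSF _ htype (fun x hx => by simp [hx])
    refine ⟨⟨insert y S.1, fun s hs => ?_⟩, Finset.subset_insert _ _, y,
      Finset.mem_insert_self _ _, fun x hx => ?_⟩
    · rcases Finset.mem_insert.1 hs with rfl | hs
      · refine ⟨⟨hy.1, hyX⟩, fun x hx => ?_⟩
        simpa [hx] using hy.2 x (Finset.mem_union_right _ hx)
      · exact S.2 s hs
    · simpa [hdisj x hx] using hy.2 x (Finset.mem_union_left _ hx)) ⟨∅, by simp⟩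
  exact hX _ (Set.iUnion_subset fun n x hx => ((s n).2 x hx).1) hs

/-- The functions `e` and `f` are at distance at most `D` on `Y`. -/
def Near (Y : Finset V) (e f : V → ℕ) (D : ℕ) : Prop :=
  ∀ q ∈ Y, e q ≤ f q + D ∧ f q ≤ e q + D

lemma Near.symm {Y : Finset V} {e f : V → ℕ} {D : ℕ} (h : Near Y e f D) : Near Y f e D :=
  fun q hq => (h q hq).symm

lemma Near.trans {Y : Finset V} {e f g : V → ℕ} {D D' : ℕ} (h : Near Y e f D)
    (h' : Near Y f g D') : Near Y e g (D + D') := fun q hq => by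
  have := h q hq
  have := h' q hq
  omega

lemma Near.refl (Y : Finset V) (e : V → ℕ) : Near Y e e 0 := fun _ _ => by simp

variable (M) in
/-- `H` is a nonexpansive choice of extensions to `F` of the types over `Y`. -/
structure Hat (Y F : Finset V) (H : (V → ℕ) → V → ℕ) : Prop where
  isType : ∀ e, M.IsType Y e → M.IsType F (H e)
  restrict : ∀ e, M.IsType Y e → ∀ x ∈ Y, H e x = e x
  near : ∀ e f D, M.IsType Y e → M.IsType Y f → Near Y e f D → Near F (H e) (H f) D

/-- A single value of a nonexpansive choice of extensions can be extended further. -/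
lemma Hat.exists_extension {Y F G : Finset V} {H : (V → ℕ) → V → ℕ} (hH : M.Hat Y F H)
    (hYF : Y ⊆ F) (hFG : F ⊆ G) {b g : V → ℕ} (hb : M.IsType Y b) (hg : M.IsType G g)
    (hgb : ∀ x ∈ F, g x = H b x) :
    ∃ K, M.Hat Y G K ∧ (∀ e, M.IsType Y e → ∀ x ∈ F, K e x = H e x) ∧
      (∀ x ∈ G, K b x = g x) ∧
      ∀ e, M.IsType Y e → (∀ x ∈ F, 2 ≤ H e x) → (∃ q ∈ Y, e q ≠ b q) → ∀ x ∈ G, 2 ≤ K e x := by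
  let A : (V → ℕ) → V → Set ℕ := fun e x =>
    {n | (∃ D, Near Y e b D ∧ n = g x + D) ∨ ∃ q ∈ F, n = H e q + M.d q x}
  have hF : ∀ e, M.IsType Y e → ∀ x ∈ F, minFour (A e x) = H e x := by
    intro e he x hx
    have h1 := minFour_le (A := A e x) (Or.inr ⟨x, hx, rfl⟩)
    have h2 := M.self x
    have h3 := ((hH.isType e he).1 x hx).2
    rcases minFour_eq_or_mem (A e x) with h | ⟨D, hD, h⟩ | ⟨q, hq, h⟩
    · omega
    · have h4 := hH.near e b D he hb hD x hx
      have h5 := hgb x hx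
      omega
    · have h4 := ((hH.isType e he).2 x hx q hq).1
      have h5 := M.comm x q
      omega
  have hnear : ∀ e f D, M.IsType Y e → M.IsType Y f → Near Y e f D → ∀ x,
      minFour (A e x) ≤ minFour (A f x) + D := by
    intro e f D he hf hef x
    have h4 := minFour_le_four (A e x)
    rcases minFour_eq_or_mem (A f x) with h | ⟨D', hD, h⟩ | ⟨q, hq, h⟩
    · omega
    · have h1 := minFour_le (A := A e x) (Or.inl ⟨D + D', hef.trans hD, rfl⟩)
      omega
    · have h1 := minFour_le (A := A e x) (Or.inr ⟨q, hq, rfl⟩)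
      have h2 := hH.near e f D he hf hef q hq
      omega
  refine ⟨fun e x => minFour (A e x), ⟨fun e he => ⟨fun x hx => ⟨?_, minFour_le_four _⟩,
    fun x hx y hy => ⟨?_, ?_⟩⟩, fun e he x hx => ?_, fun e f D he hf hef x _ =>
      ⟨hnear e f D he hf hef x, hnear f e D hf he hef.symm x⟩⟩, hF, fun x hx => ?_,
      fun e he h2 hne x hx => ?_⟩ <;> beta_reduce
  · rcases minFour_eq_or_mem (A e x) with h | ⟨D', hD, h⟩ | ⟨q, hq, h⟩
    · omega
    · have := (hg.1 x hx).1
      omega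
    · have := ((hH.isType e he).1 q hq).1
      omega
  · have h4 := minFour_le_four (A e x)
    rcases minFour_eq_or_mem (A e y) with h | ⟨D', hD, h⟩ | ⟨q, hq, h⟩
    · omega
    · have h1 := minFour_le (A := A e x) (Or.inl ⟨D', hD, rfl⟩)
      have h2 := (hg.2 x hx y hy).1
      omega
    · have h1 := minFour_le (A := A e x) (Or.inr ⟨q, hq, rfl⟩)
      have h2 := M.tri q y x
      have h3 := M.comm x y
      omega
  · have h0 := M.le_four x y
    have mixed : ∀ x ∈ G, ∀ y, ∀ D, Near Y e b D → ∀ q ∈ F,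
        M.d x y ≤ g x + D + (H e q + M.d q y) := by
      intro x hx y D hD q hq
      have h1 := (hg.2 x hx q (hFG hq)).2
      have h2 := hgb q hq
      have h3 := hH.near e b D he hb hD q hq
      have h4 := M.tri x q y
      omega
    have hcomm := M.comm x y
    rcases minFour_eq_or_mem (A e x) with h | ⟨D, hD, h⟩ | ⟨q, hq, h⟩
    · omega
    · rcases minFour_eq_or_mem (A e y) with h' | ⟨D', hD', h'⟩ | ⟨q', hq', h'⟩
      · omega
      · have := (hg.2 x hx y hy).2
        omega
      · have := mixed x hx y D hD q' hq'
        omega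
    · rcases minFour_eq_or_mem (A e y) with h' | ⟨D', hD', h'⟩ | ⟨q', hq', h'⟩
      · omega
      · have := mixed y hy x D' hD' q hq
        omega
      · have h1 := ((hH.isType e he).2 q hq q' hq').2
        have h2 := M.tri x q y
        have h3 := M.tri q q' y
        have h5 := M.comm x q
        omega
  · rw [hF e he x (hYF hx), hH.restrict e he x hx]
  · have h1 := minFour_le (A := A b x) (Or.inl ⟨0, Near.refl Y b, rfl⟩)
    have h2 := (hg.1 x hx).2
    rcases minFour_eq_or_mem (A b x) with h | ⟨D', hD, h⟩ | ⟨q, hq, h⟩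
    · omega
    · omega
    · have h3 := (hg.2 x hx q (hFG hq)).1
      have h4 := hgb q hq
      have h5 := M.comm x q
      omega
  · obtain ⟨q, hqY, hq⟩ := hne
    rcases minFour_eq_or_mem (A e x) with h | ⟨D', hD, h⟩ | ⟨q', hq', h⟩
    · omega
    · have h1 := hD q hqY
      have h3 := (hg.1 x hx).1
      omega
    · have := h2 q' hq'
      omega

/-- If the complement of `X` in `C` has no rich subset and the realizations of types taking the
value `1` are in `X`, then all types over `Y` can be extended coherently to have their
realizations in `X`. -/
lemma exists_hat_realizations_subset {C X : Set V} (hX : ∀ D ⊆ C \ X, ¬ M.Rich D)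
    {Y : Finset V} (hY : ↑Y ⊆ C)
    (h1 : ∀ w, M.IsType Y w → (∃ q ∈ Y, w q = 1) → M.realizations C Y w ⊆ X) :
    ∃ F : Finset V, Y ⊆ F ∧ ↑F ⊆ C ∧ ∃ H, M.Hat Y F H ∧
      ∀ e, M.IsType Y e → M.realizations C F (H e) ⊆ X := by
  classical
  have key : ∀ E : Finset (V → ℕ), ∃ F : Finset V, Y ⊆ F ∧ ↑F ⊆ C ∧ ∃ H, M.Hat Y F H ∧
      (∀ e ∈ E, M.IsType Y e → M.realizations C F (H e) ⊆ X) ∧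
      ∀ e, M.IsType Y e → M.realizations C F (H e) ⊆ X ∨ ∀ x ∈ F, 2 ≤ H e x := by
    intro E
    induction E using Finset.induction_on with
    | empty =>
      refine ⟨Y, subset_rfl, hY, id, ⟨fun e he => he, fun _ _ _ _ => rfl, fun _ _ _ _ _ h => h⟩,
        by simp, fun e he => ?_⟩
      by_cases h : ∃ q ∈ Y, e q = 1
      · exact Or.inl (h1 e he h)
      · push Not at h
        refine Or.inr fun x hx => ?_
        have h2 := (he.1 x hx).1
        have h3 := h x hx
        simp only [id]
        omega
    | insert b E _ ih =>
      obtain ⟨F, hYF, hFC, H, hH, hE, hall⟩ := ih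
      by_cases hb : M.IsType Y b
      swap
      · refine ⟨F, hYF, hFC, H, hH, fun e he het => ?_, hall⟩
        rcases Finset.mem_insert.1 he with rfl | he
        · exact absurd het hb
        · exact hE e he het
      rcases hall b hb with hbX | hb2
      · refine ⟨F, hYF, hFC, H, hH, fun e he het => ?_, hall⟩
        rcases Finset.mem_insert.1 he with rfl | he
        · exact hbX
        · exact hE e he het
      obtain ⟨G, hFG, hGC, g, hg, hgb, hgX⟩ :=
        exists_extension_realizations_subset hX hFC (hH.isType b hb) hb2
      obtain ⟨K, hK, hKH, hKb, hK2⟩ := hH.exists_extension hYF hFG hb hg hgb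
      have hold : ∀ e, M.IsType Y e → M.realizations C F (H e) ⊆ X →
          M.realizations C G (K e) ⊆ X := fun e he h =>
        (realizations_subset subset_rfl hFG (hKH e he)).trans h
      have hKbX : M.realizations C G (K b) ⊆ X := by
        rwa [realizations_congr hKb]
      refine ⟨G, hYF.trans hFG, hGC, K, hK, fun e he het => ?_, fun e he => ?_⟩
      · rcases Finset.mem_insert.1 he with rfl | he
        · exact hKbX
        · exact hold e het (hE e he het)
      · rcases hall e he with h | h
        · exact Or.inl (hold e he h)
        · by_cases hne : ∃ q ∈ Y, e q ≠ b q
          · exact Or.inr (hK2 e he h hne)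
          · push Not at hne
            have hnear := hK.near e b 0 he hb fun q hq => by simp [hne q hq]
            refine Or.inl ?_
            rwa [realizations_congr fun x hx => le_antisymm (hnear x hx).1 (hnear x hx).2]
  obtain ⟨E, hE⟩ := exists_finite_representatives (M := M) Y
  obtain ⟨F, hYF, hFC, H, hH, hEX, -⟩ := key E
  refine ⟨F, hYF, hFC, H, hH, fun e he => ?_⟩
  obtain ⟨g, hg, hge⟩ := hE e he
  have hgt := he.congr hge
  have hnear := hH.near e g 0 he hgt fun q hq => by simp [hge q hq]
  rw [realizations_congr fun x hx => le_antisymm (hnear x hx).1 (hnear x hx).2]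
  exact hEX g hg hgt

variable (M) in
/-- `G` assigns to each type over `Y` a type over `F`, in such a way that points realizing types
over `Y` can be required to realize the assigned types over `F`. -/
structure Coherent (Y F : Finset V) (G : (V → ℕ) → V → ℕ) : Prop where
  isType : ∀ e, M.IsType Y e → M.IsType F (G e)
  cross : ∀ e, M.IsType Y e → ∀ q ∈ Y, ∀ x ∈ F,
    e q ≤ G e x + M.d q x ∧ G e x ≤ e q + M.d q x ∧ M.d q x ≤ e q + G e x
  near : ∀ e f D, M.IsType Y e → M.IsType Y f → Near Y e f D → Near F (G e) (G f) D
  add : ∀ e f n, M.IsType Y e → M.IsType Y f → n ≤ 4 → (∀ q ∈ Y, n ≤ e q + f q) →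
    ∀ x ∈ F, n ≤ G e x + G f x

/-- Inside a rich set, one may pass to a rich subset whose points realize the types prescribed by
a coherent assignment. -/
lemma Coherent.exists_rich {C : Set V} (hC : M.Rich C) {Y F : Finset V} (hY : ↑Y ⊆ C)
    (hF : ↑F ⊆ C) {G : (V → ℕ) → V → ℕ} (hG : M.Coherent Y F G) :
    ∃ D ⊆ C, M.Rich D ∧ ↑Y ⊆ D ∧ ∀ c ∈ D, c ∉ Y → ∀ x ∈ F, M.d c x = G (M.d c) x := by
  classical
  let σ := {S : Finset V // Y ⊆ S ∧ ↑S ⊆ C ∧ ∀ c ∈ S, c ∉ Y → ∀ x ∈ F, M.d c x = G (M.d c) x}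
  obtain ⟨s, hs0, hs⟩ := exists_rich_iUnion (M := M) (σ := σ) Subtype.val (fun S t ht => by
    obtain ⟨S, hYS, hSC, hS⟩ := S
    have htY := ht.mono hYS
    have hmeet : ∀ x ∈ S, x ∈ F → G t x = t x := by
      intro x hx hxF
      have h0 := M.self x
      by_cases hxY : x ∈ Y
      · have := hG.cross t htY x hxY x hxF
        omega
      · have h1 := hS x hx hxY x hxF
        have h2 := ((hG.isType _ (isType_d hxY)).1 x hxF).1
        omega
    have htype := ht.union (hG.isType t htY) fun s hs _ x hx => by
      by_cases hsY : s ∈ Y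
      · have := hG.cross t htY s hsY x hx
        omega
      · have hst : ∀ q ∈ Y, t s ≤ t q + M.d s q ∧ t q ≤ t s + M.d s q ∧ M.d s q ≤ t s + t q := by
          intro q hq
          have h1 := ht.2 s hs q (hYS hq)
          have h2 := (ht.2 q (hYS hq) s hs).1
          have h3 := M.comm s q
          omega
        have h1 := hS s hs hsY x hx
        have h2 := hG.near _ t (t s) (isType_d hsY) htY (fun q hq => by
          have := hst q hq
          omega) x hx
        have h3 := hG.add _ t (t s) (isType_d hsY) htY (ht.1 s hs).2 (fun q hq => by
          have := hst q hq
          omega) x hx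
        omega
    obtain ⟨c, hcC, hc⟩ := hC (S ∪ F) (by simpa using ⟨hSC, hF⟩) _ htype
    have hcS : ∀ x ∈ S, M.d c x = t x := by
      intro x hx
      rw [hc x (Finset.mem_union_left _ hx)]
      split_ifs with h
      · exact hmeet x hx h
      · rfl
    have hcF : ∀ x ∈ F, M.d c x = G t x := fun x hx => by
      simpa [hx] using hc x (Finset.mem_union_right _ hx)
    refine ⟨⟨insert c S, hYS.trans (Finset.subset_insert _ _), ?_, fun a ha haY x hx => ?_⟩,
      Finset.subset_insert _ _, c, Finset.mem_insert_self _ _, hcS⟩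
    · rw [Finset.coe_insert]
      exact Set.insert_subset hcC hSC
    · rcases Finset.mem_insert.1 ha with rfl | ha
      · have h1 := hG.near _ t 0 (isType_d haY) htY (fun q hq => by simp [hcS q (hYS hq)]) x hx
        have h2 := hcF x hx
        omega
      · exact hS a ha haY x hx) ⟨Y, subset_rfl, hY, fun c hc hcY => absurd hc hcY⟩
  refine ⟨_, Set.iUnion_subset fun n => (s n).2.2.1, hs, ?_, fun c hc hcY => ?_⟩
  · intro x hx
    exact Set.mem_iUnion.2 ⟨0, by rw [hs0]; exact hx⟩
  · obtain ⟨n, hn⟩ := Set.mem_iUnion.1 hc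
    exact (s n).2.2.2 c hn hcY

/-- A nonexpansive choice of extensions of types over `Y` gives a coherent assignment over
`insert y Y`, where `y` realizes one of the chosen extensions. -/
lemma Hat.exists_coherent [DecidableEq V] {Y F : Finset V} {H : (V → ℕ) → V → ℕ}
    (hH : M.Hat Y F H) (hYF : Y ⊆ F) {f : V → ℕ} (hf : M.IsType Y f) {y : V}
    (hy : ∀ x ∈ F, M.d y x = H f x) :
    ∃ G, M.Coherent (insert y Y) F G ∧
      ∀ e, M.IsType (insert y Y) e → e y = 1 → ∀ x ∈ F, G e x = H e x := by
  let A : (V → ℕ) → V → Set ℕ := fun e x =>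
    {n | (∃ b D, M.IsType Y b ∧ Near Y b f 1 ∧ Near Y e b D ∧ e y ≤ 1 + D ∧ 1 ≤ e y + D ∧
      n = H b x + D) ∨ ∃ q ∈ insert y Y, n = e q + M.d q x}
  have hyb : ∀ b, M.IsType Y b → Near Y b f 1 → ∀ x ∈ F, M.d y x ≤ H b x + 1 ∧
      H b x ≤ M.d y x + 1 := fun b hb hbf x hx => by
    have h1 := hH.near b f 1 hb hf hbf x hx
    have h2 := hy x hx
    omega
  have hmem : ∀ q ∈ insert y Y, q = y ∨ q ∈ Y := fun q hq => Finset.mem_insert.1 hq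
  have hYy : Y ⊆ insert y Y := Finset.subset_insert _ _
  have hyy : y ∈ insert y Y := Finset.mem_insert_self _ _
  have hcross : ∀ e, M.IsType (insert y Y) e → ∀ b D, M.IsType Y b → Near Y b f 1 →
      Near Y e b D → e y ≤ 1 + D → 1 ≤ e y + D → ∀ q ∈ insert y Y, ∀ x ∈ F,
      e q ≤ H b x + D + M.d q x ∧ M.d q x ≤ e q + (H b x + D) := by
    intro e he b D hb hbf hD h1 h2 q hq x hx
    have hb1 := (hH.isType b hb).1 x hx
    rcases hmem q hq with rfl | hq
    · have := hyb b hb hbf x hx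
      omega
    · have h3 := hD q hq
      have h4 := hH.restrict b hb q hq
      have h5 := (hH.isType b hb).2 q (hYF hq) x hx
      omega
  have hcross' : ∀ e, M.IsType (insert y Y) e → ∀ q ∈ insert y Y, ∀ x ∈ F,
      e q ≤ minFour (A e x) + M.d q x ∧ minFour (A e x) ≤ e q + M.d q x ∧
        M.d q x ≤ e q + minFour (A e x) := by
    intro e he q hq x hx
    have h1 := minFour_le (A := A e x) (Or.inr ⟨q, hq, rfl⟩)
    have h2 := (he.1 q hq).2
    have h3 := M.le_four q x
    rcases minFour_eq_or_mem (A e x) with h | ⟨b, D, hb, hbf, hD, h4, h5, h⟩ | ⟨q', hq', h⟩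
    · omega
    · have := hcross e he b D hb hbf hD h4 h5 q hq x hx
      omega
    · have h4 := he.2 q hq q' hq'
      have h5 := M.tri q q' x
      have h6 := M.tri q x q'
      have h7 := M.comm x q'
      omega
  have hnear : ∀ e e' D, M.IsType (insert y Y) e → M.IsType (insert y Y) e' →
      Near (insert y Y) e e' D → ∀ x, minFour (A e x) ≤ minFour (A e' x) + D := by
    intro e e' D he he' hee x
    have h4 := minFour_le_four (A e x)
    rcases minFour_eq_or_mem (A e' x) with h | ⟨b, D', hb, hbf, hD, h1, h2, h⟩ | ⟨q, hq, h⟩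
    · omega
    · have h0 := hee y hyy
      have h1 := minFour_le (A := A e x) (Or.inl ⟨b, D + D', hb, hbf,
        Near.trans (fun q hq => hee q (hYy hq)) hD, by omega, by omega, rfl⟩)
      omega
    · have h1 := minFour_le (A := A e x) (Or.inr ⟨q, hq, rfl⟩)
      have h2 := hee q hq
      omega
  refine ⟨fun e x => minFour (A e x), ⟨fun e he => ⟨fun x hx => ⟨?_, minFour_le_four _⟩,
    fun x hx z hz => ⟨?_, ?_⟩⟩, hcross', fun e e' D he he' hee x _ =>
    ⟨hnear e e' D he he' hee x, hnear e' e D he' he hee.symm x⟩,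
    fun e e' n he he' hn hnee x hx => ?_⟩, fun e he hey x hx => ?_⟩ <;> beta_reduce
  · rcases minFour_eq_or_mem (A e x) with h | ⟨b, D, hb, hbf, hD, h1, h2, h⟩ | ⟨q, hq, h⟩
    · omega
    · have := ((hH.isType b hb).1 x hx).1
      omega
    · have := (he.1 q hq).1
      omega
  · have h4 := minFour_le_four (A e x)
    rcases minFour_eq_or_mem (A e z) with h | ⟨b, D, hb, hbf, hD, h1, h2, h⟩ | ⟨q, hq, h⟩
    · omega
    · have h3 := minFour_le (A := A e x) (Or.inl ⟨b, D, hb, hbf, hD, h1, h2, rfl⟩)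
      have h5 := ((hH.isType b hb).2 x hx z hz).1
      omega
    · have h1 := minFour_le (A := A e x) (Or.inr ⟨q, hq, rfl⟩)
      have h2 := M.tri q z x
      have h3 := M.comm x z
      omega
  · have h0 := M.le_four x z
    have hcomm := M.comm x z
    rcases minFour_eq_or_mem (A e x) with h | ⟨b, D, hb, hbf, hD, h1, h2, h⟩ | ⟨q, hq, h⟩
    · omega
    · rcases minFour_eq_or_mem (A e z) with h' | ⟨b', D', hb', hbf', hD', h1', h2', h'⟩ |
        ⟨q', hq', h'⟩
      · omega
      · have h5 := ((hH.isType b hb).2 x hx z hz).2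
        have h6 := hH.near b b' (D + D') hb hb' (hD.symm.trans hD') z hz
        omega
      · have h5 := hcross e he b D hb hbf hD h1 h2 q' hq' x hx
        have h6 := M.tri x q' z
        have h7 := M.comm x q'
        omega
    · have h5 := hcross' e he q hq z hz
      have h6 := M.tri x q z
      have h7 := M.comm x q
      omega
  · have hmix : ∀ e, M.IsType (insert y Y) e → ∀ e' : V → ℕ, (∀ q ∈ insert y Y, n ≤ e q + e' q) →
        ∀ q ∈ insert y Y, n ≤ minFour (A e x) + (e' q + M.d q x) := by
      intro e he e' hnee q hq
      have h1 := (hcross' e he q hq x hx).1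
      have h2 := hnee q hq
      omega
    rcases minFour_eq_or_mem (A e x) with h | ⟨b, D, hb, hbf, hD, h1, h2, h⟩ | ⟨q, hq, h⟩
    · omega
    · rcases minFour_eq_or_mem (A e' x) with h' | ⟨b', D', hb', hbf', hD', h1', h2', h'⟩ |
        ⟨q', hq', h'⟩
      · omega
      · have h5 := ((hH.isType b hb).1 x hx).1
        have h6 := ((hH.isType b' hb').1 x hx).1
        have h7 := hnee y hyy
        omega
      · have := hmix e he e' hnee q' hq'
        omega
    · have := hmix e' he' e (fun q hq => by have := hnee q hq; omega) q hq
      omega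
  · have heY := he.mono hYy
    have hef : Near Y e f 1 := fun q hq => by
      have h1 := (he.2 q (hYy hq) y hyy).1
      have h2 := (he.2 q (hYy hq) y hyy).2
      have h3 := hy q (hYF hq)
      have h4 := hH.restrict f hf q hq
      have h5 := M.comm q y
      have h6 := (he.2 y hyy q (hYy hq)).1
      omega
    have h1 := minFour_le (A := A e x)
      (Or.inl ⟨e, 0, heY, hef, Near.refl Y e, by omega, by omega, rfl⟩)
    have h2 := ((hH.isType e heY).1 x hx).2
    rcases minFour_eq_or_mem (A e x) with h | ⟨b, D, hb, hbf, hD, h1, h2, h⟩ | ⟨q, hq, h⟩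
    · omega
    · have h3 := hH.near e b D heY hb hD x hx
      omega
    · rcases hmem q hq with rfl | hq
      · have := hyb e heY hef x hx
        omega
      · have h3 := ((hH.isType e heY).2 x hx q (hYF hq)).1
        have h4 := hH.restrict e heY q hq
        have h5 := M.comm q x
        omega

/-- A rich set contains a rich subset of `X` or a rich subset disjoint from `X`. -/
theorem Rich.exists_subset_inter_or_diff {C : Set V} (hC : M.Rich C) (X : Set V) :
    (∃ D ⊆ C ∩ X, M.Rich D) ∨ ∃ D ⊆ C \ X, M.Rich D := by
  classical
  by_contra! hcon
  obtain ⟨hCX, hX⟩ := hcon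
  let σ := {S : Finset V × Set V // M.Rich S.2 ∧ S.2 ⊆ C ∧ ↑S.1 ⊆ S.2 ∧ ↑S.1 ⊆ X ∧
    ∀ w, M.IsType S.1 w → (∃ q ∈ S.1, w q = 1) → M.realizations S.2 S.1 w ⊆ X}
  obtain ⟨s, -, hs⟩ := exists_rich_iUnion (M := M) (σ := σ) (fun S => S.1.1) (fun S f hf => by
    obtain ⟨⟨Y, B⟩, hB, hBC, hYB, hYX, h1⟩ := S
    dsimp only at hB hBC hYB hYX h1 hf ⊢
    obtain ⟨F, hYF, hFB, H, hH, hHX⟩ := exists_hat_realizations_subset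
      (fun D hD => hX D (hD.trans (Set.sdiff_subset_sdiff_left hBC))) hYB h1
    obtain ⟨y, hyB, hy⟩ := hB F hFB _ (hH.isType f hf)
    have hyX : y ∈ X := hHX f hf ⟨hyB, hy⟩
    obtain ⟨G, hG, hG1⟩ := hH.exists_coherent hYF hf hy
    have hyYB : ↑(insert y Y) ⊆ B := by
      rw [Finset.coe_insert]
      exact Set.insert_subset hyB hYB
    obtain ⟨D, hDB, hD, hYD, hDG⟩ := hG.exists_rich hB hyYB hFB
    refine ⟨⟨⟨insert y Y, D⟩, hD, hDB.trans hBC, hYD, ?_, fun w hw hw1 => ?_⟩,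
      Finset.subset_insert _ _, y, Finset.mem_insert_self _ _, fun x hx => ?_⟩
    · rw [Finset.coe_insert]
      exact Set.insert_subset hyX hYX
    · have hwY := hw.mono (Finset.subset_insert y Y)
      by_cases hwy : w y = 1
      · rintro c ⟨hcD, hc⟩
        have hcY : c ∉ insert y Y := fun h => by
          have h2 := hc c h
          have h3 := (hw.1 c h).1
          have h4 := M.self c
          omega
        have hcy : M.d c y = 1 := (hc y (Finset.mem_insert_self _ _)).trans hwy
        refine hHX _ ((isType_d hcY).mono (Finset.subset_insert _ _)) ⟨hDB hcD, fun x hx => ?_⟩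
        rw [← hG1 _ (isType_d hcY) hcy x hx]
        exact hDG c hcD hcY x hx
      · obtain ⟨q, hq, hqw⟩ := hw1
        rcases Finset.mem_insert.1 hq with rfl | hq
        · exact absurd hqw hwy
        · exact (realizations_subset hDB (Finset.subset_insert _ _) fun _ _ => rfl).trans
            (h1 w hwY ⟨q, hq, hqw⟩)
    · rw [hy x (hYF hx), hH.restrict f hf x hx]) ⟨⟨∅, C⟩, hC, subset_rfl, by simp, by simp,
        by simp⟩
  exact hCX _ (Set.iUnion_subset fun n x hx =>
    ⟨(s n).2.2.1 ((s n).2.2.2.1 hx), (s n).2.2.2.2.1 hx⟩) hs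

/-- Rich sets are indivisible. -/
theorem Rich.exists_monochromatic {C : Set V} (hC : M.Rich C) (k : ℕ) (χ : V → ℕ)
    (hχ : ∀ c ∈ C, χ c < k) : ∃ i, ∃ D ⊆ C, M.Rich D ∧ ∀ c ∈ D, χ c = i := by
  induction k generalizing C with
  | zero =>
    refine ⟨0, C, subset_rfl, hC, fun c hc => absurd (hχ c hc) (Nat.not_lt_zero _)⟩
  | succ k ih =>
    rcases hC.exists_subset_inter_or_diff {v | χ v = k} with ⟨D, hDC, hD⟩ | ⟨D, hDC, hD⟩
    · exact ⟨k, D, fun c hc => (hDC hc).1, hD, fun c hc => (hDC hc).2⟩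
    · obtain ⟨i, E, hED, hE⟩ := ih hD fun c hc =>
        lt_of_le_of_ne (Nat.lt_succ_iff.1 (hχ c (hDC hc).1)) (hDC hc).2
      exact ⟨i, E, fun c hc => (hDC (hED hc)).1, hE⟩

/-- The grid metric induced on a set. -/
def restrict (M : GridMetric V) (C : Set V) : GridMetric C where
  d x y := M.d x y
  self x := M.self x
  eq_of x y h := Subtype.ext (M.eq_of x y h)
  comm x y := M.comm x y
  tri x y z := M.tri x y z
  le_four x y := M.le_four x y

lemma Rich.restrict {C : Set V} (hC : M.Rich C) : (M.restrict C).Rich Set.univ := by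
  classical
  intro F _ f hf
  let g : V → ℕ := fun v => if h : v ∈ C then f ⟨v, h⟩ else 0
  have hg : ∀ v : C, g v = f v := fun v => by simp [g]
  have hFC : ∀ x ∈ F.image Subtype.val, ∃ v : C, v ∈ F ∧ (v : V) = x := fun x hx => by
    simpa using hx
  obtain ⟨y, hyC, hy⟩ := hC (F.image Subtype.val) (by simp) g ⟨fun x hx => by
      obtain ⟨v, hv, rfl⟩ := hFC x hx
      rw [hg]
      exact hf.1 v hv, fun x hx z hz => by
      obtain ⟨v, hv, rfl⟩ := hFC x hx
      obtain ⟨w, hw, rfl⟩ := hFC z hz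
      rw [hg, hg]
      exact hf.2 v hv w hw⟩
  exact ⟨⟨y, hyC⟩, trivial, fun x hx => (hy x (Finset.mem_image_of_mem _ hx)).trans (hg x)⟩

/-- A rich set contains a countable rich subset. -/
lemma Rich.exists_countable (hM : M.Rich Set.univ) : ∃ C : Set V, C.Countable ∧ M.Rich C := by
  classical
  obtain ⟨s, -, hs⟩ := exists_rich_iUnion (M := M) (σ := Finset V) id (fun F f hf => by
    obtain ⟨y, -, hy⟩ := hM F (Set.subset_univ _) f hf
    exact ⟨insert y F, Finset.subset_insert _ _, y, Finset.mem_insert_self _ _, hy⟩) ∅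
  exact ⟨_, Set.countable_iUnion fun n => Finset.countable_toSet _, hs⟩

section Lists

variable {S : Type*} (D : GridMetric S) (x : ℕ → S)

variable (M) in
/-- Read from its end, the list enumerates points at the same mutual distances as the initial
terms of the sequence `x`. -/
def Copies : List V → Prop
  | [] => True
  | v :: l => Copies l ∧ ∀ w p, w :: p <:+ l → M.d v w = D.d (x l.length) (x p.length)

variable {D x}

lemma Copies.of_suffix {l m : List V} (hl : M.Copies D x l) (h : m <:+ l) : M.Copies D x m := by
  induction l with
  | nil => rw [List.suffix_nil.1 h]; trivial
  | cons v l ih =>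
    rcases List.suffix_cons_iff.1 h with rfl | h
    · exact hl
    · exact ih hl.1 h

lemma Copies.d_eq_of_suffix {v w : V} {l p : List V} (hl : M.Copies D x (v :: l))
    (h : w :: p <:+ v :: l) : M.d v w = D.d (x l.length) (x p.length) := by
  rcases List.suffix_cons_iff.1 h with h | h
  · obtain ⟨rfl, rfl⟩ := List.cons.inj h
    rw [M.self, D.self]
  · exact hl.2 w p h

lemma Copies.d_eq {v w : V} {l p q : List V} (hl : M.Copies D x l) (hv : v :: q <:+ l)
    (hw : w :: p <:+ l) : M.d v w = D.d (x q.length) (x p.length) := by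
  rcases List.suffix_or_suffix_of_suffix hv hw with h | h
  · rw [M.comm, D.comm]
    exact (hl.of_suffix hw).d_eq_of_suffix h
  · exact (hl.of_suffix hv).d_eq_of_suffix h

lemma Rich.exists_copies_cons {C : Set V} (hC : M.Rich C) {l : List V} (hl : M.Copies D x l)
    (hlC : ∀ v ∈ l, v ∈ C) : ∃ v ∈ C, M.Copies D x (v :: l) := by
  classical
  by_cases hx : ∃ w p, w :: p <:+ l ∧ x l.length = x p.length
  · obtain ⟨w, p, hp, hxp⟩ := hx
    refine ⟨w, hlC w (hp.subset List.mem_cons_self), hl, fun w' p' hp' => ?_⟩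
    rw [hxp]
    exact hl.d_eq hp hp'
  have hpos : ∀ w, ∃ p, w ∈ l → w :: p <:+ l := fun w => by
    by_cases hw : w ∈ l
    · obtain ⟨s, t, h⟩ := List.append_of_mem hw
      exact ⟨t, fun _ => ⟨s, h.symm⟩⟩
    · exact ⟨[], fun h => absurd h hw⟩
  choose p hp using hpos
  obtain ⟨y, hyC, hy⟩ := hC l.toFinset (fun v hv => hlC v (by simpa using hv))
    (fun w => D.d (x l.length) (x (p w).length)) (by
      refine ⟨fun w hw => ⟨?_, D.le_four _ _⟩, fun w hw w' hw' => ?_⟩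
      · have hw := hp w (by simpa using hw)
        by_contra! h
        exact hx ⟨w, p w, hw, D.eq_of _ _ (Nat.lt_one_iff.1 h)⟩
      · rw [hl.d_eq (hp w (by simpa using hw)) (hp w' (by simpa using hw'))]
        have h1 := D.tri (x l.length) (x (p w').length) (x (p w).length)
        have h2 := D.tri (x (p w).length) (x l.length) (x (p w').length)
        have h3 := D.comm (x (p w).length) (x l.length)
        have h4 := D.comm (x (p w).length) (x (p w').length)
        dsimp only
        omega)
  refine ⟨y, hyC, hl, fun w q hq => ?_⟩
  have hw : w ∈ l := hq.subset List.mem_cons_self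
  have h0 := hl.d_eq (hp w hw) hq
  rw [M.self] at h0
  rw [hy w (by simpa using hw), D.eq_of _ _ h0.symm]

/-- A rich set contains an infinite sequence copying `x`. -/
lemma Rich.exists_copies_seq {C : Set V} (hC : M.Rich C) :
    ∃ (v : ℕ → V) (l : ℕ → List V), (∀ n, v n ∈ C) ∧ (∀ n, (l n).length = n) ∧
      (∀ n, M.Copies D x (v n :: l n)) ∧ ∀ m n, m ≤ n → v m :: l m <:+ v n :: l n := by
  have step : ∀ l : {l : List V // M.Copies D x l ∧ ∀ v ∈ l, v ∈ C},
      ∃ v ∈ C, M.Copies D x (v :: l.1) := fun l => hC.exists_copies_cons l.2.1 l.2.2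
  choose next hnext hcopies using step
  let L : ℕ → {l : List V // M.Copies D x l ∧ ∀ v ∈ l, v ∈ C} := fun n =>
    Nat.rec ⟨[], trivial, by simp⟩ (fun _ l => ⟨next l :: l.1, hcopies l, fun v hv => by
      rcases List.mem_cons.1 hv with rfl | hv
      · exact hnext l
      · exact l.2.2 v hv⟩) n
  have hL : ∀ n, (L (n + 1)).1 = next (L n) :: (L n).1 := fun n => rfl
  refine ⟨fun n => next (L n), fun n => (L n).1, fun n => hnext _, fun n => ?_,
    fun n => hcopies _, fun m n hmn => ?_⟩
  · induction n with
    | zero => rfl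
    | succ n ih => simpa [hL] using ih
  · induction n, hmn using Nat.le_induction with
    | base => exact List.suffix_rfl
    | succ n _ ih =>
      beta_reduce at ih ⊢
      rw [← hL n] at ih
      exact ih.trans (List.suffix_cons _ _)

end Lists

end GridMetric

section Forest

/-- The infimum of `1` and the elements of `A`. -/
noncomputable def capInf (A : Set ℝ) : ℝ := sInf (insert 1 A)

lemma capInf_bddBelow {A : Set ℝ} (hA : ∀ a ∈ A, 0 ≤ a) : BddBelow (insert 1 A) :=
  ⟨0, by rintro a (rfl | ha); exacts [zero_le_one, hA a ha]⟩

lemma capInf_le_one {A : Set ℝ} (hA : ∀ a ∈ A, 0 ≤ a) : capInf A ≤ 1 :=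
  csInf_le (capInf_bddBelow hA) (Set.mem_insert _ _)

lemma capInf_le {A : Set ℝ} (hA : ∀ a ∈ A, 0 ≤ a) {a : ℝ} (ha : a ∈ A) : capInf A ≤ a :=
  csInf_le (capInf_bddBelow hA) (Set.mem_insert_of_mem _ ha)

lemma le_capInf {A : Set ℝ} {c : ℝ} (hc : c ≤ 1) (h : ∀ a ∈ A, c ≤ a) : c ≤ capInf A :=
  le_csInf (Set.insert_nonempty _ _) (by rintro a (rfl | ha); exacts [hc, h a ha])

lemma capInf_le_capInf_add {A B : Set ℝ} (hA : ∀ a ∈ A, 0 ≤ a) {c : ℝ} (hc : 0 ≤ c)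
    (h : ∀ b ∈ B, ∃ a ∈ A, a ≤ b + c) : capInf A ≤ capInf B + c := by
  have : capInf A - c ≤ capInf B := le_capInf (by linarith [capInf_le_one hA]) fun b hb => by
    obtain ⟨a, ha, hab⟩ := h b hb
    linarith [capInf_le hA ha]
  linarith

variable {S V T : Type*} [MetricSpace S] (N : GridMetric V) (X : T → S) (π : T → V)
  (le : T → T → Prop)

/-- Functions which are nonexpansive along a forest labelled in `S`, and vary by at most `1/4`
between a node of the forest and its label in `V`. -/
structure ForestLipschitz (φ : V ⊕ T → ℝ) : Prop where
  mem : ∀ a, 0 ≤ φ a ∧ φ a ≤ 1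
  tree : ∀ s t, le s t → |φ (.inr s) - φ (.inr t)| ≤ dist (X s) (X t)
  label : ∀ t, |φ (.inr t) - φ (.inl (π t))| ≤ 1 / 4

variable {N X π le}

lemma exists_forestLipschitz (hrefl : ∀ t, le t t) (htrans : ∀ r s t, le r s → le s t → le r t)
    (hforest : ∀ r s t, le r t → le s t → le r s ∨ le s r)
    (hlow : ∀ s t, le s t → dist (X s) (X t) ≤ N.d (π s) (π t) / 4)
    (hupp : ∀ s t, le s t → (N.d (π s) (π t) : ℝ) / 4 ≤ dist (X s) (X t) + 1 / 4)
    (hS : ∀ a b : S, dist a b ≤ 1) (s : T) :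
    ∃ φ, ForestLipschitz X π le φ ∧ φ (.inr s) = 0 ∧
      ∀ t, le s t → dist (X s) (X t) ≤ φ (.inr t) := by
  let ρ : V → V → ℝ := fun u v => (N.d u v : ℝ) / 4
  have ρ_nonneg : ∀ u v, 0 ≤ ρ u v := fun u v => by positivity
  have ρ_self : ∀ u, ρ u u = 0 := fun u => by simp [ρ, N.self]
  have ρ_comm : ∀ u v, ρ u v = ρ v u := fun u v => by simp only [ρ, N.comm u v]
  have ρ_tri : ∀ u v w, ρ u w ≤ ρ u v + ρ v w := fun u v w => by
    have : (N.d u w : ℝ) ≤ N.d u v + N.d v w := by exact_mod_cast N.tri u v w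
    simp only [ρ]
    linarith
  change ∀ s t, le s t → dist (X s) (X t) ≤ ρ (π s) (π t) at hlow
  change ∀ s t, le s t → ρ (π s) (π t) ≤ dist (X s) (X t) + 1 / 4 at hupp
  let A : V ⊕ T → Set ℝ := Sum.elim
    (fun u => {a | ∃ p, le p s ∧ a = dist (X s) (X p) + ρ (π p) u})
    (fun t => {a | (∃ p, le p s ∧ le p t ∧ a = dist (X s) (X p) + dist (X p) (X t)) ∨
      ∃ p q r, le p s ∧ le r q ∧ le r t ∧
        a = dist (X s) (X p) + ρ (π p) (π q) + 1 / 4 + dist (X q) (X r) + dist (X r) (X t)})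
  have hA : ∀ b, ∀ a ∈ A b, 0 ≤ a := by
    rintro (u | t) a ha
    · obtain ⟨p, -, rfl⟩ := ha
      have := ρ_nonneg (π p) u
      positivity
    · rcases ha with ⟨p, -, -, rfl⟩ | ⟨p, q, r, -, -, -, rfl⟩
      · positivity
      · have := ρ_nonneg (π p) (π q)
        positivity
  refine ⟨fun b => capInf (A b), ⟨fun b => ⟨le_capInf zero_le_one (hA b), capInf_le_one (hA b)⟩,
    fun t t' htt => ?_, fun t => ?_⟩, ?_, fun t hst => ?_⟩
  · have h1 : capInf (A (.inr t')) ≤ capInf (A (.inr t)) + dist (X t) (X t') := by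
      refine capInf_le_capInf_add (hA _) dist_nonneg ?_
      rintro _ (⟨p, hps, hpt, rfl⟩ | ⟨p, q, r, hps, hrq, hrt, rfl⟩)
      · exact ⟨_, Or.inl ⟨p, hps, htrans _ _ _ hpt htt, rfl⟩,
          by linarith [dist_triangle (X p) (X t) (X t')]⟩
      · exact ⟨_, Or.inr ⟨p, q, r, hps, hrq, htrans _ _ _ hrt htt, rfl⟩,
          by linarith [dist_triangle (X r) (X t) (X t')]⟩
    have h2 : capInf (A (.inr t)) ≤ capInf (A (.inr t')) + dist (X t) (X t') := by
      refine capInf_le_capInf_add (hA _) dist_nonneg ?_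
      rintro _ (⟨p, hps, hpt, rfl⟩ | ⟨p, q, r, hps, hrq, hrt, rfl⟩)
      · rcases hforest p t t' hpt htt with h | h
        · exact ⟨_, Or.inl ⟨p, hps, h, rfl⟩,
            by linarith [dist_triangle_right (X p) (X t) (X t')]⟩
        · refine ⟨_, Or.inl ⟨t, htrans _ _ _ h hps, hrefl t, rfl⟩, ?_⟩
          linarith [dist_triangle (X s) (X p) (X t), dist_triangle_right (X p) (X t) (X t'),
            dist_self (X t)]
      · rcases hforest r t t' hrt htt with h | h
        · exact ⟨_, Or.inr ⟨p, q, r, hps, hrq, h, rfl⟩,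
            by linarith [dist_triangle_right (X r) (X t) (X t')]⟩
        · refine ⟨_, Or.inr ⟨p, q, t, hps, htrans _ _ _ h hrq, hrefl t, rfl⟩, ?_⟩
          linarith [dist_triangle (X q) (X r) (X t), dist_triangle_right (X r) (X t) (X t'),
            dist_self (X t)]
    rw [abs_le]
    constructor <;> linarith
  · have h1 : capInf (A (.inr t)) ≤ capInf (A (.inl (π t))) + 1 / 4 := by
      refine capInf_le_capInf_add (hA _) (by norm_num) ?_
      rintro _ ⟨p, hps, rfl⟩
      exact ⟨_, Or.inr ⟨p, t, t, hps, hrefl t, hrefl t, rfl⟩, by linarith [dist_self (X t)]⟩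
    have h2 : capInf (A (.inl (π t))) ≤ capInf (A (.inr t)) + 1 / 4 := by
      refine capInf_le_capInf_add (hA _) (by norm_num) ?_
      rintro _ (⟨p, hps, hpt, rfl⟩ | ⟨p, q, r, hps, hrq, hrt, rfl⟩)
      · exact ⟨_, ⟨p, hps, rfl⟩, by linarith [hupp p t hpt]⟩
      · refine ⟨_, ⟨p, hps, rfl⟩, ?_⟩
        linarith [hupp r t hrt, hupp r q hrq, ρ_tri (π p) (π q) (π t), ρ_tri (π q) (π r) (π t),
          ρ_comm (π r) (π q), dist_comm (X r) (X q)]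
    rw [abs_le]
    constructor <;> linarith
  · refine le_antisymm ?_ (le_capInf zero_le_one (hA _))
    refine (capInf_le (hA _) (Or.inl ⟨s, hrefl s, hrefl s, rfl⟩)).trans ?_
    simp
  · refine le_capInf (hS _ _) ?_
    rintro _ (⟨p, hps, hpt, rfl⟩ | ⟨p, q, r, hps, hrq, hrt, rfl⟩)
    · exact dist_triangle _ _ _
    · have hpr : dist (X p) (X r) ≤ ρ (π p) (π r) := by
        rcases hforest p r t (htrans _ _ _ hps hst) hrt with h | h
        · exact hlow p r h
        · rw [dist_comm, ρ_comm]
          exact hlow r p h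
      linarith [hupp r q hrq, ρ_tri (π p) (π q) (π r), ρ_comm (π r) (π q),
        dist_comm (X r) (X q), dist_triangle4 (X s) (X p) (X r) (X t)]

variable (X π le) in
/-- The largest pseudodistance making all functions satisfying `ForestLipschitz`
nonexpansive. -/
noncomputable def forestDist (a b : V ⊕ T) : ℝ :=
  ⨆ φ : {φ : V ⊕ T → ℝ // ForestLipschitz X π le φ}, |φ.1 a - φ.1 b|

lemma abs_sub_le_forestDist {φ : V ⊕ T → ℝ} (hφ : ForestLipschitz X π le φ) (a b : V ⊕ T) :
    |φ a - φ b| ≤ forestDist X π le a b := by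
  refine le_ciSup (f := fun φ : {φ : V ⊕ T → ℝ // ForestLipschitz X π le φ} => |φ.1 a - φ.1 b|)
    ⟨1, ?_⟩ ⟨φ, hφ⟩
  rintro _ ⟨ψ, rfl⟩
  have ha := ψ.2.mem a
  have hb := ψ.2.mem b
  exact abs_le.2 ⟨by linarith, by linarith⟩

lemma forestDist_le {a b : V ⊕ T} {c : ℝ}
    (h : ∀ φ, ForestLipschitz X π le φ → |φ a - φ b| ≤ c) : forestDist X π le a b ≤ c := by
  have : Nonempty {φ : V ⊕ T → ℝ // ForestLipschitz X π le φ} :=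
    ⟨⟨fun _ => 0, by simp, by simp, by simp⟩⟩
  exact ciSup_le fun φ => h φ.1 φ.2

end Forest

/-- A countable pseudometric space of diameter at most `1` maps to the Urysohn sphere
preserving distances. -/
lemma IsUrysohnSphere.exists_map {S : Type} [MetricSpace S] (hS : IsUrysohnSphere S) {P : Type}
    [Countable P] (D : P → P → ℝ) (hself : ∀ a, D a a = 0) (hcomm : ∀ a b, D a b = D b a)
    (htri : ∀ a b c, D a c ≤ D a b + D b c) (hle : ∀ a b, D a b ≤ 1) :
    ∃ J : P → S, ∀ a b, dist (J a) (J b) = D a b := by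
  let _ : PseudoMetricSpace P :=
    { dist := D, dist_self := hself, dist_comm := hcomm, dist_triangle := htri }
  have : Countable (SeparationQuotient P) := Quotient.countable
  obtain ⟨J, hJ⟩ := hS.2.2.2.2 (SeparationQuotient P) inferInstance fun a b => by
    obtain ⟨a, rfl⟩ := SeparationQuotient.surjective_mk a
    obtain ⟨b, rfl⟩ := SeparationQuotient.surjective_mk b
    exact hle a b
  exact ⟨fun a => J (SeparationQuotient.mk a), fun a b => hJ.dist_eq _ _⟩

/-- Realization of one-point extensions in the Urysohn sphere. -/
lemma IsUrysohnSphere.exists_dist_eq {S : Type} [MetricSpace S] (hS : IsUrysohnSphere S)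
    (F : Finset S) (g : S → ℝ) (hg : ∀ x ∈ F, 0 ≤ g x ∧ g x ≤ 1)
    (h : ∀ x ∈ F, ∀ y ∈ F, g x ≤ g y + dist x y ∧ dist x y ≤ g x + g y) :
    ∃ y, ∀ x ∈ F, dist y x = g x := by
  let D : Option F → Option F → ℝ
    | none, none => 0
    | none, some x => g x
    | some x, none => g x
    | some x, some y => dist x y
  obtain ⟨J, hJ⟩ := hS.exists_map D
    (by rintro (_ | x) <;> simp [D])
    (by rintro (_ | x) (_ | y) <;> simp [D, dist_comm])
    (by
      rintro (_ | ⟨x, hx⟩) (_ | ⟨y, hy⟩) (_ | ⟨z, hz⟩) <;> simp only [D]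
      · norm_num
      · linarith
      · linarith [(hg y hy).1]
      · have := (h z hz y hy).1
        rw [dist_comm z y] at this
        exact this
      · linarith
      · exact (h x hx z hz).2
      · have := (h x hx y hy).1
        change g x ≤ dist x y + g y
        linarith
      · exact dist_triangle x y z)
    (by
      rintro (_ | ⟨x, hx⟩) (_ | ⟨y, hy⟩) <;> simp only [D]
      · norm_num
      · exact (hg y hy).2
      · exact (hg x hx).2
      · exact hS.2.2.2.1 x y)
  obtain ⟨ψ, hψ⟩ := hS.2.2.1 F F.finite_toSet (fun x => J (some x))
    (Isometry.of_dist_eq fun x y => hJ _ _)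
  refine ⟨ψ.symm (J none), fun x hx => ?_⟩
  rw [← ψ.dist_eq, ψ.apply_symm_apply, hψ ⟨x, hx⟩, hJ]

/-- The distance multiplied by `4` and rounded up. -/
noncomputable def ceilMetric (S : Type*) [MetricSpace S] (hS : ∀ x y : S, dist x y ≤ 1) :
    GridMetric S where
  d x y := ⌈4 * dist x y⌉₊
  self x := by simp
  eq_of x y h := by
    have := Nat.ceil_eq_zero.1 h
    exact dist_le_zero.1 (by linarith)
  comm x y := by rw [dist_comm]
  tri x y z := by
    refine le_trans (Nat.ceil_mono ?_) (Nat.ceil_add_le _ _)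
    linarith [dist_triangle x y z]
  le_four x y := by
    rw [Nat.ceil_le]
    push_cast
    linarith [hS x y]

lemma IsUrysohnSphere.rich_univ {S : Type} [MetricSpace S] (hS : IsUrysohnSphere S) :
    (ceilMetric S hS.2.2.2.1).Rich Set.univ := by
  intro F _ f hf
  have hd : ∀ x y, 4 * dist x y ≤ (ceilMetric S hS.2.2.2.1).d x y ∧
      ((ceilMetric S hS.2.2.2.1).d x y : ℝ) < 4 * dist x y + 1 := fun x y =>
    ⟨Nat.le_ceil _, Nat.ceil_lt_add_one (by positivity)⟩
  rcases F.eq_empty_or_nonempty with rfl | hF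
  · obtain ⟨y, -⟩ := hS.exists_dist_eq ∅ (fun _ => 0) (by simp) (by simp)
    exact ⟨y, trivial, by simp⟩
  let g : S → ℝ := fun x => F.inf' hF fun z => f z / 4 + dist z x
  have hgle : ∀ x, ∀ z ∈ F, g x ≤ f z / 4 + dist z x := fun x z hz =>
    Finset.inf'_le (fun z => (f z : ℝ) / 4 + dist z x) hz
  have hgex : ∀ x, ∃ z ∈ F, g x = f z / 4 + dist z x := fun x =>
    Finset.exists_mem_eq_inf' hF _
  have hlow : ∀ x ∈ F, (f x : ℝ) - 1 < 4 * g x := fun x hx => by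
    obtain ⟨z, hz, h⟩ := hgex x
    have h1 : (f x : ℝ) ≤ f z + (ceilMetric S hS.2.2.2.1).d x z := by
      exact_mod_cast (hf.2 x hx z hz).1
    linarith [(hd x z).2, dist_comm x z]
  have hupp : ∀ x ∈ F, 4 * g x ≤ f x := fun x hx => by
    linarith [hgle x x hx, dist_self x]
  obtain ⟨y, hy⟩ := hS.exists_dist_eq F g (fun x hx => by
      have h1 : (1 : ℝ) ≤ f x := by exact_mod_cast (hf.1 x hx).1
      have h2 : (f x : ℝ) ≤ 4 := by exact_mod_cast (hf.1 x hx).2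
      constructor <;> linarith [hlow x hx, hupp x hx]) (fun x hx y hy => by
      obtain ⟨z, hz, hxz⟩ := hgex x
      obtain ⟨w, hw, hyw⟩ := hgex y
      have h1 : ((ceilMetric S hS.2.2.2.1).d z w : ℝ) ≤ f z + f w := by
        exact_mod_cast (hf.2 z hz w hw).2
      constructor
      · linarith [hgle x w hw, dist_triangle w y x, dist_comm x y]
      · linarith [(hd z w).1, dist_triangle4 x z w y, dist_comm x z])
  refine ⟨y, trivial, fun x hx => ?_⟩
  have h1 := (hf.1 x hx).1
  change ⌈4 * dist y x⌉₊ = f x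
  rw [hy x hx, Nat.ceil_eq_iff (by omega)]
  refine ⟨?_, hupp x hx⟩
  rw [Nat.cast_sub h1]
  simpa using hlow x hx

/-- A distance-preserving map defined on a dense sequence extends to an isometry. -/
lemma exists_isometry_of_denseRange {S S' : Type*} [MetricSpace S] [MetricSpace S']
    [CompleteSpace S'] {x : ℕ → S} (hx : DenseRange x) {y : ℕ → S'}
    (hxy : ∀ m n, dist (y m) (y n) = dist (x m) (x n)) :
    ∃ e : S → S', Isometry e ∧ ∀ n, e (x n) = y n := by
  have hseq : ∀ z, ∃ a : ℕ → ℕ, Filter.Tendsto (fun k => x (a k)) Filter.atTop (nhds z) := by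
    intro z
    obtain ⟨u, hu, huz⟩ := mem_closure_iff_seq_limit.1 (hx z)
    choose a ha using hu
    exact ⟨a, by simpa [ha] using huz⟩
  have hlim : ∀ z, ∃ w, ∀ n, dist w (y n) = dist z (x n) := by
    intro z
    obtain ⟨a, ha⟩ := hseq z
    have hc : CauchySeq fun k => y (a k) := by
      have := ha.cauchySeq
      rw [Metric.cauchySeq_iff] at this ⊢
      simpa only [hxy] using this
    obtain ⟨w, hw⟩ := cauchySeq_tendsto_of_complete hc
    refine ⟨w, fun n => tendsto_nhds_unique (hw.dist tendsto_const_nhds) ?_⟩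
    simpa only [hxy] using ha.dist tendsto_const_nhds
  choose e he using hlim
  refine ⟨e, Isometry.of_dist_eq fun z z' => ?_, fun n => ?_⟩
  · obtain ⟨a, ha⟩ := hseq z
    have hea : Filter.Tendsto (fun k => y (a k)) Filter.atTop (nhds (e z)) := by
      rw [tendsto_iff_dist_tendsto_zero] at ha ⊢
      simpa only [dist_comm _ (e z), he, dist_comm z] using ha
    refine tendsto_nhds_unique (hea.dist tendsto_const_nhds) ?_
    simpa only [dist_comm _ (e z'), he, dist_comm z'] using ha.dist (tendsto_const_nhds (x := z'))
  · rw [← dist_eq_zero, he, dist_self]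

/-- Every Urysohn sphere is `1/3`-indivisible. -/
theorem stmt1 (S : Type) [MetricSpace S] (hS : IsUrysohnSphere S) :
    EpsIndivisible S (1/3) := by
  intro k hk χ
  have : CompleteSpace S := hS.1
  have : TopologicalSpace.SeparableSpace S := hS.2.1
  have hdiam := hS.2.2.2.1
  have hrich := hS.rich_univ
  set D := ceilMetric S hdiam
  have hDd : ∀ a b, dist a b ≤ (D.d a b : ℝ) / 4 ∧ (D.d a b : ℝ) / 4 ≤ dist a b + 1 / 4 := by
    intro a b
    have h1 : 4 * dist a b ≤ D.d a b := Nat.le_ceil _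
    have h2 : (D.d a b : ℝ) < 4 * dist a b + 1 := Nat.ceil_lt_add_one (by positivity)
    constructor <;> linarith
  have : Nonempty S := let ⟨y, _⟩ := hrich ∅ (by simp) (fun _ => 0) ⟨by simp, by simp⟩; ⟨y⟩
  let x := TopologicalSpace.denseSeq S
  obtain ⟨C₀, hC₀, hC₀rich⟩ := hrich.exists_countable
  have : Countable C₀ := hC₀
  let N := D.restrict C₀
  have hN : N.Rich Set.univ := hC₀rich.restrict
  let T := {q : C₀ × List C₀ // N.Copies D x (q.1 :: q.2)}
  let X : T → S := fun t => x t.1.2.length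
  let π : T → C₀ := fun t => t.1.1
  let le : T → T → Prop := fun s t => s.1.1 :: s.1.2 <:+ t.1.1 :: t.1.2
  have hle : ∀ s t, le s t → N.d (π s) (π t) = D.d (X s) (X t) := fun s t h => by
    rw [N.comm, D.comm]
    exact t.2.d_eq_of_suffix h
  have hlow : ∀ s t, le s t → dist (X s) (X t) ≤ N.d (π s) (π t) / 4 := fun s t h => by
    rw [hle s t h]
    exact (hDd _ _).1
  have hupp : ∀ s t, le s t → (N.d (π s) (π t) : ℝ) / 4 ≤ dist (X s) (X t) + 1 / 4 :=
    fun s t h => by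
      rw [hle s t h]
      exact (hDd _ _).2
  have hwit := exists_forestLipschitz (X := X) (π := π) (le := le) (N := N)
    (fun t => List.suffix_rfl) (fun _ _ _ h h' => List.IsSuffix.trans h h')
    (fun _ _ _ h h' => List.suffix_or_suffix_of_suffix h h') hlow hupp hdiam
  obtain ⟨J, hJ⟩ := hS.exists_map (forestDist X π le)
    (fun a => le_antisymm (forestDist_le fun φ _ => by simp)
      ((abs_nonneg _).trans (abs_sub_le_forestDist (φ := fun _ => 0)
        ⟨by simp, by simp, by simp⟩ a a)))
    (fun a b => by simp only [forestDist, abs_sub_comm])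
    (fun a b c => forestDist_le fun φ hφ => (abs_sub_le _ (φ b) _).trans
      (add_le_add (abs_sub_le_forestDist hφ a b) (abs_sub_le_forestDist hφ b c)))
    (fun a b => forestDist_le fun φ hφ => by
      have ha := hφ.mem a
      have hb := hφ.mem b
      exact abs_le.2 ⟨by linarith, by linarith⟩)
  obtain ⟨i, C, -, hC, hCi⟩ := hN.exists_monochromatic k (fun v => (χ (J (.inl v)) : ℕ))
    fun v _ => (χ (J (.inl v))).2
  obtain ⟨v, l, hvC, hlen, hcop, hsuff⟩ := hC.exists_copies_seq (D := D) (x := x)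
  let t : ℕ → T := fun n => ⟨(v n, l n), hcop n⟩
  have hX : ∀ n, X (t n) = x n := fun n => congrArg x (hlen n)
  have hJt : ∀ m n, m ≤ n → dist (J (.inr (t m))) (J (.inr (t n))) = dist (x m) (x n) := by
    intro m n hmn
    have hmn : le (t m) (t n) := hsuff m n hmn
    rw [hJ, ← hX m, ← hX n]
    refine le_antisymm (forestDist_le fun φ hφ => hφ.tree _ _ hmn) ?_
    obtain ⟨φ, hφ, h0, h⟩ := hwit (t m)
    refine (h (t n) hmn).trans (le_trans ?_ (abs_sub_le_forestDist hφ _ _))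
    rw [h0, zero_sub, abs_neg]
    exact le_abs_self _
  obtain ⟨e, he, hex⟩ := exists_isometry_of_denseRange (TopologicalSpace.denseRange_denseSeq S)
    (y := fun n => J (.inr (t n))) (fun m n => by
      rcases le_total m n with h | h
      · exact hJt m n h
      · rw [dist_comm, hJt n m h, dist_comm])
  refine ⟨χ (J (.inl (v 0))), e, he, fun z => ?_⟩
  obtain ⟨n, hn⟩ := (TopologicalSpace.denseRange_denseSeq S).exists_dist_lt z
    (by norm_num : (0 : ℝ) < 1 / 12)
  refine ⟨J (.inl (v n)), Fin.ext ((hCi _ (hvC n)).trans (hCi _ (hvC 0)).symm), ?_⟩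
  have h1 : dist (e z) (J (.inr (t n))) < 1 / 12 := by
    rw [← hex n, he.dist_eq]
    exact hn
  have h2 : dist (J (.inr (t n))) (J (.inl (v n))) ≤ 1 / 4 := by
    rw [hJ]
    exact forestDist_le fun φ hφ => hφ.label (t n)
  linarith [dist_triangle (e z) (J (.inr (t n))) (J (.inl (v n)))]
end

section
/- Let S be a Urysohn sphere, S_Q a rational Urysohn sphere, and for each positive integer m let S_m be a countable ultrahomogeneous metric space with all distances in [0,1]_m into which every countable metric space with distances in [0,1]_m embeds isometrically. Then the following are equivalent: (i) S is approximately indivisible; (ii) S_Q is approximately indivisible; (iii) for every positive integer m, S_m is (1/m)-indivisible; (iv) for every positive integer m, S_m is indivisible. -/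
open Metric

/-- A pseudometric on `P`, as a bare function. -/
structure IsPseudoDist {P : Type*} (D : P → P → ℝ) : Prop where
  self : ∀ p, D p p = 0
  comm : ∀ p q, D p q = D q p
  triangle : ∀ p q r, D p r ≤ D p q + D q r

namespace IsPseudoDist

variable {P : Type*} {D : P → P → ℝ}

theorem nonneg (h : IsPseudoDist D) (p q : P) : 0 ≤ D p q := by
  have h₁ := h.triangle p q p
  rw [h.self, h.comm q p] at h₁
  linarith

theorem congr (h : IsPseudoDist D) {p p' q q' : P} (hp : D p p' = 0) (hq : D q q' = 0) :
    D p q = D p' q' := by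
  have h₁ := h.triangle p p' q
  have h₂ := h.triangle p' q' q
  have h₃ := h.triangle p' p q'
  have h₄ := h.triangle p q q'
  rw [h.comm q' q] at h₂
  rw [h.comm p' p] at h₃
  linarith

theorem comp {Q : Type*} (h : IsPseudoDist D) (f : Q → P) :
    IsPseudoDist fun a b => D (f a) (f b) :=
  ⟨fun _ => h.self _, fun _ _ => h.comm _ _, fun _ _ _ => h.triangle _ _ _⟩

theorem min_one (h : IsPseudoDist D) : IsPseudoDist fun a b => min 1 (D a b) := by
  refine ⟨fun p => by simp [h.self], fun p q => by simp only [h.comm p q], fun p q r => ?_⟩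
  have h₁ := h.triangle p q r
  have h₂ := h.nonneg p q
  have h₃ := h.nonneg q r
  simp only [min_def]
  split_ifs <;> linarith

end IsPseudoDist

theorem isPseudoDist_dist (X : Type*) [PseudoMetricSpace X] :
    IsPseudoDist (dist : X → X → ℝ) :=
  ⟨dist_self, dist_comm, dist_triangle⟩

/-- Every countable pseudometric with values in `R` is realized by points of `X`. -/
def CountablyUniversal (R : Set ℝ) (X : Type) [MetricSpace X] : Prop :=
  ∀ (P : Type) [Countable P] (D : P → P → ℝ), IsPseudoDist D → (∀ p q, D p q ∈ R) →
    ∃ H : P → X, ∀ p q, dist (H p) (H q) = D p q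

theorem countablyUniversal_of_metric {R : Set ℝ} {X : Type} [MetricSpace X]
    (h : ∀ (Y : Type) [MetricSpace Y], Countable Y → (∀ a b : Y, dist a b ∈ R) →
      ∃ f : Y → X, Isometry f) : CountablyUniversal R X := by
  intro P _ D hD hR
  let _ : PseudoMetricSpace P :=
    { dist := D
      dist_self := hD.self
      dist_comm := hD.comm
      dist_triangle := hD.triangle }
  have hc : Countable (SeparationQuotient P) := SeparationQuotient.surjective_mk.countable
  obtain ⟨f, hf⟩ := h (SeparationQuotient P) hc (fun a b => by
    obtain ⟨a, rfl⟩ := SeparationQuotient.surjective_mk a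
    obtain ⟨b, rfl⟩ := SeparationQuotient.surjective_mk b
    rw [SeparationQuotient.dist_mk]
    exact hR a b)
  refine ⟨fun p => f (SeparationQuotient.mk p), fun p q => ?_⟩
  rw [hf.dist_eq, SeparationQuotient.dist_mk]
  rfl

/-- A pseudometric which only depends on countably much information is realized in a
countably universal space. -/
theorem CountablyUniversal.exists_of_factors {R : Set ℝ} {X : Type} [MetricSpace X]
    (h : CountablyUniversal R X) {P Q : Type} [Countable Q] {D : P → P → ℝ}
    (hD : IsPseudoDist D) (hR : ∀ p q, D p q ∈ R) (c : P → Q)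
    (hc : ∀ p q, c p = c q → D p q = 0) : ∃ H : P → X, ∀ p q, dist (H p) (H q) = D p q := by
  choose σ hσ using fun v : Set.range c => v.2
  obtain ⟨H, hH⟩ := h (Set.range c) (fun a b => D (σ a) (σ b)) (hD.comp σ) (fun _ _ => hR _ _)
  exact ⟨fun p => H ⟨c p, p, rfl⟩, fun p q => (hH _ _).trans
    (hD.congr (hc _ _ (hσ ⟨c p, p, rfl⟩)) (hc _ _ (hσ ⟨c q, q, rfl⟩)))⟩

/-- Finite Katetov functions are realized in ultrahomogeneous countably universal spaces. -/
theorem exists_dist_eq_of_katetov {R : Set ℝ} (hR0 : (0 : ℝ) ∈ R) {X : Type} [MetricSpace X]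
    (hX : CountablyUniversal R X) (hu : IsUltrahomogeneous X) (hR : ∀ x y : X, dist x y ∈ R)
    {ι : Type} [Finite ι] (p : ι → X) (f : ι → ℝ) (hf : ∀ i, f i ∈ R)
    (hf₁ : ∀ i j, f i ≤ f j + dist (p i) (p j)) (hf₂ : ∀ i j, dist (p i) (p j) ≤ f i + f j) :
    ∃ a, ∀ i, dist a (p i) = f i := by
  let D : Option ι → Option ι → ℝ
    | none, none => 0
    | none, some i => f i
    | some i, none => f i
    | some i, some j => dist (p i) (p j)
  have hf₃ : ∀ i, 0 ≤ f i := fun i => by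
    have := hf₂ i i
    rw [dist_self] at this
    linarith
  have hD : IsPseudoDist D := by
    refine ⟨?_, ?_, ?_⟩
    · rintro (_ | i) <;> simp [D]
    · rintro (_ | i) (_ | j) <;> simp [D, dist_comm]
    · rintro (_ | i) (_ | j) (_ | k) <;> simp only [D]
      · simp
      · simp
      · linarith [hf₃ j]
      · have := hf₁ k j
        rw [dist_comm] at this
        linarith
      · simp
      · exact hf₂ i k
      · linarith [hf₁ i j]
      · exact dist_triangle _ _ _
  obtain ⟨H, hH⟩ := hX (Option ι) D hD (by
    rintro (_ | i) (_ | j)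
    exacts [hR0, hf j, hf i, hR _ _])
  choose σ hσ using fun v : Set.range (fun i => H (some i)) => v.2
  obtain ⟨ψ, hψ⟩ := hu (Set.range fun i => H (some i)) (Set.finite_range _)
    (fun v => p (σ v)) (Isometry.of_dist_eq fun v w =>
      (hH (some (σ v)) (some (σ w))).symm.trans (congrArg₂ dist (hσ v) (hσ w)))
  refine ⟨ψ (H none), fun i => ?_⟩
  have h₁ : ψ (H (some i)) = p (σ ⟨H (some i), i, rfl⟩) := hψ ⟨H (some i), i, rfl⟩
  have h₂ : p (σ ⟨H (some i), i, rfl⟩) = p i := by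
    rw [← dist_eq_zero]
    exact (hH (some (σ ⟨H (some i), i, rfl⟩)) (some i)).symm.trans
      (dist_eq_zero.2 (hσ ⟨H (some i), i, rfl⟩))
  rw [← h₂, ← h₁, ψ.dist_eq]
  exact hH none (some i)

/-- An isometry defined on a dense sequence extends to the whole space. -/
theorem exists_isometry_extend {ι X C : Type*} [MetricSpace X] [MetricSpace C] [CompleteSpace C]
    {x : ι → X} (hx : DenseRange x) {h : ι → C}
    (hh : ∀ i j, dist (h i) (h j) = dist (x i) (x j)) :
    ∃ g : X → C, Isometry g ∧ ∀ i, g (x i) = h i := by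
  let _ : PseudoMetricSpace ι := PseudoMetricSpace.induced x inferInstance
  have hxi : Isometry x := Isometry.of_dist_eq fun _ _ => rfl
  have hhi : Isometry h := Isometry.of_dist_eq hh
  have hu := hxi.isUniformInducing
  have hg := uniformContinuous_uniformly_extend hu hx hhi.uniformContinuous
  have he := uniformly_extend_of_ind hu hx hhi.uniformContinuous
  refine ⟨_, Isometry.of_dist_eq fun a b => ?_, he⟩
  refine hx.induction_on₂ (p := fun a b => dist ((hu.isDenseInducing hx).extend h a)
    ((hu.isDenseInducing hx).extend h b) = dist a b) ?_ (fun i j => ?_) a b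
  · have hc := hg.continuous
    exact isClosed_eq ((hc.comp continuous_fst).dist (hc.comp continuous_snd)) continuous_dist
  · rw [he, he, hh]

/-- Recursive construction of a sequence each of whose terms satisfies a condition relative to
the preceding ones. -/
theorem exists_seq_of_step {α : Type*} [Nonempty α] {P : ℕ → α → Prop}
    {R : ℕ → ℕ → α → α → Prop}
    (step : ∀ (n : ℕ) (y : ℕ → α), (∀ i < n, P i (y i)) →
      (∀ j < n, ∀ i < j, R i j (y i) (y j)) → ∃ a, P n a ∧ ∀ i < n, R i n (y i) a) :
    ∃ y : ℕ → α, (∀ n, P n (y n)) ∧ ∀ j, ∀ i < j, R i j (y i) (y j) := by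
  choose! g hg using step
  let F : ℕ → ℕ → α :=
    fun n => Nat.rec (fun _ => Classical.arbitrary α) (fun n F => Function.update F n (g n F)) n
  have hF : ∀ n, F (n + 1) = Function.update (F n) n (g n (F n)) := fun _ => rfl
  have hpre : ∀ n, ∀ i < n, F n i = g i (F i) := by
    intro n
    induction n with
    | zero => intro i hi; omega
    | succ n ih =>
      intro i hi
      rw [hF]
      rcases eq_or_ne i n with rfl | hne
      · simp
      · rw [Function.update_of_ne hne, ih i (by omega)]
  have key : ∀ n, P n (g n (F n)) ∧ ∀ i < n, R i n (g i (F i)) (g n (F n)) := by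
    intro n
    induction n using Nat.strong_induction_on with
    | _ n ih =>
      have h := hg n (F n) (fun i hi => by rw [hpre n i hi]; exact (ih i hi).1)
        (fun j hj i hi => by
          rw [hpre n i (by omega), hpre n j hj]
          exact (ih j hj).2 i hi)
      refine ⟨h.1, fun i hi => ?_⟩
      rw [← hpre n i hi]
      exact h.2 i hi
  exact ⟨fun n => g n (F n), fun n => (key n).1, fun n => (key n).2⟩

/-- Rounding up to a multiple of `l`, truncated at `m` and rescaled to `[0,1]_m`. -/
noncomputable def roundUp (m : ℕ) (l t : ℝ) : ℝ := ((min m ⌈t / l⌉₊ : ℕ) : ℝ) / m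

theorem roundUp_mem (m : ℕ) (l t : ℝ) : roundUp m l t ∈ distSetM m :=
  ⟨_, min_le_left _ _, rfl⟩

theorem IsPseudoDist.roundUp {P : Type*} {D : P → P → ℝ} (hD : IsPseudoDist D) (m : ℕ) {l : ℝ}
    (hl : 0 < l) : IsPseudoDist fun p q => roundUp m l (D p q) := by
  refine ⟨fun p => by simp [_root_.roundUp, hD.self], fun p q => by simp only [hD.comm p q],
    fun p q r => ?_⟩
  have h₁ : ⌈D p r / l⌉₊ ≤ ⌈D p q / l⌉₊ + ⌈D q r / l⌉₊ := by
    refine (Nat.ceil_mono ?_).trans (Nat.ceil_add_le _ _)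
    rw [← add_div]
    gcongr
    exact hD.triangle p q r
  simp only [_root_.roundUp]
  rw [← add_div]
  gcongr
  norm_cast
  omega

theorem le_roundUp {m : ℕ} (hm : 0 < m) {t : ℝ} (ht : t ≤ 1) : t ≤ roundUp m (1 / m) t := by
  have hm' : (0 : ℝ) < m := by exact_mod_cast hm
  rw [roundUp, le_div_iff₀ hm', Nat.cast_min, le_min_iff]
  refine ⟨by nlinarith, ?_⟩
  rw [div_div_eq_mul_div, div_one]
  exact Nat.le_ceil _

theorem roundUp_le {m : ℕ} (hm : 0 < m) {t : ℝ} (ht : 0 ≤ t) :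
    roundUp m (1 / m) t ≤ t + 1 / m := by
  have hm' : (0 : ℝ) < m := by exact_mod_cast hm
  rw [roundUp, div_le_iff₀ hm', add_mul, one_div_mul_cancel hm'.ne', Nat.cast_min]
  refine (min_le_right _ _).trans ?_
  rw [div_div_eq_mul_div, div_one]
  exact (Nat.ceil_lt_add_one (by positivity)).le

theorem roundUp_eq {m k : ℕ} (hk : 1 ≤ k) (hkm : k ≤ m) {ε t : ℝ} (hε : 0 < ε)
    (hεm : ε * m * m < 1) (ht : |t - k / m| ≤ ε) : roundUp m (1 / m + ε) t = k / m := by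
  have hm' : (0 : ℝ) < m := by exact_mod_cast hk.trans hkm
  have hk' : (1 : ℝ) ≤ k := by exact_mod_cast hk
  have hkm' : (k : ℝ) ≤ m := by exact_mod_cast hkm
  have hl : 0 < 1 / (m : ℝ) + ε := by positivity
  rw [abs_le] at ht
  have hceil : ⌈t / (1 / m + ε)⌉₊ = k := by
    rw [Nat.ceil_eq_iff (by omega), lt_div_iff₀ hl, div_le_iff₀ hl, Nat.cast_sub hk, Nat.cast_one]
    have h₁ : (k : ℝ) * (1 / m + ε) = k / m + k * ε := by ring
    have h₂ : ((k : ℝ) - 1) * (1 / m + ε) = k / m + k * ε - 1 / m - ε := by ring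
    have h₃ : ε * m < 1 / m := by rwa [lt_div_iff₀ hm']
    rw [h₁, h₂]
    constructor <;> nlinarith
  rw [roundUp, hceil, min_eq_right hkm]

theorem IsUrysohnSphereM.countablyUniversal {m : ℕ} {W : Type} [MetricSpace W]
    (h : IsUrysohnSphereM m W) : CountablyUniversal (distSetM m) W :=
  countablyUniversal_of_metric h.2.2.2

theorem distSetM_rat {m : ℕ} {d : ℝ} (hd : d ∈ distSetM m) : ∃ q : ℚ, 0 ≤ q ∧ q ≤ 1 ∧ d = q := by
  obtain ⟨k, hk, rfl⟩ := hd
  refine ⟨k / m, by positivity, ?_, by push_cast; rfl⟩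
  exact div_le_one_of_le₀ (by exact_mod_cast hk) (by positivity)

theorem IsUrysohnSphereM.dist_le_one {m : ℕ} {W : Type} [MetricSpace W]
    (h : IsUrysohnSphereM m W) (v w : W) : dist v w ≤ 1 := by
  obtain ⟨q, -, hq, h'⟩ := distSetM_rat (h.2.2.1 v w)
  rw [h']
  exact_mod_cast hq

theorem IsRationalUrysohnSphere.countablyUniversal {Q : Type} [MetricSpace Q]
    (h : IsRationalUrysohnSphere Q) :
    CountablyUniversal {d | ∃ q : ℚ, 0 ≤ q ∧ q ≤ 1 ∧ d = q} Q :=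
  countablyUniversal_of_metric h.2.2.2

theorem IsUrysohnSphere.countablyUniversal {S : Type} [MetricSpace S]
    (h : IsUrysohnSphere S) : CountablyUniversal (Set.Iic 1) S :=
  countablyUniversal_of_metric fun Y _ _ hY => h.2.2.2.2 Y inferInstance hY

theorem IsUrysohnSphere.nonempty {S : Type} [MetricSpace S] (h : IsUrysohnSphere S) :
    Nonempty S := by
  obtain ⟨H, -⟩ := h.countablyUniversal Unit (fun _ _ => 0)
    ⟨fun _ => rfl, fun _ _ => rfl, fun _ _ _ => by simp⟩ (fun _ _ => Set.mem_Iic.2 zero_le_one)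
  exact ⟨H ()⟩

theorem IsRationalUrysohnSphere.nonempty {Q : Type} [MetricSpace Q]
    (h : IsRationalUrysohnSphere Q) : Nonempty Q := by
  obtain ⟨H, -⟩ := h.countablyUniversal Unit (fun _ _ => 0)
    ⟨fun _ => rfl, fun _ _ => rfl, fun _ _ _ => by simp⟩
    (fun _ _ => ⟨0, le_rfl, zero_le_one, by simp⟩)
  exact ⟨H ()⟩

/-- Approximate indivisibility of the rational Urysohn sphere makes the spaces `S_m`
indivisible. -/
theorem ApproxIndivisible.epsIndivisible_zero {Q : Type} [MetricSpace Q]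
    (hQ : IsRationalUrysohnSphere Q) (h : ApproxIndivisible Q) {m : ℕ} (hm : 0 < m) {W : Type}
    [MetricSpace W] (hW : IsUrysohnSphereM m W) : EpsIndivisible W 0 := by
  intro k hk χ
  have := hQ.1
  have := hW.1
  have hm' : (0 : ℝ) < m := by exact_mod_cast hm
  set ε : ℝ := 1 / (2 * m * m) with hεdef
  have hε : 0 < ε := by positivity
  have hεm : ε * m * m < 1 := by
    rw [hεdef]
    field_simp
    norm_num
  obtain ⟨j, hj⟩ := hW.countablyUniversal Q _
    ((isPseudoDist_dist Q).roundUp m (l := 1 / m + ε) (by positivity))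
    (fun _ _ => roundUp_mem _ _ _)
  obtain ⟨g, hg⟩ := hQ.countablyUniversal W _ (isPseudoDist_dist W)
    (fun v w => distSetM_rat (hW.2.2.1 v w))
  obtain ⟨i, e, he, hei⟩ := h (ε / 2) (by positivity) k hk (χ ∘ j)
  choose x hx hxd using fun w => hei (g w)
  refine ⟨i, fun w => j (x w), Isometry.of_dist_eq fun v w => ?_, fun w => ⟨_, hx w, by simp⟩⟩
  rcases eq_or_ne v w with rfl | hvw
  · simp
  obtain ⟨a, ham, ha⟩ := hW.2.2.1 v w
  have ha1 : 1 ≤ a := by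
    rw [Nat.one_le_iff_ne_zero]
    rintro rfl
    simp [hvw] at ha
  rw [hj, ha]
  refine roundUp_eq ha1 ham hε hεm ?_
  rw [← ha, ← hg v w, ← he.dist_eq (g v) (g w), ← Real.dist_eq]
  refine (dist_dist_dist_le _ _ _ _).trans ?_
  have h₁ := hxd v
  have h₂ := hxd w
  rw [dist_comm] at h₁ h₂
  linarith

open Filter Topology in
/-- A separable metric space of diameter at most `1` embeds in the completion of a rational
Urysohn sphere. -/
theorem IsRationalUrysohnSphere.exists_isometry_completion {Q : Type} [MetricSpace Q]
    (hQ : IsRationalUrysohnSphere Q) (X : Type) [MetricSpace X]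
    [TopologicalSpace.SeparableSpace X] [Nonempty X] (hX : ∀ x y : X, dist x y ≤ 1) :
    ∃ κ : X → UniformSpace.Completion Q, Isometry κ := by
  let s := TopologicalSpace.denseSeq X
  let ε : ℕ × ℕ → ℝ := fun a => 1 / ((a.2 : ℝ) + 1)
  have hε : ∀ a, 0 < ε a := fun a => by positivity
  have hr : ∀ x y : ℝ, x < y → ∃ q : ℚ, x < q ∧ (q : ℝ) < y := fun _ _ => exists_rat_btwn
  choose! r hr using hr
  let lo : ℕ × ℕ → ℕ × ℕ → ℝ := fun a b => dist (s a.1) (s b.1) + max (ε a) (ε b)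
  let hi : ℕ × ℕ → ℕ × ℕ → ℝ := fun a b => dist (s a.1) (s b.1) + (ε a + ε b)
  have hlohi : ∀ a b, lo a b < hi a b := fun a b => by
    have h₁ := hε a
    have h₂ := hε b
    simp only [lo, hi]
    rcases max_choice (ε a) (ε b) with h | h <;> rw [h] <;> linarith
  let D : ℕ × ℕ → ℕ × ℕ → ℝ := fun a b => if a = b then 0 else r (lo a b) (hi a b)
  have hD : IsPseudoDist D := by
    refine ⟨fun a => by simp [D], fun a b => ?_, fun a b c => ?_⟩
    · simp only [D, eq_comm (a := a), lo, hi, dist_comm (s a.1), max_comm (ε a), add_comm (ε a)]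
    · have h₁ := hr _ _ (hlohi a b)
      have h₂ := hr _ _ (hlohi b c)
      have h₃ := hr _ _ (hlohi a c)
      have h₄ := dist_triangle (s a.1) (s b.1) (s c.1)
      have h₅ := le_max_left (ε a) (ε b)
      have h₆ := le_max_right (ε b) (ε c)
      have h₇ : 0 ≤ lo a b := add_nonneg dist_nonneg ((hε a).le.trans (le_max_left _ _))
      by_cases hac : a = c
      · subst hac
        by_cases hab : a = b
        · simp [D, hab]
        · simp only [D, if_true, if_neg hab, if_neg (Ne.symm hab)]
          have h₈ : 0 ≤ lo b a := add_nonneg dist_nonneg ((hε b).le.trans (le_max_left _ _))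
          linarith
      by_cases hab : a = b
      · subst hab
        simp [D]
      by_cases hbc : b = c
      · subst hbc
        simp [D]
      simp only [D, if_neg hac, if_neg hab, if_neg hbc]
      simp only [lo, hi] at *
      linarith
  have hDrat : ∀ a b, ∃ q : ℚ, 0 ≤ q ∧ q ≤ 1 ∧ min 1 (D a b) = q := fun a b => by
    have hq : ∃ q : ℚ, D a b = q := by
      by_cases hab : a = b
      · exact ⟨0, by simp [D, hab]⟩
      · exact ⟨_, if_neg hab⟩
    obtain ⟨q, hq⟩ := hq
    have h₀ := hD.nonneg a b
    rw [hq] at h₀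
    refine ⟨min 1 q, le_min zero_le_one (by exact_mod_cast h₀), min_le_left _ _, ?_⟩
    rw [hq]
    push_cast
    rfl
  have hDapprox : ∀ a b, |min 1 (D a b) - dist (s a.1) (s b.1)| ≤ ε a + ε b := fun a b => by
    have h₁ := hr _ _ (hlohi a b)
    have h₂ := hX (s a.1) (s b.1)
    have h₃ := hε a
    have h₄ := hε b
    have h₅ := le_max_left (ε a) (ε b)
    by_cases hab : a = b
    · subst hab
      simp only [D, if_true, dist_self]
      norm_num
      linarith
    · simp only [D, if_neg hab, abs_le]
      simp only [lo, hi] at *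
      constructor
      · have : dist (s a.1) (s b.1) ≤ min 1 (r (lo a b) (hi a b) : ℝ) :=
          le_min h₂ (by simp only [lo, hi]; linarith)
        simp only [lo, hi] at this
        linarith
      · refine (sub_le_sub_right (min_le_right _ _) _).trans ?_
        linarith
  obtain ⟨φ, hφ⟩ := hQ.countablyUniversal (ℕ × ℕ) _ hD.min_one hDrat
  let u : ℕ → ℕ → UniformSpace.Completion Q := fun n k => (φ (n, k) : UniformSpace.Completion Q)
  have hu : ∀ n k n' k', dist (u n k) (u n' k') = min 1 (D (n, k) (n', k')) :=
    fun n k n' k' => (UniformSpace.Completion.dist_eq _ _).trans (hφ _ _)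
  have hlim : Tendsto (fun k : ℕ => 1 / ((k : ℝ) + 1) + 1 / ((k : ℝ) + 1)) atTop (𝓝 0) := by
    simpa using (tendsto_one_div_add_atTop_nhds_zero_nat (𝕜 := ℝ)).add
      tendsto_one_div_add_atTop_nhds_zero_nat
  have hcauchy : ∀ n, CauchySeq (u n) := fun n => by
    refine cauchySeq_of_le_tendsto_0 _ (fun k l N hk hl => ?_) hlim
    rw [hu]
    have h₁ := hDapprox (n, k) (n, l)
    rw [dist_self, sub_zero] at h₁
    refine (le_abs_self _).trans (h₁.trans (add_le_add ?_ ?_)) <;>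
    exact one_div_le_one_div_of_le (by positivity) (by simpa using ‹N ≤ _›)
  choose t ht using fun n => cauchySeq_tendsto_of_complete (hcauchy n)
  obtain ⟨κ, hκ, -⟩ := exists_isometry_extend (TopologicalSpace.denseRange_denseSeq X) (h := t)
    (fun n n' => by
      refine tendsto_nhds_unique ((ht n).dist (ht n')) ?_
      rw [tendsto_iff_dist_tendsto_zero]
      refine squeeze_zero (fun _ => dist_nonneg) (fun k => ?_) hlim
      rw [hu, Real.dist_eq]
      exact hDapprox (n, k) (n', k))
  exact ⟨κ, hκ⟩

theorem exists_forall_le_and_eq {n : ℕ} (g : Fin n → ℝ) :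
    ∃ r, (∀ i, g i ≤ r) ∧ (r = 0 ∨ ∃ i, r = g i) := by
  rcases isEmpty_or_nonempty (Fin n) with _ | _
  · exact ⟨0, fun i => isEmptyElim i, Or.inl rfl⟩
  · obtain ⟨i, hi⟩ := Finite.exists_max g
    exact ⟨g i, hi, Or.inr ⟨i, rfl⟩⟩

/-- An isometric copy of a rational Urysohn sphere `Q` in the completion of `Q` can be moved
into `Q` by an arbitrarily small perturbation. -/
theorem IsRationalUrysohnSphere.exists_isometry_near {Q : Type} [MetricSpace Q]
    (hQ : IsRationalUrysohnSphere Q) {φ : Q → UniformSpace.Completion Q} (hφ : Isometry φ)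
    {η : ℝ} (hη : 0 < η) :
    ∃ ψ : Q → Q, Isometry ψ ∧ ∀ x, dist ((ψ x : Q) : UniformSpace.Completion Q) (φ x) ≤ η := by
  have := hQ.1
  have := hQ.nonempty
  obtain ⟨x, hx⟩ := exists_surjective_nat Q
  let b : ℕ → ℝ := fun n => η * (1 - (1 / 2) ^ n)
  have hb : Monotone b := fun m n hmn => by
    have : (1 / 2 : ℝ) ^ n ≤ (1 / 2) ^ m := pow_le_pow_of_le_one (by norm_num) (by norm_num) hmn
    simp only [b]
    nlinarith
  have hb' : ∀ n, b n < b (n + 1) := fun n => by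
    have : (0 : ℝ) < (1 / 2) ^ n := by positivity
    simp only [b, pow_succ]
    nlinarith
  have hb0 : b 0 = 0 := by simp [b]
  have hbη : ∀ n, b n ≤ η := fun n => by
    have : (0 : ℝ) < (1 / 2) ^ n := by positivity
    simp only [b]
    nlinarith
  obtain ⟨y, hy₁, hy₂⟩ := exists_seq_of_step (α := Q)
    (P := fun n a => dist (a : UniformSpace.Completion Q) (φ (x n)) ≤ b (n + 1))
    (R := fun i j a a' => dist a' a = dist (x j) (x i)) (fun n y h₁ h₂ => by
      set θ := (b (n + 1) - b n) / 2 with hθdef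
      have hθ : 0 < θ := by
        have := hb' n
        simp only [hθdef]
        linarith
      obtain ⟨u, hu⟩ : ∃ u : Q, dist (φ (x n)) (u : UniformSpace.Completion Q) < θ :=
        UniformSpace.Completion.denseRange_coe.exists_dist_lt _ hθ
      have hyy : ∀ i j : Fin n, dist (y i) (y j) = dist (x i) (x j) := fun i j => by
        rcases lt_trichotomy i j with h | rfl | h
        · rw [dist_comm, h₂ j j.2 i h, dist_comm]
        · simp
        · exact h₂ i i.2 j h
      obtain ⟨r, hr₁, hr₂⟩ := exists_forall_le_and_eq
        (fun i : Fin n => |dist (x n) (x i) - dist u (y i)|)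
      have hr₀ : 0 ≤ r := by
        rcases hr₂ with h | ⟨i, h⟩ <;> rw [h]
        exact abs_nonneg _
      have hrrat : ∃ q : ℚ, 0 ≤ q ∧ q ≤ 1 ∧ r = q := by
        rcases hr₂ with h | ⟨i, h⟩
        · exact ⟨0, le_rfl, zero_le_one, by simpa using h⟩
        · obtain ⟨q, hq₀, hq₁, hq⟩ := hQ.2.2.1 (x n) (x i)
          obtain ⟨q', hq'₀, hq'₁, hq'⟩ := hQ.2.2.1 u (y i)
          refine ⟨|q - q'|, abs_nonneg _, abs_le.2 ⟨by linarith, by linarith⟩, ?_⟩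
          rw [h, hq, hq']
          push_cast
          rfl
      obtain ⟨a, ha⟩ := exists_dist_eq_of_katetov (by exact ⟨0, le_rfl, zero_le_one, by simp⟩)
        hQ.countablyUniversal hQ.2.1 hQ.2.2.1 (ι := Option (Fin n))
        (fun o => o.elim u fun i => y i) (fun o => o.elim r fun i => dist (x n) (x i))
        (by
          rintro (_ | i)
          · exact hrrat
          · exact hQ.2.2.1 _ _)
        (by
          rintro (_ | i) (_ | j) <;> simp only [Option.elim_none, Option.elim_some]
          · simp
          · rcases hr₂ with h | ⟨i, h⟩
            · rw [h]
              positivity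
            · have h₃ := dist_triangle u (y j) (y i)
              have h₄ := dist_triangle u (y i) (y j)
              have h₅ := dist_triangle (x n) (x j) (x i)
              have h₆ := dist_triangle_left (x j) (x i) (x n)
              have h₇ := dist_triangle (y i) u (y j)
              rw [hyy] at h₃ h₇
              rw [dist_comm (y i) u] at h₇
              rw [dist_comm (x j)] at *
              rw [h, abs_le']
              constructor <;> linarith
          · have h₃ := (abs_le.1 (hr₁ i)).2
            rw [dist_comm (y i)]
            linarith
          · rw [hyy, dist_comm (x i)]
            exact dist_triangle _ _ _)
        (by
          rintro (_ | i) (_ | j) <;> simp only [Option.elim_none, Option.elim_some]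
          · simpa using hr₀
          · have h₃ := (abs_le.1 (hr₁ j)).1
            linarith
          · have h₃ := (abs_le.1 (hr₁ i)).1
            rw [dist_comm (y i)]
            linarith
          · rw [hyy, dist_comm (x n)]
            exact dist_triangle _ _ _)
      refine ⟨a, ?_, fun i hi => ha (some ⟨i, hi⟩)⟩
      have hau : dist (a : UniformSpace.Completion Q) u = r :=
        (UniformSpace.Completion.dist_eq _ _).trans (ha none)
      have hrb : r ≤ θ + b n := by
        rcases hr₂ with h | ⟨i, h⟩
        · have := hb (Nat.zero_le n)
          linarith
        · have h₃ := h₁ i i.2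
          have h₄ : b (i + 1) ≤ b n := hb i.2
          have h₅ := dist_dist_dist_le (φ (x n)) (φ (x i)) (u : UniformSpace.Completion Q) (y i)
          rw [Real.dist_eq, hφ.dist_eq, UniformSpace.Completion.dist_eq, ← h,
            dist_comm (φ (x i))] at h₅
          linarith
      have h₆ := dist_triangle_right (a : UniformSpace.Completion Q) (φ (x n)) u
      linarith)
  have hyx : ∀ i j, dist (y i) (y j) = dist (x i) (x j) := fun i j => by
    rcases lt_trichotomy i j with h | rfl | h
    · rw [dist_comm, hy₂ j i h, dist_comm]
    · simp
    · exact hy₂ i j h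
  choose σ hσ using hx
  refine ⟨fun p => y (σ p), Isometry.of_dist_eq fun p q => by rw [hyx, hσ, hσ], fun p => ?_⟩
  have h := (hy₁ (σ p)).trans (hbη _)
  rwa [hσ] at h

/-- Oscillation stability passes from the Urysohn sphere to the rational Urysohn sphere. -/
theorem ApproxIndivisible.rational {S Q : Type} [MetricSpace S] [MetricSpace Q]
    (hS : IsUrysohnSphere S) (hQ : IsRationalUrysohnSphere Q) (h : ApproxIndivisible S) :
    ApproxIndivisible Q := by
  intro ε hε k hk χ
  have := hS.2.1
  have := hS.nonempty
  have := hQ.1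
  obtain ⟨κ, hκ⟩ := hQ.exists_isometry_completion S hS.2.2.2.1
  obtain ⟨ι, hι⟩ := hS.countablyUniversal Q _ (isPseudoDist_dist Q) (fun p q => by
    obtain ⟨r, -, hr, h'⟩ := hQ.2.2.1 p q
    rw [h', Set.mem_Iic]
    exact_mod_cast hr)
  have hι : Isometry ι := Isometry.of_dist_eq hι
  have hε3 : 0 < ε / 3 := by positivity
  choose near hnear using fun s => UniformSpace.Completion.denseRange_coe.exists_dist_lt (κ s) hε3
  obtain ⟨i, e, he, hei⟩ := h (ε / 3) hε3 k hk (χ ∘ near)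
  obtain ⟨ψ, hψ, hψd⟩ := hQ.exists_isometry_near (hκ.comp (he.comp hι)) hε3
  refine ⟨i, ψ, hψ, fun z => ?_⟩
  obtain ⟨s, hs, hsd⟩ := hei (ι z)
  refine ⟨near s, hs, ?_⟩
  rw [← UniformSpace.Completion.dist_eq]
  rw [← hκ.dist_eq] at hsd
  have h₁ := dist_triangle4 (ψ z : UniformSpace.Completion Q) (κ (e (ι z))) (κ s) (near s)
  have h₂ := hψd z
  have h₃ := hnear s
  simp only [Function.comp_apply] at h₂
  linarith

section Gluing

variable {W T : Type*} [MetricSpace W] {ρ : T → T → ℝ} {A : T → W → ℝ}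

/-- The pseudometric on `W ⊕ T` in which the distance between `s : T` and `w : W` is `A s w`,
and distances in `T` are those of `ρ` or of the shortest path through `W`. -/
noncomputable def glue (ρ : T → T → ℝ) (A : T → W → ℝ) : W ⊕ T → W ⊕ T → ℝ
  | .inl v, .inl w => dist v w
  | .inl w, .inr s => A s w
  | .inr s, .inl w => A s w
  | .inr s, .inr t => min (ρ s t) (⨅ w, A s w + A t w)

theorem isPseudoDist_glue [Nonempty W] (hρ : IsPseudoDist ρ)
    (hA₁ : ∀ s v w, A s v ≤ A s w + dist w v)
    (hA₂ : ∀ s v w, dist v w ≤ A s v + A s w) (hA₃ : ∀ s t w, A s w ≤ ρ s t + A t w) :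
    IsPseudoDist (glue ρ A) := by
  have hA₀ : ∀ s w, 0 ≤ A s w := fun s w => by
    have := hA₂ s w w
    rw [dist_self] at this
    linarith
  have hle : ∀ s t w, ⨅ w, A s w + A t w ≤ A s w + A t w := fun s t w =>
    ciInf_le ⟨0, by rintro _ ⟨w, rfl⟩; exact add_nonneg (hA₀ _ _) (hA₀ _ _)⟩ w
  have hcomm : ∀ p q, glue ρ A p q = glue ρ A q p := by
    rintro (v | s) (w | t) <;> simp only [glue]
    · exact dist_comm _ _
    · simp only [hρ.comm s t, add_comm (A s _)]
  have hA₄ : ∀ s t w, A s w ≤ min (ρ s t) (⨅ w, A s w + A t w) + A t w := fun s t w => by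
    rw [← sub_le_iff_le_add]
    refine le_min (sub_le_iff_le_add.2 (hA₃ s t w)) (le_ciInf fun v => ?_)
    have h₁ := hA₁ s w v
    have h₂ := hA₂ t v w
    linarith
  refine ⟨?_, hcomm, ?_⟩
  · rintro (v | s)
    · exact dist_self v
    · simp only [glue, hρ.self]
      exact min_eq_left (le_ciInf fun w => add_nonneg (hA₀ _ _) (hA₀ _ _))
  · rintro (u | s) (v | t) (w | r) <;> simp only [glue]
    · exact dist_triangle _ _ _
    · have := hA₁ r u v
      rw [dist_comm] at this
      linarith
    · exact hA₂ _ _ _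
    · have := hA₄ r t u
      have h := hcomm (.inr r) (.inr t)
      simp only [glue] at h
      linarith
    · have := hA₁ s w v
      linarith
    · exact (min_le_right _ _).trans (hle _ _ _)
    · exact hA₄ _ _ _
    · rcases min_choice (ρ s t) (⨅ w, A s w + A t w) with h | h <;> rw [h]
      · rcases min_choice (ρ t r) (⨅ w, A t w + A r w) with h' | h' <;> rw [h']
        · exact (min_le_left _ _).trans (hρ.triangle _ _ _)
        · rw [← sub_le_iff_le_add']
          refine le_ciInf fun w => ?_
          have h₁ := (min_le_right (ρ s r) (⨅ w, A s w + A r w)).trans (hle s r w)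
          have h₂ := hA₃ s t w
          linarith
      · rw [← sub_le_iff_le_add]
        refine le_ciInf fun w => ?_
        have h₁ := (min_le_right (ρ s r) (⨅ w, A s w + A r w)).trans (hle s r w)
        have h₂ := hA₄ r t w
        have h := hcomm (.inr r) (.inr t)
        simp only [glue] at h
        linarith

/-- If `π : T → W` does not increase distances by more than `2 * δ`, then `T` can be attached to
`W` along `π` at distance `2 * δ`, keeping the distances of all pairs in `T` on which `ρ` is not
larger than the distance of the images. -/
theorem exists_attach [Nonempty W] (hρ : IsPseudoDist ρ) {δ : ℝ} (hδ : 0 ≤ δ) (π : T → W)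
    (hπ : ∀ s t, dist (π s) (π t) ≤ ρ s t + 2 * δ) :
    ∃ D : W ⊕ T → W ⊕ T → ℝ, IsPseudoDist D ∧ (∀ v w, D (.inl v) (.inl w) = dist v w) ∧
      (∀ s t, ρ s t ≤ dist (π s) (π t) → D (.inr s) (.inr t) = ρ s t) ∧
      (∀ s t, D (.inr s) (.inr t) ≤ ρ s t) ∧ ∀ s, D (.inr s) (.inl (π s)) ≤ 2 * δ := by
  have hnn : ∀ s w t, 0 ≤ ρ s t + dist (π t) w := fun s w t =>
    add_nonneg (hρ.nonneg _ _) dist_nonneg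
  have hle : ∀ s w t, ⨅ t, ρ s t + dist (π t) w ≤ ρ s t + dist (π t) w := fun s w t =>
    ciInf_le ⟨0, by rintro _ ⟨t, rfl⟩; exact hnn s w t⟩ t
  have hge : ∀ s w, dist (π s) w - 2 * δ ≤ ⨅ t, ρ s t + dist (π t) w := fun s w => by
    have : Nonempty T := ⟨s⟩
    refine le_ciInf fun t => ?_
    have h₁ := hπ s t
    have h₂ := dist_triangle (π s) (π t) w
    linarith
  let A : T → W → ℝ := fun s w => 2 * δ + ⨅ t, ρ s t + dist (π t) w
  have hA₂ : ∀ s v w, dist v w ≤ A s v + A s w := fun s v w => by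
    have : Nonempty T := ⟨s⟩
    have h : dist v w - 4 * δ - (⨅ t, ρ s t + dist (π t) w) ≤ ⨅ t, ρ s t + dist (π t) v := by
      refine le_ciInf fun t => ?_
      rw [sub_le_comm]
      refine le_ciInf fun t' => ?_
      have h₁ := hπ t t'
      have h₂ := hρ.triangle t s t'
      have h₃ := dist_triangle4 v (π t) (π t') w
      rw [hρ.comm t s] at h₂
      rw [dist_comm v (π t)] at h₃
      linarith
    simp only [A]
    linarith
  refine ⟨glue ρ A, isPseudoDist_glue hρ (fun s v w => ?_) hA₂ (fun s t w => ?_),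
    fun _ _ => rfl, fun s t hst => ?_, fun s t => min_le_left _ _, fun s => ?_⟩
  · have : Nonempty T := ⟨s⟩
    have h : (⨅ t, ρ s t + dist (π t) v) - dist w v ≤ ⨅ t, ρ s t + dist (π t) w := by
      refine le_ciInf fun t => ?_
      have h₁ := hle s v t
      have h₂ := dist_triangle (π t) w v
      linarith
    simp only [A]
    linarith
  · have : Nonempty T := ⟨s⟩
    have h : (⨅ r, ρ s r + dist (π r) w) - ρ s t ≤ ⨅ r, ρ t r + dist (π r) w := by
      refine le_ciInf fun r => ?_
      have h₁ := hle s w r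
      have h₂ := hρ.triangle s t r
      linarith
    simp only [A]
    linarith
  · refine min_eq_left (le_ciInf fun w => ?_)
    have h₁ := hge s w
    have h₂ := hge t w
    have h₃ := dist_triangle_right (π s) (π t) w
    simp only [A]
    linarith
  · have h := hle s (π s) s
    rw [hρ.self, dist_self] at h
    simp only [glue, A]
    linarith

end Gluing

section Tree

variable {W : Type*} {E : Set (ℕ → W)} {d : ℕ → ℕ → ℝ}

open Classical in
/-- The amalgam of copies of the pseudometric `d` on `ℕ`, one for each sequence `e ∈ E`, the
copies of `e` and `f` being glued along the common initial segment of `e` and `f`. -/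
noncomputable def treeDist (E : Set (ℕ → W)) (d : ℕ → ℕ → ℝ) (s t : ℕ × E) : ℝ :=
  ⨅ a : ℕ, if ∀ i ≤ a, s.2.1 i = t.2.1 i then d s.1 a + d a t.1 else 2

theorem treeDist_le (hd : IsPseudoDist d) (s t : ℕ × E) (a : ℕ) (h : ∀ i ≤ a, s.2.1 i = t.2.1 i) :
    treeDist E d s t ≤ d s.1 a + d a t.1 := by
  classical
  refine (ciInf_le ⟨0, ?_⟩ a).trans (if_pos h).le
  rintro _ ⟨b, rfl⟩
  dsimp only
  split_ifs
  · exact add_nonneg (hd.nonneg _ _) (hd.nonneg _ _)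
  · norm_num

theorem le_treeDist {s t : ℕ × E} {c : ℝ} (hc : c ≤ 2)
    (h : ∀ a, (∀ i ≤ a, s.2.1 i = t.2.1 i) → c ≤ d s.1 a + d a t.1) : c ≤ treeDist E d s t := by
  refine le_ciInf fun a => ?_
  split_ifs with h'
  exacts [h a h', hc]

theorem treeDist_le_two (hd : IsPseudoDist d) (hd₁ : ∀ i j, d i j ≤ 1) (s t : ℕ × E) :
    treeDist E d s t ≤ 2 := by
  classical
  refine (ciInf_le ⟨0, ?_⟩ 0).trans ?_
  · rintro _ ⟨b, rfl⟩
    dsimp only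
    split_ifs
    · exact add_nonneg (hd.nonneg _ _) (hd.nonneg _ _)
    · norm_num
  · split_ifs
    · linarith [hd₁ s.1 0, hd₁ 0 t.1]
    · norm_num

theorem treeDist_same (hd : IsPseudoDist d) (hd₁ : ∀ i j, d i j ≤ 1) (e : E) (n k : ℕ) :
    treeDist E d (n, e) (k, e) = d n k := by
  refine le_antisymm ?_ (le_treeDist (by linarith [hd₁ n k]) fun a _ => hd.triangle _ _ _)
  have := treeDist_le hd (n, e) (k, e) n fun _ _ => rfl
  rwa [hd.self, zero_add] at this

theorem isPseudoDist_treeDist (hd : IsPseudoDist d) (hd₁ : ∀ i j, d i j ≤ 1) :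
    IsPseudoDist (treeDist E d) := by
  have hnn : ∀ s t, 0 ≤ treeDist E d s t := fun s t =>
    le_treeDist (by norm_num) fun a _ => add_nonneg (hd.nonneg _ _) (hd.nonneg _ _)
  refine ⟨fun s => ?_, fun s t => ?_, fun s t r => ?_⟩
  · rw [← hd.self s.1]
    exact treeDist_same hd hd₁ s.2 s.1 s.1
  · classical
    simp only [treeDist]
    refine iInf_congr fun a => ?_
    rw [hd.comm s.1 a, hd.comm a t.1, add_comm (d a s.1)]
    exact if_congr (forall₂_congr fun _ _ => eq_comm) rfl rfl
  · rw [← sub_le_iff_le_add]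
    have h₂ := treeDist_le_two hd hd₁ s r
    refine le_treeDist (by linarith [hnn t r]) fun a ha => ?_
    rw [sub_le_comm]
    refine le_treeDist (by linarith [hd.nonneg s.1 a, hd.nonneg a t.1]) fun b hb => ?_
    rw [sub_le_iff_le_add]
    rcases le_total a b with h | h
    · have h₃ := treeDist_le hd s r a fun i hi => (ha i hi).trans (hb i (hi.trans h))
      have h₄ := hd.triangle a t.1 r.1
      have h₅ := hd.triangle t.1 b r.1
      linarith
    · have h₃ := treeDist_le hd s r b fun i hi => (ha i (hi.trans h)).trans (hb i hi)
      have h₄ := hd.triangle s.1 a b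
      have h₅ := hd.triangle a t.1 b
      linarith

end Tree

/-- If the spaces `S_m` are `1/m`-indivisible, then the Urysohn sphere is oscillation stable. -/
theorem IsUrysohnSphere.approxIndivisible {S : Type} [MetricSpace S] (hS : IsUrysohnSphere S)
    {M : ℕ → Type} [∀ m, MetricSpace (M m)] (hM : ∀ m, 0 < m → IsUrysohnSphereM m (M m))
    (h : ∀ m : ℕ, 0 < m → EpsIndivisible (M m) (1 / (m : ℝ))) : ApproxIndivisible S := by
  intro ε hε k hk χ
  have := hS.1
  have := hS.2.1
  have := hS.nonempty
  obtain ⟨n, hn⟩ := exists_nat_one_div_lt (show 0 < ε / 4 by positivity)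
  set m := n + 1 with hmdef
  have hm : 0 < m := n.succ_pos
  set δ : ℝ := 1 / m with hδdef
  have hδ : 0 < δ := by positivity
  have hδε : δ < ε / 4 := by simpa [hδdef, hmdef] using hn
  have hW := hM m hm
  have := hW.1
  let x := TopologicalSpace.denseSeq S
  let d : ℕ → ℕ → ℝ := fun i j => dist (x i) (x j)
  have hd : IsPseudoDist d := (isPseudoDist_dist S).comp x
  have hd₁ : ∀ i j, d i j ≤ 1 := fun _ _ => hS.2.2.2.1 _ _
  obtain ⟨z, hz⟩ := hW.countablyUniversal ℕ _ (hd.roundUp m hδ) (fun _ _ => roundUp_mem _ _ _)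
  have : Nonempty (M m) := ⟨z 0⟩
  let E : Set (ℕ → M m) := {e | ∀ i j, dist (e i) (e j) = roundUp m δ (d i j)}
  let π : ℕ × E → M m := fun s => s.2.1 s.1
  obtain ⟨D, hD, hDW, hDT, hDle, hDπ⟩ := exists_attach
    (isPseudoDist_treeDist (E := E) hd hd₁) hδ.le π (fun s t => by
      rw [← sub_le_iff_le_add]
      refine le_treeDist (by linarith [hW.dist_le_one (π s) (π t)]) fun a ha => ?_
      have h₁ := dist_triangle (s.2.1 s.1) (s.2.1 a) (t.2.1 t.1)
      rw [s.2.2, ha a le_rfl, t.2.2] at h₁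
      have h₂ := roundUp_le hm (hd.nonneg s.1 a)
      have h₃ := roundUp_le hm (hd.nonneg a t.1)
      simp only [π, hδdef] at *
      linarith)
  obtain ⟨H, hH⟩ := hS.countablyUniversal.exists_of_factors hD.min_one
    (fun _ _ => Set.mem_Iic.2 (min_le_left _ _))
    (Q := M m ⊕ Σ n : ℕ, (Fin (n + 1) → M m))
    (Sum.map id fun s => ⟨s.1, fun i => s.2.1 i⟩) (by
      rintro (v | ⟨a, e⟩) (w | ⟨b, f⟩) hc
      · obtain rfl : v = w := by simpa using hc
        simp [hD.self]
      · simp at hc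
      · simp at hc
      · simp only [Sum.map_inr, Sum.inr.injEq, Sigma.mk.injEq] at hc
        obtain ⟨rfl, hc⟩ := hc
        have hef : ∀ i ≤ a, e.1 i = f.1 i := fun i hi =>
          congrFun (eq_of_heq hc) ⟨i, Nat.lt_succ_of_le hi⟩
        have h₁ := treeDist_le hd (a, e) (a, f) a hef
        have h₂ := hDle (a, e) (a, f)
        simp only [hd.self, add_zero] at h₁
        have h₃ := hD.nonneg (.inr (a, e)) (.inr (a, f))
        rw [min_eq_right (by linarith)]
        linarith)
  obtain ⟨i, e, he, hei⟩ := h m hm k hk fun w => χ (H (.inl w))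
  have heE : (e ∘ z) ∈ E := fun i j => by
    simp only [Function.comp_apply, he.dist_eq, hz]
  let y : ℕ → S := fun n => H (.inr (n, ⟨e ∘ z, heE⟩))
  have hy : ∀ a b, dist (y a) (y b) = dist (x a) (x b) := fun a b => by
    have h₁ := treeDist_same hd hd₁ (⟨e ∘ z, heE⟩ : E) a b
    rw [hH, hDT, h₁, min_eq_right (hd₁ a b)]
    rw [h₁]
    simp only [π]
    rw [heE]
    exact le_roundUp hm (hd₁ a b)
  obtain ⟨g, hg, hgx⟩ := exists_isometry_extend (TopologicalSpace.denseRange_denseSeq S) hy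
  refine ⟨i, g, hg, fun p => ?_⟩
  obtain ⟨a, ha⟩ := (TopologicalSpace.denseRange_denseSeq S).exists_dist_lt p hδ
  obtain ⟨w, hw, hwd⟩ := hei (z a)
  refine ⟨H (.inl w), hw, ?_⟩
  have h₁ : dist (g p) (y a) < δ := by rwa [← hgx, hg.dist_eq]
  have h₂ : dist (y a) (H (.inl (e (z a)))) ≤ 2 * δ := by
    rw [hH]
    exact (min_le_right _ _).trans (hDπ (a, ⟨e ∘ z, heE⟩))
  have h₃ : dist (H (.inl (e (z a)))) (H (.inl w)) ≤ δ := by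
    rw [hH, hDW]
    exact (min_le_right _ _).trans hwd
  have h₄ := dist_triangle4 (g p) (y a) (H (.inl (e (z a)))) (H (.inl w))
  linarith

/-- The equivalence between oscillation stability of `S`, approximate
indivisibility of `S_ℚ`, `1/m`-indivisibility of the `S_m`'s and exact
indivisibility of the `S_m`'s. -/
theorem stmt2 (S : Type) [MetricSpace S] (hS : IsUrysohnSphere S)
    (SQ : Type) [MetricSpace SQ] (hSQ : IsRationalUrysohnSphere SQ)
    (Sm : ℕ → Type) [∀ m, MetricSpace (Sm m)]
    (hSm : ∀ m : ℕ, 0 < m → IsUrysohnSphereM m (Sm m)) :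
    [ApproxIndivisible S,
     ApproxIndivisible SQ,
     ∀ m : ℕ, 0 < m → EpsIndivisible (Sm m) (1/(m:ℝ)),
     ∀ m : ℕ, 0 < m → EpsIndivisible (Sm m) 0].TFAE := by
  tfae_have 1 → 2 := fun h => h.rational hS hSQ
  tfae_have 2 → 4 := fun h m hm => h.epsIndivisible_zero hSQ hm (hSm m hm)
  tfae_have 4 → 3 := fun h m hm k hk χ => by
    obtain ⟨i, e, he, hei⟩ := h m hm k hk χ
    refine ⟨i, e, he, fun z => ?_⟩
    obtain ⟨x, hx, hxd⟩ := hei z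
    exact ⟨x, hx, hxd.trans (by positivity)⟩
  tfae_have 3 → 1 := hS.approxIndivisible hSm
  tfae_finish
end

section
/- Let m be a positive integer. If some (equivalently, every) countable ultrahomogeneous metric space S_m with all distances in [0,1]_m into which every countable metric space with distances in [0,1]_m embeds isometrically is indivisible, then every Urysohn sphere S is (1/m)-indivisible. -/
open Metric

section Amalgam

variable {T X : Type} [MetricSpace X]

/-- The `[0,1]`-valued functions on `T ⊕ X` that are `1`-Lipschitz for `c` on `T`, `1`-Lipschitz
on `X`, and vary by at most `η` between `t` and `y t`. -/
structure IsAdmissible (c : T → T → ℝ) (y : T → X) (η : ℝ) (f : T ⊕ X → ℝ) : Prop where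
  nonneg : ∀ v, 0 ≤ f v
  le_one : ∀ v, f v ≤ 1
  left : ∀ s t, f (Sum.inl s) ≤ f (Sum.inl t) + c s t
  right : ∀ x x', f (Sum.inr x) ≤ f (Sum.inr x') + dist x x'
  cross_le : ∀ t, f (Sum.inl t) ≤ f (Sum.inr (y t)) + η
  le_cross : ∀ t, f (Sum.inr (y t)) ≤ f (Sum.inl t) + η

/-- A pair of Lipschitz functions `h` on `T` and `A` on `X` with `A ∘ y ≤ h + η` becomes admissible
once `h` is lowered appropriately. -/
theorem IsAdmissible.of_lipschitz {c : T → T → ℝ} {y : T → X} {η : ℝ} (hη : 0 ≤ η)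
    (hc0 : ∀ s t, 0 ≤ c s t) (hself : ∀ t, c t t = 0)
    (htri : ∀ s t u, c s u ≤ c s t + c t u)
    (hy : ∀ s t, dist (y s) (y t) ≤ c s t + 2 * η)
    {h : T → ℝ} {A : X → ℝ} (h0 : ∀ t, 0 ≤ h t) (h1 : ∀ t, h t ≤ 1)
    (A0 : ∀ x, 0 ≤ A x) (A1 : ∀ x, A x ≤ 1)
    (hlip : ∀ s t, h s ≤ h t + c s t) (Alip : ∀ x x', A x ≤ A x' + dist x x')
    (hA : ∀ t, A (y t) ≤ h t + η) :
    IsAdmissible c y η (Sum.elim (fun t => min (h t) (⨅ s, (c t s + η + A (y s)))) A) := by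
  have bdd : ∀ t, BddBelow (Set.range fun s => c t s + η + A (y s)) := fun t =>
    ⟨0, by rintro _ ⟨s, rfl⟩; have := hc0 t s; have := A0 (y s); positivity⟩
  refine ⟨?_, ?_, ?_, ?_, ?_, ?_⟩
  · rintro (t | x)
    · have : Nonempty T := ⟨t⟩
      refine le_min (h0 t) (le_ciInf fun s => ?_)
      have := hc0 t s
      have := A0 (y s)
      positivity
    · exact A0 x
  · rintro (t | x)
    · exact (min_le_left _ _).trans (h1 t)
    · exact A1 x
  · intro s t
    have : Nonempty T := ⟨t⟩
    simp only [Sum.elim_inl]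
    rw [← sub_le_iff_le_add]
    refine le_min ?_ (le_ciInf fun u => ?_)
    · linarith [min_le_left (h s) (⨅ u, (c s u + η + A (y u))), hlip s t]
    · linarith [min_le_right (h s) (⨅ u, (c s u + η + A (y u))), ciInf_le (bdd s) u, htri s t u]
  · exact Alip
  · intro t
    simp only [Sum.elim_inl, Sum.elim_inr]
    linarith [min_le_right (h t) (⨅ u, (c t u + η + A (y u))), ciInf_le (bdd t) t, hself t]
  · intro t
    have : Nonempty T := ⟨t⟩
    simp only [Sum.elim_inl, Sum.elim_inr]
    rw [← sub_le_iff_le_add]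
    refine le_min ?_ (le_ciInf fun u => ?_)
    · linarith [hA t]
    · linarith [Alip (y t) (y u), hy t u]

/-- A pseudometric `c` on `T` and a metric space `X` related by a map `y : T → X` expanding
distances by at most `2 * η` can be amalgamated so that `t` and `y t` are `η`-close. Distances in
`X` are preserved, and so are those distances in `T` which are not shortened by passing
through `X`. -/
theorem exists_amalgam (hX : ∀ x x' : X, dist x x' ≤ 1) {c : T → T → ℝ} {y : T → X} {η : ℝ}
    (hη : 0 ≤ η) (hc0 : ∀ s t, 0 ≤ c s t) (hc1 : ∀ s t, c s t ≤ 1) (hself : ∀ t, c t t = 0)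
    (hcomm : ∀ s t, c s t = c t s) (htri : ∀ s t u, c s u ≤ c s t + c t u)
    (hy : ∀ s t, dist (y s) (y t) ≤ c s t + 2 * η) :
    ∃ (E : Type) (_ : MetricSpace E) (i : T → E) (j : X → E),
      Set.range i ∪ Set.range j = Set.univ ∧ (∀ a b : E, dist a b ≤ 1) ∧ Isometry j ∧
      (∀ s t, dist (i s) (i t) ≤ c s t) ∧ (∀ t, dist (i t) (j (y t)) ≤ η) ∧
      ∀ s t, (∀ s' t', c s t ≤ c s s' + η + dist (y s') (y t') + η + c t' t) →
        c s t ≤ dist (i s) (i t) := by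
  let Φ := {f : T ⊕ X → ℝ // IsAdmissible c y η f}
  let _ : TopologicalSpace Φ := ⊥
  have : DiscreteTopology Φ := ⟨rfl⟩
  let Ψ : T ⊕ X → BoundedContinuousFunction Φ ℝ := fun v =>
    BoundedContinuousFunction.mkOfDiscrete (fun f => f.1 v) 1 fun f g => by
      rw [Real.dist_eq, abs_le]
      constructor <;> linarith [f.2.nonneg v, g.2.nonneg v, f.2.le_one v, g.2.le_one v]
  have Ψ_apply : ∀ v f, Ψ v f = f.1 v := fun _ _ => rfl
  have le_dist : ∀ (f : Φ) u v, f.1 u - f.1 v ≤ dist (Ψ u) (Ψ v) := fun f u v =>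
    (le_abs_self _).trans (by
      simpa only [Real.dist_eq, Ψ_apply] using
        BoundedContinuousFunction.dist_coe_le_dist (f := Ψ u) (g := Ψ v) f)
  have dist_le : ∀ u v r, 0 ≤ r → (∀ f : Φ, f.1 u ≤ f.1 v + r) → (∀ f : Φ, f.1 v ≤ f.1 u + r) →
      dist (Ψ u) (Ψ v) ≤ r := fun u v r hr h₁ h₂ => by
    refine (BoundedContinuousFunction.dist_le hr).2 fun f => ?_
    rw [Real.dist_eq, Ψ_apply, Ψ_apply, abs_le]
    constructor <;> linarith [h₁ f, h₂ f]
  refine ⟨Set.range Ψ, inferInstance, fun t => ⟨Ψ (Sum.inl t), _, rfl⟩,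
    fun x => ⟨Ψ (Sum.inr x), _, rfl⟩, ?_, ?_, ?_, ?_, ?_, ?_⟩
  · ext ⟨_, v, rfl⟩
    rcases v with t | x <;> simp
  · rintro ⟨_, u, rfl⟩ ⟨_, v, rfl⟩
    exact dist_le u v 1 zero_le_one
      (fun f => by linarith [f.2.le_one u, f.2.nonneg v])
      (fun f => by linarith [f.2.le_one v, f.2.nonneg u])
  · refine Isometry.of_dist_eq fun x x' => le_antisymm ?_ ?_
    · exact dist_le _ _ _ dist_nonneg (fun f => f.2.right x x')
        (fun f => dist_comm x x' ▸ f.2.right x' x)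
    · have := le_dist ⟨_, IsAdmissible.of_lipschitz (h := fun _ => 1) (A := fun u => dist u x')
        hη hc0 hself htri hy (fun _ => zero_le_one) (fun _ => le_rfl) (fun _ => dist_nonneg)
        (fun u => hX u x') (fun s t => by linarith [hc0 s t])
        (fun u v => by linarith [dist_triangle u v x'])
        (fun t => by linarith [hX (y t) x'])⟩ (Sum.inr x) (Sum.inr x')
      simp only [Sum.elim_inr, dist_self, sub_zero] at this
      exact this
  · intro s t
    exact dist_le _ _ _ (hc0 s t) (fun f => f.2.left s t) (fun f => hcomm s t ▸ f.2.left t s)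
  · intro t
    exact dist_le _ _ _ hη (fun f => f.2.cross_le t) (fun f => f.2.le_cross t)
  · intro s t hst
    have : Nonempty T := ⟨t⟩
    have hpos : ∀ x u, 0 ≤ dist x (y u) + η + c u t := fun x u => by
      have := hc0 u t
      positivity
    have bdd : ∀ x, BddBelow (Set.range fun u => dist x (y u) + η + c u t) := fun x =>
      ⟨0, by rintro _ ⟨u, rfl⟩; exact hpos x u⟩
    let A : X → ℝ := fun x => min 1 (⨅ u, (dist x (y u) + η + c u t))
    have A0 : ∀ x, 0 ≤ A x := fun x => le_min zero_le_one (le_ciInf (hpos x))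
    have A_le : ∀ x u, A x ≤ dist x (y u) + η + c u t := fun x u =>
      (min_le_right _ _).trans (ciInf_le (bdd x) u)
    have A1 : ∀ x, A x ≤ 1 := fun x => min_le_left _ _
    have Alip : ∀ x x', A x ≤ A x' + dist x x' := fun x x' => by
      rw [← sub_le_iff_le_add]
      refine le_min (by linarith [A1 x, @dist_nonneg _ _ x x']) (le_ciInf fun u => ?_)
      linarith [A_le x u, dist_triangle x x' (y u)]
    have key := le_dist ⟨_, IsAdmissible.of_lipschitz (h := fun u => c u t) (A := A)
      hη hc0 hself htri hy (fun u => hc0 u t) (fun u => hc1 u t) A0 A1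
      (fun u v => by linarith [htri u v t]) Alip
      (fun u => by have := A_le (y u) u; rw [dist_self] at this; linarith)⟩
      (Sum.inl s) (Sum.inl t)
    simp only [Sum.elim_inl] at key
    have hs : c s t ≤ min (c s t) (⨅ u, (c s u + η + A (y u))) := by
      refine le_min le_rfl (le_ciInf fun u => ?_)
      rw [← sub_le_iff_le_add']
      refine le_min (by linarith [hc1 s t, hc0 s u]) (le_ciInf fun v => ?_)
      linarith [hst u v]
    have ht := min_le_left (c t t) (⨅ u, (c t u + η + A (y u)))
    rw [hself] at ht
    rw [hself] at key
    exact (by linarith : c s t ≤ dist (Ψ (Sum.inl s)) (Ψ (Sum.inl t)))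

end Amalgam

section BranchDist

variable {S X : Type} [MetricSpace S]

open Classical in
/-- Copies of `S` indexed by sequences `b : ℕ → X` are glued together: the copies of `w` indexed by
`b` and `b'` are identified when `b` and `b'` agree up to the index `n w`. -/
noncomputable def branchDist (n : S → ℕ) (s t : S × (ℕ → X)) : ℝ :=
  ⨅ w : S, if ∀ i ≤ n w, s.2 i = t.2 i then min 1 (dist s.1 w + dist w t.1) else 1

variable {n : S → ℕ}

theorem le_branchDist {s t : S × (ℕ → X)} {a : ℝ} (ha : a ≤ 1)
    (h : ∀ w, (∀ i ≤ n w, s.2 i = t.2 i) → a ≤ dist s.1 w + dist w t.1) :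
    a ≤ branchDist n s t := by
  have : Nonempty S := ⟨s.1⟩
  refine le_ciInf fun w => ?_
  split_ifs with hw
  · exact le_min ha (h w hw)
  · exact ha

theorem branchDist_nonneg (s t : S × (ℕ → X)) : 0 ≤ branchDist n s t :=
  le_branchDist zero_le_one fun _ _ => by positivity

theorem branchDist_bddBelow (s t : S × (ℕ → X)) : BddBelow (Set.range fun w : S =>
    open Classical in
    if ∀ i ≤ n w, s.2 i = t.2 i then min 1 (dist s.1 w + dist w t.1) else 1) := by
  refine ⟨0, ?_⟩
  rintro _ ⟨w, rfl⟩
  dsimp only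
  split_ifs <;> positivity

theorem branchDist_le_one (s t : S × (ℕ → X)) : branchDist n s t ≤ 1 := by
  refine (ciInf_le (branchDist_bddBelow s t) s.1).trans ?_
  split_ifs
  · exact min_le_left _ _
  · exact le_rfl

theorem branchDist_le {s t : S × (ℕ → X)} {w : S} (h : ∀ i ≤ n w, s.2 i = t.2 i) :
    branchDist n s t ≤ dist s.1 w + dist w t.1 := by
  refine (ciInf_le (branchDist_bddBelow s t) w).trans ?_
  rw [if_pos h]
  exact min_le_right _ _

theorem branchDist_comm (s t : S × (ℕ → X)) : branchDist n s t = branchDist n t s := by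
  refine le_antisymm ?_ ?_ <;>
  · refine le_branchDist (branchDist_le_one _ _) fun w hw => ?_
    refine (branchDist_le (w := w) fun i hi => (hw i hi).symm).trans_eq ?_
    simp only [dist_comm, add_comm]

theorem branchDist_triangle (s t u : S × (ℕ → X)) :
    branchDist n s u ≤ branchDist n s t + branchDist n t u := by
  rw [← sub_le_iff_le_add]
  have hsu := branchDist_le_one (n := n) s u
  have htu := branchDist_nonneg (n := n) t u
  refine le_branchDist (by linarith) fun w hw => ?_
  rw [sub_le_iff_le_add, ← sub_le_iff_le_add']
  have hsw : 0 ≤ dist s.1 w := dist_nonneg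
  have hwt : 0 ≤ dist w t.1 := dist_nonneg
  refine le_branchDist (by linarith) fun w' hw' => ?_
  rcases le_total (n w) (n w') with h | h
  · linarith [branchDist_le (s := s) (t := u) (w := w)
      (fun i hi => (hw i hi).trans (hw' i (hi.trans h))),
      dist_triangle4 w t.1 w' u.1]
  · linarith [branchDist_le (s := s) (t := u) (w := w')
      (fun i hi => (hw i (hi.trans h)).trans (hw' i hi)),
      dist_triangle4 s.1 w t.1 w']

theorem branchDist_same (hS : ∀ z z' : S, dist z z' ≤ 1) (z z' : S) (b : ℕ → X) :
    branchDist n (z, b) (z', b) = dist z z' := by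
  refine le_antisymm ?_ (le_branchDist (hS z z') fun w _ => dist_triangle z w z')
  simpa using branchDist_le (n := n) (s := (z, b)) (t := (z', b)) (w := z) fun _ _ => rfl

end BranchDist

section Discretization

/-- A separable space of diameter at most `1` admits a countable partition and a pseudometric on
the set of pieces, with values in `[0,1]_m`, which is `1/m`-close to the given metric. -/
theorem exists_discretization {S : Type} [MetricSpace S] [TopologicalSpace.SeparableSpace S]
    [Nonempty S] (hS : ∀ z z' : S, dist z z' ≤ 1) {m : ℕ} (hm : 0 < m) :
    ∃ (n : S → ℕ) (F : PseudoMetricSpace ℕ), (∀ i j, F.dist i j ∈ distSetM m) ∧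
      ∀ z w, F.dist (n z) (n w) ≤ dist z w + 1 / m ∧ dist z w ≤ F.dist (n z) (n w) + 1 / m := by
  have hm1 : (1 : ℝ) ≤ m := by exact_mod_cast hm
  have hm0 : (0 : ℝ) < m := by linarith
  let p := TopologicalSpace.denseSeq S
  have hδ : (0 : ℝ) < 1 / (4 * m ^ 2) := by positivity
  have hp : ∀ z : S, ∃ i, dist z (p i) < 1 / (4 * m ^ 2) := fun z =>
    (TopologicalSpace.denseRange_denseSeq S).exists_dist_lt z hδ
  choose n hn using hp
  let G : ℕ → ℕ → ℝ := fun i j => ⌈((m : ℝ) - 1 / 2) * dist (p i) (p j)⌉₊ / m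
  have hmul : ∀ i j, (G i j) * m = ⌈((m : ℝ) - 1 / 2) * dist (p i) (p j)⌉₊ := fun i j =>
    div_mul_cancel₀ _ hm0.ne'
  have hm2 : (0 : ℝ) ≤ (m : ℝ) - 1 / 2 := by linarith
  let F : PseudoMetricSpace ℕ :=
    { dist := G
      dist_self := fun i => by simp [G]
      dist_comm := fun i j => by simp only [G, dist_comm]
      dist_triangle := fun i j k => by
        rw [← mul_le_mul_iff_left₀ hm0, add_mul, hmul, hmul, hmul]
        have : ⌈((m : ℝ) - 1 / 2) * dist (p i) (p k)⌉₊ ≤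
            ⌈((m : ℝ) - 1 / 2) * dist (p i) (p j)⌉₊ + ⌈((m : ℝ) - 1 / 2) * dist (p j) (p k)⌉₊ := by
          refine (Nat.ceil_mono ?_).trans (Nat.ceil_add_le _ _)
          rw [← mul_add]
          exact mul_le_mul_of_nonneg_left (dist_triangle _ _ _) hm2
        exact_mod_cast this }
  refine ⟨n, F, fun i j => ⟨_, ?_, rfl⟩, fun z w => ?_⟩
  · refine Nat.ceil_le.2 ?_
    nlinarith [hS (p i) (p j), @dist_nonneg _ _ (p i) (p j)]
  · change G _ _ ≤ _ ∧ _ ≤ G _ _ + _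
    have hz := hn z
    have hw := hn w
    set δ : ℝ := 1 / (4 * m ^ 2) with hδ_def
    have hδm : δ * m * m = 1 / 4 := by
      rw [hδ_def]
      field_simp
    have hδm' : δ * m ≤ 1 / 4 := by nlinarith [mul_pos hδ hm0]
    have h₁ : dist (p (n z)) (p (n w)) ≤ dist z w + 2 * δ := by
      linarith [dist_triangle4 (p (n z)) z w (p (n w)), dist_comm (p (n z)) z]
    have h₂ : dist z w ≤ dist (p (n z)) (p (n w)) + 2 * δ := by
      linarith [dist_triangle4 z (p (n z)) (p (n w)) w, dist_comm (p (n w)) w]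
    have hd : dist (p (n z)) (p (n w)) ≤ 1 := hS _ _
    have hd0 : 0 ≤ dist z w := dist_nonneg
    have hd0' : 0 ≤ dist (p (n z)) (p (n w)) := dist_nonneg
    have hone : (1 / m : ℝ) * m = 1 := div_mul_cancel₀ _ hm0.ne'
    constructor
    · rw [← mul_le_mul_iff_left₀ hm0, hmul, add_mul, hone]
      rcases le_or_gt (((m : ℝ) - 1 / 2) * dist (p (n z)) (p (n w))) (m * dist z w) with h | h
      · linarith [Nat.ceil_lt_add_one (mul_nonneg hm2 hd0')]
      · have hle : ((m : ℝ) - 1 / 2) * dist (p (n z)) (p (n w)) ≤ (1 : ℕ) := by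
          have h₃ := mul_le_mul_of_nonneg_left h₁ hm2
          have h₄ : dist z w ≤ 4 * δ * m - 2 * δ := by nlinarith
          have h₅ := mul_le_mul_of_nonneg_left h₄ hm2
          push_cast
          nlinarith [mul_pos hδ hm0]
        have : ((⌈((m : ℝ) - 1 / 2) * dist (p (n z)) (p (n w))⌉₊ : ℕ) : ℝ) ≤ 1 := by
          exact_mod_cast Nat.ceil_le.2 hle
        nlinarith
    · rw [← mul_le_mul_iff_left₀ hm0, add_mul, hmul, hone]
      have := Nat.le_ceil (((m : ℝ) - 1 / 2) * dist (p (n z)) (p (n w)))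
      nlinarith

end Discretization

theorem IsUrysohnSphereM.exists_dist_eq {m : ℕ} {X : Type} [MetricSpace X]
    (hX : IsUrysohnSphereM m X) {Y : Type} [Countable Y] (F : PseudoMetricSpace Y)
    (hF : ∀ i j, F.dist i j ∈ distSetM m) : ∃ g : Y → X, ∀ i j, dist (g i) (g j) = F.dist i j := by
  have : Countable (SeparationQuotient Y) := Quotient.countable
  obtain ⟨g, hg⟩ := hX.2.2.2 (SeparationQuotient Y) inferInstance (by
    intro a b
    obtain ⟨a, rfl⟩ := SeparationQuotient.surjective_mk a
    obtain ⟨b, rfl⟩ := SeparationQuotient.surjective_mk b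
    rw [SeparationQuotient.dist_mk]
    exact hF _ _)
  exact ⟨fun i => g (SeparationQuotient.mk i), fun i j => by
    rw [hg.dist_eq, SeparationQuotient.dist_mk]⟩

/-- If each sequence in a family is realized by a copy of `S`, and the copies of `z` given by two
sequences which agree up to `n z` are at distance `0`, then countably many copies are dense. -/
theorem isSeparable_range_of_eq_of_agree {S X E : Type} [MetricSpace S] [MetricSpace E]
    [TopologicalSpace.SeparableSpace S] [Countable X] {n : S → ℕ} {B : Set (ℕ → X)}
    {i : S × B → E} (hi : ∀ b, Continuous fun z => i (z, b))
    (h : ∀ z (b b' : B), (∀ k ≤ n z, b.1 k = b'.1 k) → i (z, b) = i (z, b')) :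
    TopologicalSpace.IsSeparable (Set.range i) := by
  let res : (N : ℕ) → B → Fin (N + 1) → X := fun N b k => b.1 k
  have hU : TopologicalSpace.IsSeparable
      (⋃ σ : Σ N, Set.range (res N), Set.range fun z => i (z, σ.2.2.choose)) :=
    .iUnion fun σ => TopologicalSpace.isSeparable_range (hi _)
  refine hU.mono ?_
  rintro _ ⟨⟨z, b⟩, rfl⟩
  refine Set.mem_iUnion.2 ⟨⟨n z, res (n z) b, b, rfl⟩, z, ?_⟩
  refine h z _ _ fun k hk => ?_
  generalize_proofs hb
  exact congrFun hb.choose_spec ⟨k, Nat.lt_succ_of_le hk⟩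

/-- Some copy of `S_m` in a Urysohn sphere is such that every copy of `S_m` inside it has a copy
of the sphere within distance `1/m`. -/
theorem exists_isometry_forall_near {m : ℕ} (hm : 0 < m) {X : Type} [MetricSpace X]
    (hX : IsUrysohnSphereM m X) {S : Type} [MetricSpace S] (hS : IsUrysohnSphere S) :
    ∃ j : X → S, ∀ e : X → X, Isometry e →
      ∃ f : S → S, Isometry f ∧ ∀ z, ∃ x, dist (f z) (j (e x)) ≤ 1 / m := by
  obtain ⟨-, hsep, -, hS1, hSuniv⟩ := hS
  have := hX.1
  have : Nonempty S := by
    obtain ⟨f, -⟩ := hSuniv Unit inferInstance (fun a b => by simp)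
    exact ⟨f ()⟩
  have hX1 : ∀ x x' : X, dist x x' ≤ 1 := fun x x' => by
    obtain ⟨k, hk, hd⟩ := hX.2.2.1 x x'
    rw [hd, div_le_one (by exact_mod_cast hm)]
    exact_mod_cast hk
  obtain ⟨n, F, hFm, hF⟩ := exists_discretization hS1 hm
  obtain ⟨g, hg⟩ := hX.exists_dist_eq F hFm
  let B : Set (ℕ → X) := {b | ∀ k l, dist (b k) (b l) = F.dist k l}
  let q : S × B → S × (ℕ → X) := fun t => (t.1, t.2.1)
  let y : S × B → X := fun t => t.2.1 (n t.1)
  have hη : (0 : ℝ) ≤ 1 / m := by positivity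
  have hy : ∀ s t, dist (y s) (y t) ≤ branchDist n (q s) (q t) + 2 * (1 / m) := by
    intro s t
    rw [← sub_le_iff_le_add]
    refine le_branchDist (by linarith [hX1 (y s) (y t)]) fun w hw => ?_
    have h₁ := dist_triangle (y s) (s.2.1 (n w)) (y t)
    have h₂ : s.2.1 (n w) = t.2.1 (n w) := hw _ le_rfl
    rw [s.2.2, h₂, t.2.2] at h₁
    linarith [(hF s.1 w).1, (hF w t.1).1]
  obtain ⟨E, _, i, j, hij, hE, hj, hi, hnear, hlow⟩ :=
    exists_amalgam (c := fun s t => branchDist n (q s) (q t)) hX1 hη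
      (fun s t => branchDist_nonneg _ _) (fun s t => branchDist_le_one _ _)
      (fun t => (branchDist_same hS1 _ _ _).trans (dist_self _))
      (fun s t => branchDist_comm _ _) (fun s t u => branchDist_triangle _ _ _) hy
  have hisom : ∀ b, Isometry fun z => i (z, b) := fun b => by
    refine Isometry.of_dist_eq fun z z₀ => ?_
    have hsame : branchDist n (q (z, b)) (q (z₀, b)) = dist z z₀ := branchDist_same hS1 _ _ _
    refine le_antisymm ((hi _ _).trans_eq hsame) ?_
    rw [← hsame]
    refine hlow _ _ fun s t => ?_
    rw [hsame]
    -- the shortcut leaves the branch, crosses `X` and returns to the branch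
    suffices h : dist z z₀ - (1 / m + dist (y s) (y t) + 1 / m + branchDist n (q t) (q (z₀, b))) ≤
        branchDist n (q (z, b)) (q s) by linarith
    have hpos := @dist_nonneg _ _ (y s) (y t)
    refine le_branchDist (by linarith [hS1 z z₀, branchDist_nonneg (n := n) (q t) (q (z₀, b))])
      fun w hw => ?_
    suffices h : dist z z₀ - (1 / m + dist (y s) (y t) + 1 / m + (dist z w + dist w s.1)) ≤
        branchDist n (q t) (q (z₀, b)) by
      change _ ≤ dist z w + dist w s.1
      linarith
    refine le_branchDist (by linarith [hS1 z z₀, @dist_nonneg _ _ z w, @dist_nonneg _ _ w s.1])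
      fun w' hw' => ?_
    change _ ≤ dist t.1 w' + dist w' z₀
    rcases le_total (n w) (n w') with h | h
    · have h₁ : s.2.1 (n w) = t.2.1 (n w) := (hw _ le_rfl).symm.trans (hw' _ h).symm
      have h₂ := dist_triangle (t.2.1 (n w)) (y s) (y t)
      rw [t.2.2, ← h₁, s.2.2] at h₂
      linarith [(hF w t.1).2, (hF w s.1).1, dist_triangle4 z w t.1 z₀, dist_triangle t.1 w' z₀]
    · have h₁ : t.2.1 (n w') = s.2.1 (n w') := (hw' _ le_rfl).trans (hw _ h)
      have h₂ := dist_triangle (y s) (y t) (s.2.1 (n w'))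
      rw [s.2.2, ← h₁, t.2.2] at h₂
      linarith [(hF s.1 w').2, (hF t.1 w').1, dist_triangle4 z s.1 w' z₀, dist_triangle z w s.1]
  have hsepE : TopologicalSpace.SeparableSpace E := by
    rw [← TopologicalSpace.isSeparable_univ_iff, ← hij]
    refine .union (isSeparable_range_of_eq_of_agree (n := n) (fun b => (hisom b).continuous)
      fun z b b' hb => ?_) (Set.countable_range j).isSeparable
    refine dist_le_zero.1 ((hi _ _).trans ((branchDist_le hb).trans_eq ?_))
    simp [q]
  obtain ⟨v, hv⟩ := hSuniv E hsepE hE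
  refine ⟨v ∘ j, fun e he => ?_⟩
  let b : B := ⟨e ∘ g, fun k l => (he.dist_eq _ _).trans (hg k l)⟩
  refine ⟨fun z => v (i (z, b)), hv.comp (hisom b), fun z => ⟨g (n z), ?_⟩⟩
  exact (hv.dist_eq _ _).trans_le (hnear (z, b))

/-- If `S_m` is indivisible, then every Urysohn sphere is `1/m`-indivisible. -/
theorem stmt10 (m : ℕ) (hm : 0 < m)
    (h : ∃ (Sm : Type) (_ : MetricSpace Sm),
      IsUrysohnSphereM m Sm ∧ EpsIndivisible Sm 0)
    (S : Type) [MetricSpace S] (hS : IsUrysohnSphere S) :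
    EpsIndivisible S (1/(m:ℝ)) := by
  obtain ⟨Sm, _, hSm, hind⟩ := h
  obtain ⟨j, hj⟩ := exists_isometry_forall_near hm hSm hS
  intro k hk χ
  obtain ⟨i, e, he, hcol⟩ := hind k hk (χ ∘ j)
  obtain ⟨f, hf, hnear⟩ := hj e he
  refine ⟨i, f, hf, fun z => ?_⟩
  obtain ⟨x, hx⟩ := hnear z
  obtain ⟨x', hx', hd⟩ := hcol x
  rw [dist_le_zero.1 hd] at hx
  exact ⟨j x', hx', hx⟩
end

section
/- Let m be a positive integer, let S_Q be a rational Urysohn sphere with a fixed enumeration {y_n : n ∈ ℕ}, and let X_m be the metric space on the same underlying set with metric ⌈d⌉_m(x,y) = ⌈m·d(x,y)⌉/m, writing x_n for the point y_n viewed in X_m. Then there exists a countable metric space Z with all distances in [0,1] containing X_m as a metric subspace such that for every strictly increasing σ : ℕ → ℕ for which x_n ↦ x_{σ(n)} is distance-preserving in X_m, the set {z ∈ Z : there exists n with d^Z(z, x_{σ(n)}) ≤ 1/m} contains a subset isometric to S_Q. -/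
open Metric

/-- Greedy modification of `ψ : ℕ → ℝ` into a function that is `1`-Lipschitz for the distance
pulled back along `y`: the value `ψ n` is clamped to the interval allowed by the earlier values. -/
noncomputable def clampLip {α : Type*} [PseudoMetricSpace α] (y : ℕ → α) (ψ : ℕ → ℝ) (n : ℕ) : ℝ :=
  ⨆ o : Option (Fin n), o.elim
    (⨅ o' : Option (Fin n), o'.elim (ψ n) fun i => clampLip y ψ i + dist (y i) (y n))
    fun i => clampLip y ψ i - dist (y i) (y n)
termination_by n
decreasing_by all_goals exact i.isLt

section ClampLip

variable {α : Type*} [PseudoMetricSpace α] (y : ℕ → α) (ψ : ℕ → ℝ)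

theorem sub_le_clampLip {i n : ℕ} (h : i < n) :
    clampLip y ψ i - dist (y i) (y n) ≤ clampLip y ψ n := by
  conv_rhs => rw [clampLip]
  exact le_ciSup (f := fun o : Option (Fin n) => o.elim
    (⨅ o' : Option (Fin n), o'.elim (ψ n) fun i => clampLip y ψ i + dist (y i) (y n))
    fun i => clampLip y ψ i - dist (y i) (y n)) (Set.finite_range _).bddAbove (some ⟨i, h⟩)

theorem iInf_le_clampLip (n : ℕ) :
    (⨅ o : Option (Fin n), o.elim (ψ n) fun i => clampLip y ψ i + dist (y i) (y n)) ≤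
      clampLip y ψ n := by
  conv_rhs => rw [clampLip]
  exact le_ciSup (f := fun o : Option (Fin n) => o.elim
    (⨅ o' : Option (Fin n), o'.elim (ψ n) fun i => clampLip y ψ i + dist (y i) (y n))
    fun i => clampLip y ψ i - dist (y i) (y n)) (Set.finite_range _).bddAbove none

theorem clampLip_eq_or (n : ℕ) :
    (clampLip y ψ n =
      ⨅ o : Option (Fin n), o.elim (ψ n) fun i => clampLip y ψ i + dist (y i) (y n)) ∨
    ∃ i < n, clampLip y ψ n = clampLip y ψ i - dist (y i) (y n) := by
  obtain ⟨o, ho⟩ := exists_eq_ciSup_of_finite (f := fun o : Option (Fin n) => o.elim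
    (⨅ o' : Option (Fin n), o'.elim (ψ n) fun i => clampLip y ψ i + dist (y i) (y n))
    fun i => clampLip y ψ i - dist (y i) (y n))
  rw [← clampLip] at ho
  cases o with
  | none => exact .inl ho.symm
  | some i => exact .inr ⟨i, i.isLt, ho.symm⟩

theorem abs_clampLip_sub_le (i n : ℕ) :
    |clampLip y ψ i - clampLip y ψ n| ≤ dist (y i) (y n) := by
  have key : ∀ n, ∀ i < n, |clampLip y ψ i - clampLip y ψ n| ≤ dist (y i) (y n) := by
    intro n
    induction n using Nat.strong_induction_on with
    | _ n ih =>
      intro i hi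
      have hlow := sub_le_clampLip y ψ hi
      rw [abs_le]
      refine ⟨?_, by linarith⟩
      rcases clampLip_eq_or y ψ n with h | ⟨j, hj, h⟩
      · have := ciInf_le (f := fun o : Option (Fin n) => o.elim (ψ n)
          fun i => clampLip y ψ i + dist (y i) (y n)) (Set.finite_range _).bddBelow
          (some ⟨i, hi⟩)
        simp only [Option.elim_some] at this
        linarith
      · have hij : |clampLip y ψ i - clampLip y ψ j| ≤ dist (y i) (y j) := by
          rcases lt_trichotomy i j with hlt | rfl | hlt
          · exact ih j hj i hlt
          · simp
          · rw [abs_sub_comm, dist_comm]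
            exact ih i hi j hlt
        have := (abs_le.1 hij).1
        have := dist_triangle_right (y i) (y j) (y n)
        linarith
  rcases lt_trichotomy i n with h | rfl | h
  · exact key n i h
  · simp
  · rw [abs_sub_comm, dist_comm]
    exact key i n h

theorem exists_clampLip_le (n : ℕ) : ∃ v ≤ n, clampLip y ψ n ≤ ψ v - dist (y v) (y n) := by
  induction n using Nat.strong_induction_on with
  | _ n ih =>
    rcases clampLip_eq_or y ψ n with h | ⟨i, hi, h⟩
    · refine ⟨n, le_rfl, ?_⟩
      rw [h, dist_self, sub_zero]
      exact ciInf_le (f := fun o : Option (Fin n) => o.elim (ψ n)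
        fun i => clampLip y ψ i + dist (y i) (y n)) (Set.finite_range _).bddBelow none
    · obtain ⟨v, hv, hle⟩ := ih i hi
      have := dist_triangle (y v) (y i) (y n)
      exact ⟨v, hv.trans hi.le, by linarith⟩

theorem exists_le_clampLip (n : ℕ) : ∃ v ≤ n, ψ v + dist (y v) (y n) ≤ clampLip y ψ n := by
  induction n using Nat.strong_induction_on with
  | _ n ih =>
    have hinf := iInf_le_clampLip y ψ n
    obtain ⟨o, ho⟩ := exists_eq_ciInf_of_finite (f := fun o : Option (Fin n) => o.elim (ψ n)
      fun i => clampLip y ψ i + dist (y i) (y n))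
    rw [← ho] at hinf
    cases o with
    | none => exact ⟨n, le_rfl, by simpa using hinf⟩
    | some i =>
      obtain ⟨v, hv, hle⟩ := ih i i.isLt
      have := dist_triangle (y v) (y i) (y n)
      simp only [Option.elim_some] at hinf
      exact ⟨v, hv.trans i.isLt.le, by linarith⟩

theorem abs_clampLip_sub_self_le {c : ℝ} (h : ∀ i j, ψ i - ψ j ≤ dist (y i) (y j) + c) (n : ℕ) :
    |clampLip y ψ n - ψ n| ≤ c := by
  obtain ⟨v, -, hv⟩ := exists_clampLip_le y ψ n
  obtain ⟨w, -, hw⟩ := exists_le_clampLip y ψ n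
  have h₁ := h v n
  have h₂ := h n w
  rw [dist_comm] at h₂
  rw [abs_le]
  constructor <;> linarith

theorem clampLip_mem_Icc {a b : ℝ} (h : ∀ i, ψ i ∈ Set.Icc a b) (n : ℕ) :
    clampLip y ψ n ∈ Set.Icc a b := by
  obtain ⟨v, -, hv⟩ := exists_clampLip_le y ψ n
  obtain ⟨w, -, hw⟩ := exists_le_clampLip y ψ n
  have h₁ := (h v).2
  have h₂ := (h w).1
  have h₃ := dist_nonneg (x := y v) (y := y n)
  have h₄ := dist_nonneg (x := y w) (y := y n)
  constructor <;> linarith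

variable {ψ} in
theorem clampLip_congr {ψ' : ℕ → ℝ} {n : ℕ} (h : ∀ i ≤ n, ψ i = ψ' i) :
    clampLip y ψ n = clampLip y ψ' n := by
  induction n using Nat.strong_induction_on with
  | _ n ih =>
    have hi : ∀ i : Fin n, clampLip y ψ i = clampLip y ψ' i := fun i =>
      ih i i.isLt fun j hj => h j (hj.trans i.isLt.le)
    rw [clampLip, clampLip]
    simp only [hi, h n le_rfl]

end ClampLip

/-- The distance `⌈m · dist⌉ / m`. -/
noncomputable def ceilDist {α : Type*} [PseudoMetricSpace α] (m : ℕ) (a b : α) : ℝ :=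
  (⌈(m : ℝ) * dist a b⌉ : ℝ) / m

section CeilDist

variable {α : Type*} [PseudoMetricSpace α] {m : ℕ}

theorem ceilDist_self (a : α) : ceilDist m a a = 0 := by simp [ceilDist]

theorem ceilDist_comm (a b : α) : ceilDist m a b = ceilDist m b a := by
  simp [ceilDist, dist_comm]

theorem ceilDist_triangle (a b c : α) :
    ceilDist m a c ≤ ceilDist m a b + ceilDist m b c := by
  rw [ceilDist, ceilDist, ceilDist, ← add_div]
  gcongr
  rw [← Int.cast_add]
  refine Int.cast_le.2 ((Int.ceil_mono ?_).trans (Int.ceil_add_le _ _))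
  rw [← mul_add]
  gcongr
  exact dist_triangle a b c

theorem ceilDist_nonneg (a b : α) : 0 ≤ ceilDist m a b :=
  div_nonneg (Int.cast_nonneg (Int.ceil_nonneg (by positivity))) (by positivity)

theorem ceilDist_le_one {a b : α} (h : dist a b ≤ 1) : ceilDist m a b ≤ 1 := by
  refine div_le_one_of_le₀ ?_ (by positivity)
  have : ⌈(m : ℝ) * dist a b⌉ ≤ (m : ℤ) := by
    rw [Int.ceil_le]
    simpa using mul_le_mul_of_nonneg_left h (Nat.cast_nonneg (α := ℝ) m)
  exact_mod_cast this

theorem dist_le_ceilDist (hm : 0 < m) (a b : α) : dist a b ≤ ceilDist m a b := by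
  rw [ceilDist, le_div_iff₀ (by positivity), mul_comm]
  exact Int.le_ceil _

theorem ceilDist_le_dist_add (hm : 0 < m) (a b : α) :
    ceilDist m a b ≤ dist a b + 1 / m := by
  have hm' : (0 : ℝ) < m := by positivity
  rw [ceilDist, div_le_iff₀ hm', add_mul, one_div, inv_mul_cancel₀ hm'.ne', mul_comm (dist a b)]
  exact (Int.ceil_lt_add_one _).le

end CeilDist

section Amalgam

variable {α : Type*} [PseudoMetricSpace α] {m : ℕ} {y : ℕ → α}

/-- The `[0,1]`-valued functions on `ℕ` that are `1`-Lipschitz for `⌈m · dist⌉ / m` pulled back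
along `y`. -/
def ceilLip (m : ℕ) (y : ℕ → α) : Set (ℕ → ℝ) :=
  {φ | (∀ n, φ n ∈ Set.Icc (0 : ℝ) 1) ∧ ∀ n k, φ n - φ k ≤ ceilDist m (y n) (y k)}

/-- The coordinates of the points of the amalgam: `Sum.inl n` is the `n`-th point of the original
space, and `Sum.inr l` is the tree node attached to the last entry of the finite sequence `l`. -/
noncomputable def amalgamCoord (y : ℕ → α) (φ : ℕ → ℝ) : ℕ ⊕ List ℕ → ℝ :=
  Sum.elim φ fun l => clampLip y (fun i => φ (l.getD i 0)) (l.length - 1)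

theorem amalgamCoord_mem_Icc {φ : ℕ → ℝ} (hφ : φ ∈ ceilLip m y) (v : ℕ ⊕ List ℕ) :
    amalgamCoord y φ v ∈ Set.Icc (0 : ℝ) 1 := by
  cases v with
  | inl n => exact hφ.1 n
  | inr l => exact clampLip_mem_Icc y _ (fun i => hφ.1 _) _

theorem memℓp_amalgamCoord (m : ℕ) (y : ℕ → α) (v : ℕ ⊕ List ℕ) :
    Memℓp (E := fun _ : ceilLip m y => ℝ) (fun φ => amalgamCoord y φ.1 v) ⊤ := by
  refine memℓp_infty ⟨1, ?_⟩
  rintro _ ⟨φ, rfl⟩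
  obtain ⟨h₀, h₁⟩ := amalgamCoord_mem_Icc φ.2 v
  simp only [Real.norm_eq_abs, abs_le]
  constructor <;> linarith

/-- The points of the amalgam, embedded in a space of bounded functions. -/
noncomputable def amalgamPoint (m : ℕ) (y : ℕ → α) (v : ℕ ⊕ List ℕ) :
    lp (fun _ : ceilLip m y => ℝ) ⊤ :=
  ⟨_, memℓp_amalgamCoord m y v⟩

theorem dist_amalgamPoint_le {v w : ℕ ⊕ List ℕ} {c : ℝ} (hc : 0 ≤ c)
    (h : ∀ φ ∈ ceilLip m y, |amalgamCoord y φ v - amalgamCoord y φ w| ≤ c) :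
    dist (amalgamPoint m y v) (amalgamPoint m y w) ≤ c := by
  rw [dist_eq_norm]
  exact lp.norm_le_of_forall_le hc fun φ => h φ.1 φ.2

theorem le_dist_amalgamPoint (v w : ℕ ⊕ List ℕ) {φ : ℕ → ℝ} (hφ : φ ∈ ceilLip m y) :
    |amalgamCoord y φ v - amalgamCoord y φ w| ≤
      dist (amalgamPoint m y v) (amalgamPoint m y w) := by
  rw [dist_eq_norm]
  exact lp.norm_apply_le_norm ENNReal.top_ne_zero
    (amalgamPoint m y v - amalgamPoint m y w) ⟨φ, hφ⟩

theorem dist_amalgamPoint_le_one (v w : ℕ ⊕ List ℕ) :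
    dist (amalgamPoint m y v) (amalgamPoint m y w) ≤ 1 := by
  refine dist_amalgamPoint_le zero_le_one fun φ hφ => ?_
  obtain ⟨h₀, h₁⟩ := amalgamCoord_mem_Icc hφ v
  obtain ⟨h₂, h₃⟩ := amalgamCoord_mem_Icc hφ w
  rw [abs_le]
  constructor <;> linarith

theorem dist_amalgamPoint_inl (hd : ∀ a b : α, dist a b ≤ 1) (n k : ℕ) :
    dist (amalgamPoint m y (.inl n)) (amalgamPoint m y (.inl k)) = ceilDist m (y n) (y k) := by
  apply le_antisymm
  · refine dist_amalgamPoint_le (ceilDist_nonneg _ _) fun φ hφ => abs_sub_le_iff.2 ⟨hφ.2 n k, ?_⟩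
    rw [ceilDist_comm]
    exact hφ.2 k n
  · have hφ : (fun i => ceilDist m (y i) (y k)) ∈ ceilLip m y :=
      ⟨fun i => ⟨ceilDist_nonneg _ _, ceilDist_le_one (hd _ _)⟩, fun i j => by
        linarith [ceilDist_triangle (m := m) (y i) (y j) (y k)]⟩
    have := le_dist_amalgamPoint (.inl n) (.inl k) hφ
    simp only [amalgamCoord, Sum.elim_inl, ceilDist_self, sub_zero] at this
    exact (le_abs_self _).trans this

/-- The tree node determined by the first `n + 1` values of `σ`. -/
def branchNode (σ : ℕ → ℕ) (n : ℕ) : ℕ ⊕ List ℕ := .inr ((List.range (n + 1)).map σ)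

theorem amalgamCoord_branchNode (y : ℕ → α) (φ : ℕ → ℝ) (σ : ℕ → ℕ) (n : ℕ) :
    amalgamCoord y φ (branchNode σ n) = clampLip y (φ ∘ σ) n := by
  simp only [amalgamCoord, branchNode, Sum.elim_inr, List.length_map, List.length_range,
    Nat.add_sub_cancel]
  refine clampLip_congr y fun i hi => ?_
  simp [List.getD_eq_getElem?_getD, List.getElem?_range (Nat.lt_succ_of_le hi)]

variable {σ : ℕ → ℕ}

theorem dist_branchNode_le (hm : 0 < m)
    (hσ : ∀ n k, ceilDist m (y (σ n)) (y (σ k)) = ceilDist m (y n) (y k)) (n : ℕ) :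
    dist (amalgamPoint m y (branchNode σ n)) (amalgamPoint m y (.inl (σ n))) ≤ 1 / m := by
  refine dist_amalgamPoint_le (by positivity) fun φ hφ => ?_
  rw [amalgamCoord_branchNode]
  refine abs_clampLip_sub_self_le y (φ ∘ σ) (fun i j => ?_) n
  exact (hφ.2 _ _).trans ((hσ i j).le.trans (ceilDist_le_dist_add hm _ _))

theorem exists_ceilLip_comp_eq_dist (hm : 0 < m) (hd : ∀ a b : α, dist a b ≤ 1)
    (hσ : ∀ n k, ceilDist m (y (σ n)) (y (σ k)) = ceilDist m (y n) (y k)) (n : ℕ) :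
    ∃ φ ∈ ceilLip m y, ∀ i, φ (σ i) = dist (y n) (y i) := by
  have hbdd : ∀ x, BddBelow (Set.range fun i => dist (y n) (y i) + ceilDist m (y (σ i)) (y x)) := by
    refine fun x => ⟨0, ?_⟩
    rintro _ ⟨i, rfl⟩
    exact add_nonneg dist_nonneg (ceilDist_nonneg _ _)
  refine ⟨fun x => min 1 (⨅ i, dist (y n) (y i) + ceilDist m (y (σ i)) (y x)),
    ⟨fun x => ⟨le_min zero_le_one (le_ciInf fun i =>
      add_nonneg dist_nonneg (ceilDist_nonneg _ _)), min_le_left _ _⟩, fun x x' => ?_⟩,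
    fun i => ?_⟩
  · rw [sub_le_iff_le_add', ← min_add_add_right]
    refine le_min ((min_le_left _ _).trans (by linarith [ceilDist_nonneg (m := m) (y x) (y x')]))
      ((min_le_right _ _).trans ?_)
    rw [← sub_le_iff_le_add]
    refine le_ciInf fun i => ?_
    have h₁ := ciInf_le (hbdd x) i
    have h₂ := ceilDist_triangle (m := m) (y (σ i)) (y x') (y x)
    rw [ceilDist_comm (y x')] at h₂
    linarith
  · apply le_antisymm
    · refine (min_le_right _ _).trans ((ciInf_le (hbdd _) i).trans ?_)
      simp [ceilDist_self]
    · refine le_min (hd _ _) (le_ciInf fun j => ?_)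
      rw [hσ]
      have h₁ := dist_triangle (y n) (y j) (y i)
      have h₂ := dist_le_ceilDist hm (y j) (y i)
      linarith

theorem dist_branchNode (hm : 0 < m) (hd : ∀ a b : α, dist a b ≤ 1)
    (hσ : ∀ n k, ceilDist m (y (σ n)) (y (σ k)) = ceilDist m (y n) (y k)) (n k : ℕ) :
    dist (amalgamPoint m y (branchNode σ n)) (amalgamPoint m y (branchNode σ k)) =
      dist (y n) (y k) := by
  apply le_antisymm
  · refine dist_amalgamPoint_le dist_nonneg fun φ _ => ?_
    rw [amalgamCoord_branchNode, amalgamCoord_branchNode]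
    exact abs_clampLip_sub_le y _ n k
  · obtain ⟨φ, hφ, hφσ⟩ := exists_ceilLip_comp_eq_dist hm hd hσ n
    have hclamp : ∀ i, clampLip y (φ ∘ σ) i = dist (y n) (y i) := by
      intro i
      have := abs_clampLip_sub_self_le y (φ ∘ σ) (c := 0) (fun i j => by
        simp only [Function.comp_apply, hφσ]
        have := dist_triangle_right (y n) (y i) (y j)
        linarith) i
      rw [← hφσ i]
      exact sub_eq_zero.1 (abs_nonpos_iff.1 this)
    have := le_dist_amalgamPoint (branchNode σ n) (branchNode σ k) hφ
    rw [amalgamCoord_branchNode, amalgamCoord_branchNode, hclamp, hclamp, dist_self, zero_sub,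
      abs_neg, abs_of_nonneg dist_nonneg] at this
    exact this

end Amalgam

/-- The hedgehog lemma: there is a countable metric space `Z` with distances in
`[0,1]` containing `X_m = (S_ℚ, ⌈d⌉_m)` such that for every strictly increasing
`σ` for which `x_n ↦ x_{σ(n)}` is distance preserving in `X_m`, the `1/m`-ball
around `{x_{σ(n)} : n ∈ ℕ}` inside `Z` contains an isometric copy of `S_ℚ`. -/
theorem stmt11 (m : ℕ) (hm : 0 < m)
    (SQ : Type) [MetricSpace SQ] (hSQ : IsRationalUrysohnSphere SQ)
    (y : ℕ → SQ) (hy : Function.Bijective y) :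
    ∃ (Z : Type) (_ : MetricSpace Z) (j : ℕ → Z),
      Countable Z ∧
      (∀ z z' : Z, dist z z' ∈ Set.Icc (0:ℝ) 1) ∧
      Function.Injective j ∧
      (∀ n k : ℕ, dist (j n) (j k) = (⌈(m : ℝ) * dist (y n) (y k)⌉ : ℝ) / m) ∧
      ∀ σ : ℕ → ℕ, StrictMono σ →
        (∀ n k : ℕ, (⌈(m : ℝ) * dist (y (σ n)) (y (σ k))⌉ : ℝ) / m =
          (⌈(m : ℝ) * dist (y n) (y k)⌉ : ℝ) / m) →
        ∃ C ⊆ {z : Z | ∃ n : ℕ, dist z (j (σ n)) ≤ 1/(m:ℝ)},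
          ∃ e : SQ → Z, Isometry e ∧ Set.range e = C := by
  have hd : ∀ a b : SQ, dist a b ≤ 1 := fun a b => by
    obtain ⟨q, -, hq, h⟩ := hSQ.2.2.1 a b
    rw [h]
    exact_mod_cast hq
  have hj : ∀ n k, dist (amalgamPoint m y (.inl n)) (amalgamPoint m y (.inl k)) =
      ceilDist m (y n) (y k) := dist_amalgamPoint_inl hd
  let pt : ℕ ⊕ List ℕ → Set.range (amalgamPoint m y) := Set.rangeFactorization _
  refine ⟨Set.range (amalgamPoint m y), inferInstance, fun n => pt (.inl n), ?_, ?_, ?_, hj, ?_⟩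
  · exact (Set.countable_range _).to_subtype
  · rintro ⟨_, v, rfl⟩ ⟨_, w, rfl⟩
    exact ⟨dist_nonneg, dist_amalgamPoint_le_one v w⟩
  · intro n k h
    have h₀ : ceilDist m (y n) (y k) = 0 := by
      rw [← hj]
      exact dist_eq_zero.2 (Subtype.ext_iff.1 h)
    exact hy.1 (dist_le_zero.1 ((dist_le_ceilDist hm _ _).trans h₀.le))
  · intro σ _ hσ
    let r := Equiv.ofBijective y hy
    refine ⟨Set.range fun p => pt (branchNode σ (r.symm p)), ?_,
      fun p => pt (branchNode σ (r.symm p)), Isometry.of_dist_eq fun p q => ?_, rfl⟩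
    · rintro _ ⟨p, rfl⟩
      exact ⟨r.symm p, dist_branchNode_le hm hσ _⟩
    · refine (dist_branchNode hm hd hσ _ _).trans ?_
      exact congrArg₂ dist (r.apply_symm_apply p) (r.apply_symm_apply q)
end

section
/- Let m be a positive integer. If some (equivalently, every) countable ultrahomogeneous metric space S_m with all distances in [0,1]_m into which every countable metric space with distances in [0,1]_m embeds isometrically is indivisible, then every countable ultrahomogeneous metric space S_{3m} with all distances in [0,1]_{3m} into which every countable metric space with distances in [0,1]_{3m} embeds isometrically is (2/(3m))-indivisible. -/
open Metric

/-- Any countable set with an integer pseudometric bounded by `K` maps into the Urysohn space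
with distances in `[0,1]_K`, with distances divided by `K`. -/
theorem IsUrysohnSphereM.exists_map {K : ℕ} {T : Type} [MetricSpace T]
    (hT : IsUrysohnSphereM K T) {V : Type} [Countable V] (ρ : V → V → ℕ)
    (self : ∀ u, ρ u u = 0) (symm : ∀ u v, ρ u v = ρ v u)
    (tri : ∀ u v w, ρ u w ≤ ρ u v + ρ v w) (bdd : ∀ u v, ρ u v ≤ K) :
    ∃ ψ : V → T, ∀ u v, dist (ψ u) (ψ v) = (ρ u v : ℝ) / K := by
  let _ : PseudoMetricSpace V :=
    { dist := fun u v => (ρ u v : ℝ) / K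
      dist_self := fun u => by simp [self]
      dist_comm := fun u v => by simp [symm u v]
      dist_triangle := fun u v w => by
        rw [← add_div]
        have := tri u v w
        gcongr
        exact_mod_cast this }
  have hc : Countable (SeparationQuotient V) :=
    SeparationQuotient.surjective_mk.countable
  obtain ⟨f, hf⟩ := hT.2.2.2 (SeparationQuotient V) hc (by
    intro a b
    obtain ⟨u, rfl⟩ := SeparationQuotient.surjective_mk a
    obtain ⟨v, rfl⟩ := SeparationQuotient.surjective_mk b
    exact ⟨ρ u v, bdd u v, SeparationQuotient.dist_mk u v⟩)
  exact ⟨fun u => f (SeparationQuotient.mk u), fun u v => by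
    rw [hf.dist_eq, SeparationQuotient.dist_mk]; rfl⟩

/-- An integer pseudometric determined by a family of bounded functions that are declared to be
`1`-Lipschitz. -/
theorem exists_pseudometric_of_lipschitz {V : Type} (K : ℕ) (L : Set (V → ℕ))
    (hL : ∀ f ∈ L, ∀ v, f v ≤ K) :
    ∃ ρ : V → V → ℕ, (∀ u, ρ u u = 0) ∧ (∀ u v, ρ u v = ρ v u) ∧
      (∀ u v w, ρ u w ≤ ρ u v + ρ v w) ∧ (∀ u v, ρ u v ≤ K) ∧
      ∀ u v n, ρ u v ≤ n ↔ ∀ f ∈ L, f u ≤ f v + n ∧ f v ≤ f u + n := by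
  let S : V → V → Set ℕ := fun u v => {n | ∀ f ∈ L, f u ≤ f v + n ∧ f v ≤ f u + n}
  have hK : ∀ u v, K ∈ S u v := fun u v f hf => by
    have := hL f hf u
    have := hL f hf v
    omega
  have key : ∀ u v n, sInf (S u v) ≤ n ↔ ∀ f ∈ L, f u ≤ f v + n ∧ f v ≤ f u + n := by
    intro u v n
    refine ⟨fun h f hf => ?_, fun h => Nat.sInf_le h⟩
    have := Nat.sInf_mem ⟨K, hK u v⟩ f hf
    omega
  refine ⟨fun u v => sInf (S u v), fun u => ?_, fun u v => ?_, fun u v w => ?_,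
    fun u v => Nat.sInf_le (hK u v), key⟩
  · exact Nat.le_zero.mp ((key u u 0).mpr fun f _ => by omega)
  · have : S u v = S v u := by ext n; exact forall₂_congr fun f _ => and_comm
    simp only [this]
  · refine (key u w _).mpr fun f hf => ?_
    have h1 := (key u v _).mp le_rfl f hf
    have h2 := (key v w _).mp le_rfl f hf
    dsimp only
    omega

namespace BranchSpace

/-- Points of a tree of partial maps from `X` to `M`: a branch `i : I`, codes a map `σ i`, and a
point `x` at which it is cut off (for the order given by `enc`), such that up to `x` the map
increases distances, by at most `2`. -/
def Node {X M I : Type} (d : X → X → ℕ) (D : M → M → ℕ) (enc : X → ℕ) (σ : I → X → M) : Type :=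
  {p : X × I // ∀ y z, enc y ≤ enc p.1 → enc z ≤ enc p.1 →
    d y z ≤ D (σ p.2 y) (σ p.2 z) ∧ D (σ p.2 y) (σ p.2 z) ≤ d y z + 2}

variable {X M I : Type} {d : X → X → ℕ} {D : M → M → ℕ} {enc : X → ℕ} {σ : I → X → M}

/-- The point of `X` at which a node is cut off. -/
def Node.pt (s : Node d D enc σ) : X := s.1.1

/-- The partial map of a node. -/
def Node.map (s : Node d D enc σ) : X → M := σ s.1.2

/-- The last value of the partial map of a node. -/
def Node.val (s : Node d D enc σ) : M := s.map s.pt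

theorem Node.le_dist (s : Node d D enc σ) {y z : X} (hy : enc y ≤ enc s.pt)
    (hz : enc z ≤ enc s.pt) : d y z ≤ D (s.map y) (s.map z) := (s.2 y z hy hz).1

theorem Node.dist_le (s : Node d D enc σ) {y z : X} (hy : enc y ≤ enc s.pt)
    (hz : enc z ≤ enc s.pt) : D (s.map y) (s.map z) ≤ d y z + 2 := (s.2 y z hy hz).2

/-- The nodes `s` and `t` both extend a common node cut off at `q`. -/
def Meet (q : X) (s t : Node d D enc σ) : Prop :=
  enc q ≤ enc s.pt ∧ enc q ≤ enc t.pt ∧ ∀ y, enc y ≤ enc q → s.map y = t.map y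

theorem Meet.symm {q : X} {s t : Node d D enc σ} (h : Meet q s t) : Meet q t s :=
  ⟨h.2.1, h.1, fun y hy => (h.2.2 y hy).symm⟩

theorem Meet.trans {q q' : X} {s t u : Node d D enc σ} (h : Meet q s t) (h' : Meet q' t u)
    (hq : enc q ≤ enc q') : Meet q s u :=
  ⟨h.1, hq.trans h'.2.1, fun y hy => (h.2.2 y hy).trans (h'.2.2 y (hy.trans hq))⟩

/-- The path distance in the tree of nodes, truncated at `K`. -/
noncomputable def treeDist (K : ℕ) (s t : Node d D enc σ) : ℕ :=
  sInf ({K} ∪ {n | ∃ q, Meet q s t ∧ n = d s.pt q + d q t.pt})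

theorem treeDist_le (K : ℕ) (s t : Node d D enc σ) : treeDist K s t ≤ K :=
  Nat.sInf_le (Or.inl rfl)

theorem treeDist_le_of_meet (K : ℕ) {s t : Node d D enc σ} {q : X} (h : Meet q s t) :
    treeDist K s t ≤ d s.pt q + d q t.pt :=
  Nat.sInf_le (Or.inr ⟨q, h, rfl⟩)

theorem treeDist_cases (K : ℕ) (s t : Node d D enc σ) :
    treeDist K s t = K ∨ ∃ q, Meet q s t ∧ treeDist K s t = d s.pt q + d q t.pt :=
  Nat.sInf_mem (s := {K} ∪ {n | ∃ q, Meet q s t ∧ n = d s.pt q + d q t.pt}) ⟨K, Or.inl rfl⟩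

variable {K : ℕ} (dself : ∀ x, d x x = 0) (dsymm : ∀ x y, d x y = d y x)
  (dtri : ∀ x y z, d x z ≤ d x y + d y z) (dK : ∀ x y, d x y ≤ K)
  (Dself : ∀ x, D x x = 0) (Dsymm : ∀ x y, D x y = D y x)
  (Dtri : ∀ x y z, D x z ≤ D x y + D y z) (DK : ∀ x y, D x y ≤ K)

include dself in
theorem treeDist_self (s : Node d D enc σ) : treeDist K s s = 0 := by
  have := treeDist_le_of_meet K (s := s) (t := s) (q := s.pt) ⟨le_rfl, le_rfl, fun _ _ => rfl⟩
  simpa [dself] using this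

include dsymm in
theorem treeDist_comm (s t : Node d D enc σ) : treeDist K s t = treeDist K t s := by
  have key : ∀ s t : Node d D enc σ, treeDist K s t ≤ treeDist K t s := by
    intro s t
    rcases treeDist_cases K t s with h | ⟨q, hq, h⟩
    · rw [h]; exact treeDist_le K s t
    · have := treeDist_le_of_meet K hq.symm
      rw [dsymm s.pt, dsymm q t.pt] at this
      omega
  exact le_antisymm (key s t) (key t s)

include dtri in
theorem treeDist_triangle (s t u : Node d D enc σ) :
    treeDist K s u ≤ treeDist K s t + treeDist K t u := by
  have hsu := treeDist_le K s u
  rcases treeDist_cases K s t with h | ⟨q, hq, h⟩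
  · omega
  rcases treeDist_cases K t u with h' | ⟨q', hq', h'⟩
  · omega
  have h3 := dtri q t.pt q'
  rcases le_total (enc q) (enc q') with hle | hle
  · have h1 := treeDist_le_of_meet K (hq.trans hq' hle)
    have h2 := dtri q q' u.pt
    omega
  · have h1 := treeDist_le_of_meet K (hq'.symm.trans hq.symm hle).symm
    have h2 := dtri s.pt q q'
    omega

include dself in
theorem treeDist_le_of_agree {s t : Node d D enc σ}
    (h : ∀ y, enc y ≤ enc s.pt → enc y ≤ enc t.pt → s.map y = t.map y) :
    treeDist K s t ≤ d s.pt t.pt := by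
  rcases le_total (enc s.pt) (enc t.pt) with hle | hle
  · have := treeDist_le_of_meet K (s := s) (t := t) (q := s.pt)
      ⟨le_rfl, hle, fun y hy => h y hy (hy.trans hle)⟩
    simpa [dself] using this
  · have := treeDist_le_of_meet K (s := s) (t := t) (q := t.pt)
      ⟨hle, le_rfl, fun y hy => h y (hy.trans hle) hy⟩
    simpa [dself] using this

theorem Meet.map_eq {q : X} {s t : Node d D enc σ} (h : Meet q s t) : s.map q = t.map q :=
  h.2.2 q le_rfl

include Dtri DK in
theorem le_treeDist_add_four (s t : Node d D enc σ) : D s.val t.val ≤ treeDist K s t + 4 := by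
  have := DK s.val t.val
  rcases treeDist_cases K s t with h | ⟨q, hq, h⟩
  · omega
  have h1 : D s.val (s.map q) ≤ _ := s.dist_le le_rfl hq.1
  have h2 : D (t.map q) t.val ≤ _ := t.dist_le hq.2.1 le_rfl
  have h3 := Dtri s.val (s.map q) t.val
  rw [hq.map_eq] at h1 h3
  omega

include dtri dK Dtri in
/-- A detour through `M` between two comparable nodes is not a shortcut. -/
theorem dist_le_detour {r r' : Node d D enc σ}
    (h : ∀ y, enc y ≤ enc r.pt → enc y ≤ enc r'.pt → r.map y = r'.map y)
    (t s : Node d D enc σ) :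
    d r.pt r'.pt ≤ treeDist K r t + D t.val s.val + treeDist K s r' + 4 := by
  have := dK r.pt r'.pt
  rcases treeDist_cases K r t with h1 | ⟨q, hq, h1⟩
  · omega
  rcases treeDist_cases K s r' with h2 | ⟨q', hq', h2⟩
  · omega
  have e1 : D (t.map q) t.val ≤ _ := t.dist_le hq.2.1 le_rfl
  have e2 : D s.val (s.map q') ≤ _ := s.dist_le le_rfl hq'.1
  have e3 := Dtri (t.map q) t.val (s.map q')
  have e4 := Dtri t.val s.val (s.map q')
  have e5 : d q q' ≤ D (t.map q) (s.map q') := by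
    rw [← hq.map_eq, hq'.map_eq]
    rcases le_total (enc r.pt) (enc r'.pt) with hle | hle
    · rw [h q hq.1 (hq.1.trans hle)]
      exact r'.le_dist (hq.1.trans hle) hq'.2.1
    · rw [← h q' (hq'.2.1.trans hle) hq'.2.1]
      exact r.le_dist hq.1 (hq'.2.1.trans hle)
  have e6 := dtri r.pt q r'.pt
  have e7 := dtri q q' r'.pt
  omega

/-- The admissible `1`-Lipschitz functions on the disjoint union of `M` and the tree. -/
def Lip (d : X → X → ℕ) (D : M → M → ℕ) (enc : X → ℕ) (σ : I → X → M) (K : ℕ) :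
    Set (M ⊕ Node d D enc σ → ℕ) :=
  {f | (∀ v, f v ≤ K) ∧ (∀ a b, f (Sum.inl a) ≤ f (Sum.inl b) + D a b) ∧
    (∀ s t, f (Sum.inr s) ≤ f (Sum.inr t) + treeDist K s t) ∧
    ∀ s, f (Sum.inr s) ≤ f (Sum.inl s.val) + 2 ∧ f (Sum.inl s.val) ≤ f (Sum.inr s) + 2}

/-- Extension of a function on `M` to the tree. -/
noncomputable def extend (K : ℕ) (g : M → ℕ) (t : Node d D enc σ) : ℕ :=
  min K (⨅ s : Node d D enc σ, (g s.val + 2 + treeDist K s t))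

theorem extend_le (g : M → ℕ) (s t : Node d D enc σ) :
    extend K g t ≤ g s.val + 2 + treeDist K s t :=
  (min_le_right _ _).trans (ciInf_le (OrderBot.bddBelow _) s)

theorem extend_cases (K : ℕ) (g : M → ℕ) (t : Node d D enc σ) :
    extend K g t = K ∨ ∃ s : Node d D enc σ, extend K g t = g s.val + 2 + treeDist K s t := by
  have : Nonempty (Node d D enc σ) := ⟨t⟩
  obtain ⟨s, hs⟩ := ciInf_mem fun s : Node d D enc σ => g s.val + 2 + treeDist K s t
  rcases min_choice K (⨅ s : Node d D enc σ, (g s.val + 2 + treeDist K s t)) with h | h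
  · exact Or.inl h
  · exact Or.inr ⟨s, h.trans hs.symm⟩

theorem extend_le_bound (g : M → ℕ) (t : Node d D enc σ) : extend K g t ≤ K := min_le_left _ _

include dsymm dtri in
theorem extend_lipschitz (g : M → ℕ) (t u : Node d D enc σ) :
    extend K g t ≤ extend K g u + treeDist K t u := by
  rcases extend_cases K g u with h | ⟨s, h⟩
  · have := extend_le_bound (K := K) g t
    omega
  · have h1 := extend_le (K := K) g s t
    have h2 := treeDist_triangle (K := K) dtri s u t
    rw [treeDist_comm dsymm u t] at h2
    omega

include dself in
theorem extend_le_add_two (g : M → ℕ) (t : Node d D enc σ) : extend K g t ≤ g t.val + 2 := by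
  have := extend_le (K := K) g t t
  rwa [treeDist_self dself] at this

include Dsymm Dtri DK in
theorem le_extend_add_two {g : M → ℕ} (gK : ∀ a, g a ≤ K) (hg : ∀ a b, g a ≤ g b + D a b)
    (t : Node d D enc σ) : g t.val ≤ extend K g t + 2 := by
  have := gK t.val
  rcases extend_cases K g t with h | ⟨s, h⟩
  · omega
  · have h1 := hg t.val s.val
    have h2 := le_treeDist_add_four Dtri DK s t
    rw [Dsymm s.val] at h2
    omega

include dself dsymm dtri Dsymm Dtri DK in
theorem elim_extend_mem_Lip {g : M → ℕ} (gK : ∀ a, g a ≤ K) (hg : ∀ a b, g a ≤ g b + D a b) :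
    Sum.elim g (extend K g) ∈ Lip d D enc σ K :=
  ⟨fun v => by cases v <;> simp [gK, extend_le_bound], hg, extend_lipschitz dsymm dtri g,
    fun s => ⟨extend_le_add_two dself g s, le_extend_add_two Dsymm Dtri DK gK hg s⟩⟩

/-- The distance to the node `r` along paths ending with a step from the tree to `M`. -/
noncomputable def distFrom (K : ℕ) (r : Node d D enc σ) (a : M) : ℕ :=
  ⨅ t : Node d D enc σ, min K (treeDist K r t + 2 + D t.val a)

theorem distFrom_le (r t : Node d D enc σ) (a : M) :
    distFrom K r a ≤ min K (treeDist K r t + 2 + D t.val a) :=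
  ciInf_le (OrderBot.bddBelow _) t

theorem distFrom_cases (K : ℕ) (r : Node d D enc σ) (a : M) :
    ∃ t : Node d D enc σ, distFrom K r a = min K (treeDist K r t + 2 + D t.val a) := by
  have : Nonempty (Node d D enc σ) := ⟨r⟩
  obtain ⟨t, ht⟩ := ciInf_mem fun t : Node d D enc σ => min K (treeDist K r t + 2 + D t.val a)
  exact ⟨t, ht.symm⟩

include Dsymm Dtri in
theorem distFrom_lipschitz (r : Node d D enc σ) (a b : M) :
    distFrom K r a ≤ distFrom K r b + D a b := by
  obtain ⟨t, h⟩ := distFrom_cases K r b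
  have h1 := distFrom_le (K := K) r t a
  have h2 := Dtri t.val b a
  rw [Dsymm b a] at h2
  omega

include dself dsymm dtri dK Dself Dsymm Dtri DK in
theorem exists_lip_separating {r r' : Node d D enc σ}
    (h : ∀ y, enc y ≤ enc r.pt → enc y ≤ enc r'.pt → r.map y = r'.map y) :
    ∃ f ∈ Lip d D enc σ K, f (Sum.inr r) = 0 ∧
      min (treeDist K r r') (d r.pt r'.pt) ≤ f (Sum.inr r') := by
  have gK : ∀ a, distFrom K r a ≤ K := fun a =>
    (distFrom_le r r a).trans (min_le_left _ _)
  have hg := distFrom_lipschitz (K := K) Dsymm Dtri r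
  refine ⟨Sum.elim (distFrom K r) fun t => min (treeDist K r t) (extend K (distFrom K r) t),
    ⟨?_, hg, ?_, ?_⟩, ?_, ?_⟩
  · rintro (a | t)
    · exact gK a
    · exact (min_le_left _ _).trans (treeDist_le K r t)
  · intro s t
    have h1 := extend_lipschitz (K := K) dsymm dtri (distFrom K r) s t
    have h2 := treeDist_triangle (K := K) dtri r t s
    rw [treeDist_comm dsymm t s] at h2
    simp only [Sum.elim_inr]
    omega
  · intro s
    have h1 := extend_le_add_two (K := K) dself (distFrom K r) s
    have h2 := le_extend_add_two Dsymm Dtri DK gK hg s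
    have h3 := distFrom_le (K := K) r s s.val
    rw [Dself] at h3
    simp only [Sum.elim_inr, Sum.elim_inl]
    omega
  · simp [treeDist_self dself]
  · simp only [Sum.elim_inr]
    refine min_le_min_left _ ?_
    have hK := dK r.pt r'.pt
    rcases extend_cases K (distFrom K r) r' with h1 | ⟨s, h1⟩
    · omega
    · obtain ⟨t, h2⟩ := distFrom_cases K r s.val
      have h3 := dist_le_detour dtri dK Dtri h t s
      omega

include dtri dK in
theorem le_treeDist (r r' : Node d D enc σ) : d r.pt r'.pt ≤ treeDist K r r' := by
  rcases treeDist_cases K r r' with h | ⟨q, -, h⟩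
  · rw [h]; exact dK _ _
  · rw [h]; exact dtri _ _ _

include dself dsymm dtri dK Dself Dsymm Dtri DK in
/-- The pseudometric on the disjoint union of `M` and the tree: it extends the distances on `M`
and along branches, and each node is at distance at most `2` from its last value. -/
theorem exists_pseudometric :
    ∃ ρ : M ⊕ Node d D enc σ → M ⊕ Node d D enc σ → ℕ,
      (∀ u, ρ u u = 0) ∧ (∀ u v, ρ u v = ρ v u) ∧
      (∀ u v w, ρ u w ≤ ρ u v + ρ v w) ∧ (∀ u v, ρ u v ≤ K) ∧
      (∀ a b, ρ (Sum.inl a) (Sum.inl b) = D a b) ∧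
      (∀ s, ρ (Sum.inr s) (Sum.inl s.val) ≤ 2) ∧
      ∀ r r' : Node d D enc σ,
        (∀ y, enc y ≤ enc r.pt → enc y ≤ enc r'.pt → r.map y = r'.map y) →
        ρ (Sum.inr r) (Sum.inr r') = d r.pt r'.pt := by
  obtain ⟨ρ, h1, h2, h3, h4, key⟩ :=
    exists_pseudometric_of_lipschitz K (Lip d D enc σ K) fun f hf => hf.1
  refine ⟨ρ, h1, h2, h3, h4, fun a b => le_antisymm ?_ ?_, fun s => ?_, fun r r' h =>
    le_antisymm ?_ ?_⟩
  · refine (key _ _ _).mpr fun f hf => ⟨hf.2.1 a b, ?_⟩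
    rw [Dsymm]; exact hf.2.1 b a
  · have := (key (Sum.inl a) (Sum.inl b) _).mp le_rfl _
      (elim_extend_mem_Lip (enc := enc) (σ := σ) dself dsymm dtri Dsymm Dtri DK (g := D a) (DK a)
        fun x y => by rw [Dsymm x y]; exact Dtri a y x)
    simpa [Dself] using this.2
  · exact (key _ _ _).mpr fun f hf => hf.2.2.2 s
  · refine (key _ _ _).mpr fun f hf => ?_
    have e1 := hf.2.2.1 r r'
    have e2 := hf.2.2.1 r' r
    rw [treeDist_comm dsymm r' r] at e2
    have e3 := treeDist_le_of_agree (K := K) dself h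
    omega
  · obtain ⟨f, hf, e1, e2⟩ := exists_lip_separating dself dsymm dtri dK Dself Dsymm Dtri DK h
    have e3 := (key (Sum.inr r) (Sum.inr r') _).mp le_rfl f hf
    have e4 := le_treeDist dtri dK r r'
    omega

end BranchSpace

/-- A countable family of maps into a countable space that interpolates every map on the initial
segments of a countable set. -/
theorem exists_countable_interpolating (X M : Type) [Countable M] (enc : X → ℕ)
    (henc : Function.Injective enc) :
    ∃ (I : Type) (σ : I → X → M), Countable I ∧
      ∀ (τ : X → M) (x : X), ∃ i, ∀ y, enc y ≤ enc x → σ i y = τ y := by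
  rcases isEmpty_or_nonempty M with hM | ⟨⟨a⟩⟩
  · exact ⟨PEmpty, fun i => i.elim, inferInstance, fun τ x => hM.elim (τ x)⟩
  · classical
    refine ⟨List M, fun l y => l.getD (enc y) a, inferInstance, fun τ x => ?_⟩
    let τ' : ℕ → M := fun n => if h : ∃ y, enc y = n then τ h.choose else a
    refine ⟨List.ofFn fun j : Fin (enc x + 1) => τ' j, fun y hy => ?_⟩
    have h : ∃ z, enc z = enc y := ⟨y, rfl⟩
    have hτ : τ' (enc y) = τ y := by
      simp only [τ', dif_pos h, henc h.choose_spec]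
    simp [List.getD_eq_getElem?_getD, Nat.lt_succ_of_le hy, hτ, -List.ofFn_succ]

/-- Distances in `[0,1]_K` are given by an integer metric bounded by `K`. -/
theorem exists_natDist {K : ℕ} (hK : 0 < K) {X : Type} [MetricSpace X]
    (hX : ∀ x y : X, dist x y ∈ distSetM K) :
    ∃ d : X → X → ℕ, (∀ x y, dist x y = (d x y : ℝ) / K) ∧ (∀ x, d x x = 0) ∧
      (∀ x y, d x y = 0 → x = y) ∧ (∀ x y, d x y = d y x) ∧
      (∀ x y z, d x z ≤ d x y + d y z) ∧ ∀ x y, d x y ≤ K := by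
  choose d hd1 hd2 using hX
  have hK' : (0 : ℝ) < K := by exact_mod_cast hK
  have hd : ∀ x y, (d x y : ℝ) = dist x y * K := fun x y => by
    rw [hd2]; field_simp
  refine ⟨d, hd2, fun x => ?_, fun x y h => ?_, fun x y => ?_, fun x y z => ?_, hd1⟩
  · have := hd x x
    rw [dist_self, zero_mul] at this
    exact_mod_cast this
  · have := hd2 x y
    rw [h, Nat.cast_zero, zero_div] at this
    exact dist_eq_zero.mp this
  · have := hd x y
    rw [dist_comm, ← hd] at this
    exact_mod_cast this
  · have := mul_le_mul_of_nonneg_right (dist_triangle x y z) hK'.le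
    rw [add_mul, ← hd, ← hd, ← hd] at this
    exact_mod_cast this

/-- If `S_m` is indivisible, then `S_{3m}` is `2/(3m)`-indivisible. -/
theorem stmt13 (m : ℕ) (hm : 0 < m)
    (h : ∃ (Sm : Type) (_ : MetricSpace Sm),
      IsUrysohnSphereM m Sm ∧ EpsIndivisible Sm 0)
    (T : Type) [MetricSpace T] (hT : IsUrysohnSphereM (3 * m) T) :
    EpsIndivisible T (2 / (3 * (m : ℝ))) := by
  obtain ⟨M, _, hM, hind⟩ := h
  have hm3 : 0 < 3 * m := by omega
  have hmR : (0 : ℝ) < m := by exact_mod_cast hm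
  have := hM.1
  have := hT.1
  obtain ⟨d, dd, dself, -, dsymm, dtri, dK⟩ := exists_natDist hm3 hT.2.2.1
  obtain ⟨D, DD, Dself, -, Dsymm, Dtri, DK⟩ := exists_natDist hm hM.2.2.1
  obtain ⟨enc, henc⟩ := exists_injective_nat T
  obtain ⟨I, σ, hI, hσ⟩ := exists_countable_interpolating T M enc henc
  let D' : M → M → ℕ := fun a b => 3 * D a b
  have hcount : Countable (BranchSpace.Node d D' enc σ) :=
    inferInstanceAs (Countable {p : T × I // _})
  obtain ⟨ρ, ρself, ρsymm, ρtri, ρK, ρM, ρval, ρbranch⟩ :=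
    BranchSpace.exists_pseudometric (enc := enc) (σ := σ) (D := D') dself dsymm dtri dK
      (fun a => by simp [D', Dself]) (fun a b => by simp [D', Dsymm a b])
      (fun a b c => by have := Dtri a b c; simp only [D']; omega)
      (fun a b => by have := DK a b; simp only [D']; omega)
  obtain ⟨ψ, hψ⟩ := hT.exists_map ρ ρself ρsymm ρtri ρK
  obtain ⟨θ, hθ⟩ := hM.exists_map (fun x y : T => (d x y + 2) / 3)
    (fun x => by simp [dself]) (fun x y => by simp [dsymm x y])
    (fun x y z => by have := dtri x y z; omega)
    (fun x y => by have := dK x y; omega)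
  intro k hk χ
  obtain ⟨i, e, he, hei⟩ := hind k hk fun a => χ (ψ (Sum.inl a))
  have hcol : ∀ a, χ (ψ (Sum.inl (e a))) = i := fun a => by
    obtain ⟨x, hx, hx'⟩ := hei a
    rwa [dist_le_zero.mp hx']
  have hD : ∀ x y : T, D (e (θ x)) (e (θ y)) = (d x y + 2) / 3 := fun x y => by
    have h1 := hθ x y
    rw [← he.dist_eq, DD, div_left_inj' hmR.ne'] at h1
    exact_mod_cast h1
  choose j hj using hσ fun x => e (θ x)
  let node : T → BranchSpace.Node d D' enc σ := fun x =>
    ⟨(x, j x), fun y z hy hz => by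
      simp only [hj x y hy, hj x z hz, D', hD]
      omega⟩
  refine ⟨i, fun x => ψ (Sum.inr (node x)), Isometry.of_dist_eq fun x y => ?_, fun x =>
    ⟨ψ (Sum.inl (e (θ x))), hcol _, ?_⟩⟩
  · rw [hψ, ρbranch (node x) (node y), dd]
    · rfl
    · exact fun z hx hy => (hj x z hx).trans (hj y z hy).symm
  · have hv : (node x).val = e (θ x) := hj x x le_rfl
    have h2 := ρval (node x)
    rw [hv] at h2
    rw [hψ]
    push_cast
    gcongr
    exact_mod_cast h2
end
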